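/- Let B be the open unit ball in ℝⁿ and let F = F(A,p,u,x) be a C² real-valued function on Symₙ(ℝ) × ℝⁿ × ℝ × B such that for each fixed p ∈ ℝⁿ the map (A,u,x) ↦ F(A⁻¹,p,u,x) is locally convex on Sym⁺ₙ(ℝ) × ℝ × B. Let u ∈ C³(B) be a convex solution of F(D²u, Du, u, x) = 0 on B satisfying the uniform ellipticity condition Λ⁻¹|ξ|² ≤ F^{ij}(D²u,Du,u,x) ξᵢ ξⱼ ≤ Λ|ξ|² for all ξ ∈ ℝⁿ and all x ∈ B, for some constant Λ > 0. Then the Hessian D²u has constant rank on B, i.e. the function x ↦ rank(D²u(x)) is constant on B. -/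

import Mathlib

open Metric

/-- The `i`-th partial derivative (0-based, junk value `0` if `i ≥ n`). -/
noncomputable def pd {n : ℕ} (f : EuclideanSpace ℝ (Fin n) → ℝ)
    (x : EuclideanSpace ℝ (Fin n)) (i : ℕ) : ℝ :=
  if h : i < n then fderiv ℝ f x (EuclideanSpace.single ⟨i, h⟩ 1) else 0

/-- The Hessian matrix of second partial derivatives. -/
noncomputable def hessM {n : ℕ} (u : EuclideanSpace ℝ (Fin n) → ℝ)
    (x : EuclideanSpace ℝ (Fin n)) : Matrix (Fin n) (Fin n) ℝ :=
  Matrix.of fun i j => pd (fun y => pd u y (j : ℕ)) x (i : ℕ)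

/-- The derivative `F^{ij}` of `F` in the matrix entry `A_{ij}`, evaluated at
`(D²u(x), Du(x), u(x), x)`. -/
noncomputable def Fmat {n : ℕ}
    (F : (Fin n → Fin n → ℝ) × (Fin n → ℝ) × ℝ × EuclideanSpace ℝ (Fin n) → ℝ)
    (u : EuclideanSpace ℝ (Fin n) → ℝ) (x : EuclideanSpace ℝ (Fin n)) (i j : Fin n) : ℝ :=
  fderiv ℝ (fun A => F (A, fun l => pd u x l, u x, x)) (fun a b => hessM u x a b)
    (fun a b => if a = i ∧ b = j then (1 : ℝ) else 0)

open Filter Topology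

/-- Necessary second-order condition at a local minimum on the line. -/
theorem second_deriv_nonneg_of_isLocalMin {f f' : ℝ → ℝ} {f'' x : ℝ}
    (h1 : ∀ᶠ t in 𝓝 x, HasDerivAt f (f' t) t) (h2 : HasDerivAt f' f'' x)
    (hmin : IsLocalMin f x) : 0 ≤ f'' := by
  by_contra hneg
  push Not at hneg
  have e1 : deriv f =ᶠ[𝓝 x] f' := h1.mono fun t ht => ht.deriv
  have hd0 : deriv f x = 0 := hmin.deriv_eq_zero
  have hdd : deriv (deriv f) x = f'' := by rw [e1.deriv_eq]; exact h2.deriv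
  have hneg' : deriv (deriv fun t => -f t) x > 0 := by
    have : (deriv fun t => -f t) = fun t => -deriv f t := by ext t; exact deriv.fun_neg
    rw [this, deriv.fun_neg, hdd]; linarith
  have hmax : IsLocalMin (fun t => -f t) x :=
    isLocalMin_of_deriv_deriv_pos hneg' (by rw [deriv.fun_neg, hd0, neg_zero])
      (h1.self_of_nhds.continuousAt.neg)
  have hconst : f =ᶠ[𝓝 x] fun _ => f x := by
    filter_upwards [hmin, hmax] with t ht1 ht2
    linarith
  have hf0 : f' =ᶠ[𝓝 x] fun _ => 0 := by
    have := hconst.deriv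
    filter_upwards [this, e1] with t ht ht'
    rw [← ht', ht]; simp
  have : deriv f' x = 0 := by rw [hf0.deriv_eq]; simp
  rw [h2.deriv] at this
  linarith

/-- A function lying below its symmetric averages has nonnegative second derivative. -/
theorem second_deriv_nonneg_of_midpoint {f f' : ℝ → ℝ} {f'' : ℝ}
    (h1 : ∀ᶠ t in 𝓝 (0 : ℝ), HasDerivAt f (f' t) t) (h2 : HasDerivAt f' f'' 0)
    (hmid : ∀ᶠ t in 𝓝 (0 : ℝ), 2 * f 0 ≤ f t + f (-t)) : 0 ≤ f'' := by
  have hneg : Tendsto (fun t : ℝ => -t) (𝓝 0) (𝓝 0) := by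
    simpa using (continuous_neg (G := ℝ)).tendsto 0
  have h1' : ∀ᶠ t in 𝓝 (0 : ℝ), HasDerivAt (fun s => f s + f (-s)) (f' t - f' (-t)) t := by
    filter_upwards [h1, hneg.eventually h1] with t ht ht'
    have := ht.add (ht'.scomp t (hasDerivAt_neg t))
    refine this.congr_deriv ?_
    simp; try ring
  have h2' : HasDerivAt (fun t => f' t - f' (-t)) (2 * f'') 0 := by
    have h2n : HasDerivAt f' f'' (-0) := by simpa using h2
    have := h2.sub (h2n.scomp 0 (hasDerivAt_neg 0))
    refine this.congr_deriv ?_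
    simp; try ring
  have := second_deriv_nonneg_of_isLocalMin h1' h2' (by
    filter_upwards [hmid] with t ht
    simp only [neg_zero]; linarith)
  linarith

open scoped MatrixOrder Matrix.Norms.L2Operator in
theorem Matrix.PosSemidef.exists_conjTranspose_mul_self {n : ℕ} {c : Matrix (Fin n) (Fin n) ℝ}
    (hc : c.PosSemidef) : ∃ D : Matrix (Fin n) (Fin n) ℝ, c = D.conjTranspose * D :=
  CStarAlgebra.nonneg_iff_eq_star_mul_self.mp hc.nonneg

/-- The trace of a product of two nonnegative quadratic forms is nonnegative. -/
theorem sum_mul_nonneg_of_quadForm {n : ℕ} {c A : Fin n → Fin n → ℝ}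
    (hcs : ∀ i j, c i j = c j i) (hc : ∀ ξ : Fin n → ℝ, 0 ≤ ∑ i, ∑ j, c i j * ξ i * ξ j)
    (hA : ∀ ξ : Fin n → ℝ, 0 ≤ ∑ i, ∑ j, A i j * ξ i * ξ j) :
    0 ≤ ∑ i, ∑ j, c i j * A i j := by
  have hps : (Matrix.of c).PosSemidef := by
    refine Matrix.PosSemidef.of_dotProduct_mulVec_nonneg ?_ ?_
    · ext i j; simp [hcs i j]
    · intro x
      refine (hc x).trans_eq ?_
      simp only [dotProduct, Matrix.mulVec, Matrix.of_apply, star_trivial, Finset.mul_sum]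
      refine Finset.sum_congr rfl fun i _ => Finset.sum_congr rfl fun j _ => by ring
  obtain ⟨D, hD⟩ : ∃ D : Matrix (Fin n) (Fin n) ℝ, Matrix.of c = D.conjTranspose * D :=
    hps.exists_conjTranspose_mul_self
  have hcD : ∀ i j, c i j = ∑ k, D k i * D k j := by
    intro i j
    have := congrFun (congrFun hD i) j
    simpa [Matrix.mul_apply] using this
  have : ∑ i, ∑ j, c i j * A i j = ∑ k, ∑ i, ∑ j, A i j * D k i * D k j := by
    simp_rw [hcD, Finset.sum_mul]
    rw [Finset.sum_comm]
    calc _ = ∑ j, ∑ k, ∑ i, D k i * D k j * A i j := 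
          Finset.sum_congr rfl fun j _ => Finset.sum_comm
      _ = ∑ k, ∑ j, ∑ i, D k i * D k j * A i j := Finset.sum_comm
      _ = _ := Finset.sum_congr rfl fun k _ => by
          rw [Finset.sum_comm]
          refine Finset.sum_congr rfl fun i _ => Finset.sum_congr rfl fun j _ => by ring
  rw [this]
  exact Finset.sum_nonneg fun k _ => hA (D k)

/-- Difference quotients with moving base point converge for strictly differentiable maps. -/
theorem HasStrictFDerivAt.tendsto_diffQuot {E G ι : Type*} [NormedAddCommGroup E]
    [NormedSpace ℝ E] [NormedAddCommGroup G] [NormedSpace ℝ G] {f : E → G} {f' : E →L[ℝ] G}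
    {a : E} (hf : HasStrictFDerivAt f f' a) {l : Filter ι} {x : ι → E} {h : ι → ℝ}
    (hx : Tendsto x l (𝓝 a)) (hh : Tendsto h l (𝓝 0)) (hne : ∀ k, h k ≠ 0) (e : E) :
    Tendsto (fun k => (h k)⁻¹ • (f (x k + h k • e) - f (x k))) l (𝓝 (f' e)) := by
  have hxe : Tendsto (fun k => x k + h k • e) l (𝓝 a) := by
    simpa using hx.add (hh.smul_const e)
  have ho := hf.isLittleO.comp_tendsto (hxe.prodMk_nhds hx)
  have ho2 : (fun k => f (x k + h k • e) - f (x k) - f' (h k • e)) =o[l] fun k => h k := by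
    have hb : (fun k => h k • e) =O[l] fun k => h k := by
      refine Asymptotics.IsBigO.of_bound ‖e‖ (Eventually.of_forall fun k => ?_)
      rw [norm_smul, mul_comm]
    refine Asymptotics.IsLittleO.trans_isBigO ?_ hb
    simpa [Function.comp_def] using ho
  have ho3 := (Asymptotics.isLittleO_iff_tendsto' (f := fun k => 
    ‖f (x k + h k • e) - f (x k) - f' (h k • e)‖) (g := h) (l := l)
    (Eventually.of_forall fun k hk => absurd hk (hne k))).1 ho2.norm_left
  rw [tendsto_iff_norm_sub_tendsto_zero]
  have := ho3.norm
  simp only [norm_zero] at this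
  refine this.congr fun k => ?_
  have : (h k)⁻¹ • (f (x k + h k • e) - f (x k)) - f' e
      = (h k)⁻¹ • (f (x k + h k • e) - f (x k) - f' (h k • e)) := by
    rw [map_smul, smul_sub, smul_sub, smul_sub, smul_smul, inv_mul_cancel₀ (hne k), one_smul]
  rw [this, norm_smul, norm_div, norm_norm, norm_inv, div_eq_inv_mul]

/-- The linear form with coefficients `w`. -/
noncomputable def linForm {n : ℕ} (w : Fin n → ℝ) : EuclideanSpace ℝ (Fin n) →L[ℝ] ℝ :=
  ∑ i, w i • EuclideanSpace.proj i

theorem linForm_apply {n : ℕ} (w : Fin n → ℝ) (v : EuclideanSpace ℝ (Fin n)) :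
    linForm w v = ∑ i, w i * v i := by
  simp [linForm]

theorem linForm_single {n : ℕ} (w : Fin n → ℝ) (i : Fin n) :
    linForm w (EuclideanSpace.single i 1) = w i := by
  simp [linForm_apply]

theorem eq_linForm {n : ℕ} (L : EuclideanSpace ℝ (Fin n) →L[ℝ] ℝ) :
    L = linForm fun i => L (EuclideanSpace.single i 1) := by
  ext v
  rw [linForm_apply]
  conv_lhs => rw [← (EuclideanSpace.basisFun (Fin n) ℝ).sum_repr v]
  simp [mul_comm]

/-- `f` has gradient `f1` and Hessian `f2` on `s`. -/
structure HasHessianOn {n : ℕ} (f : EuclideanSpace ℝ (Fin n) → ℝ)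
    (f1 : EuclideanSpace ℝ (Fin n) → Fin n → ℝ)
    (f2 : EuclideanSpace ℝ (Fin n) → Fin n → Fin n → ℝ)
    (s : Set (EuclideanSpace ℝ (Fin n))) : Prop where
  grad : ∀ x ∈ s, HasFDerivAt f (linForm (f1 x)) x
  hess : ∀ x ∈ s, ∀ i, HasFDerivAt (fun y => f1 y i) (linForm (f2 x i)) x

section
variable {n : ℕ} {s : Set (EuclideanSpace ℝ (Fin n))}

theorem HasHessianOn.isLocalMin {f : EuclideanSpace ℝ (Fin n) → ℝ} {f1 f2}
    (hf : HasHessianOn f f1 f2 s) (hs : IsOpen s) {x : EuclideanSpace ℝ (Fin n)} (hx : x ∈ s)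
    (hmin : IsLocalMin f x) (w : Fin n → ℝ) : 0 ≤ ∑ i, ∑ j, f2 x i j * w i * w j := by
  set W : EuclideanSpace ℝ (Fin n) := WithLp.toLp 2 w with hW
  have hWi : ∀ i, W i = w i := fun i => rfl
  set γ : ℝ → EuclideanSpace ℝ (Fin n) := fun t => x + t • W with hγ
  have hγd : ∀ t, HasDerivAt γ W t := fun t => by
    have := ((hasDerivAt_id t).smul_const W).const_add x
    rwa [one_smul] at this
  have hγ0 : γ 0 = x := by simp [hγ]
  have hγc : Tendsto γ (𝓝 0) (𝓝 x) := by
    have := (hγd 0).continuousAt.tendsto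
    rwa [hγ0] at this
  have h1 : ∀ᶠ t in 𝓝 (0 : ℝ), HasDerivAt (f ∘ γ) (∑ i, f1 (γ t) i * w i) t := by
    filter_upwards [hγc.eventually (hs.mem_nhds hx)] with t ht
    have := (hf.grad _ ht).comp_hasDerivAt t (hγd t)
    rwa [linForm_apply] at this
  have h2 : HasDerivAt (fun t => ∑ i, f1 (γ t) i * w i) (∑ i, (∑ j, f2 x i j * w j) * w i) 0 := by
    refine HasDerivAt.fun_sum fun i _ => ?_
    have hx' : γ 0 ∈ s := by rw [hγ0]; exact hx
    have := (hf.hess _ hx' i).comp_hasDerivAt (0 : ℝ) (hγd 0)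
    rw [linForm_apply, hγ0] at this
    exact this.mul_const _
  have := second_deriv_nonneg_of_isLocalMin h1 h2 (by
    have : IsLocalMin f (γ 0) := by rw [hγ0]; exact hmin
    exact this.comp_tendsto (by rw [hγ0]; exact hγc))
  refine this.trans_eq (Finset.sum_congr rfl fun i _ => ?_)
  rw [Finset.sum_mul]
  exact Finset.sum_congr rfl fun j _ => by ring

theorem linForm_add (a b : Fin n → ℝ) : linForm (fun i => a i + b i) = linForm a + linForm b := by
  ext v; simp [linForm_apply, add_mul, Finset.sum_add_distrib]

theorem linForm_smul (r : ℝ) (a : Fin n → ℝ) : linForm (fun i => r * a i) = r • linForm a := by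
  ext v; simp [linForm_apply, mul_assoc, Finset.mul_sum]

theorem linForm_sum {ι : Type*} (t : Finset ι) (a : ι → Fin n → ℝ) :
    linForm (fun i => ∑ k ∈ t, a k i) = ∑ k ∈ t, linForm (a k) := by
  ext v
  simp only [linForm_apply, Finset.sum_mul, sum_apply]
  exact Finset.sum_comm

theorem HasHessianOn.add {f g : EuclideanSpace ℝ (Fin n) → ℝ} {f1 f2 g1 g2}
    (hf : HasHessianOn f f1 f2 s) (hg : HasHessianOn g g1 g2 s) :
    HasHessianOn (fun x => f x + g x) (fun x i => f1 x i + g1 x i)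
      (fun x i j => f2 x i j + g2 x i j) s where
  grad x hx := by rw [linForm_add]; exact (hf.grad x hx).add (hg.grad x hx)
  hess x hx i := by rw [linForm_add]; exact (hf.hess x hx i).add (hg.hess x hx i)

theorem HasHessianOn.sum {ι : Type*} (t : Finset ι) {f : ι → EuclideanSpace ℝ (Fin n) → ℝ}
    {f1 : ι → EuclideanSpace ℝ (Fin n) → Fin n → ℝ}
    {f2 : ι → EuclideanSpace ℝ (Fin n) → Fin n → Fin n → ℝ}
    (hf : ∀ k ∈ t, HasHessianOn (f k) (f1 k) (f2 k) s) :
    HasHessianOn (fun x => ∑ k ∈ t, f k x) (fun x i => ∑ k ∈ t, f1 k x i)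
      (fun x i j => ∑ k ∈ t, f2 k x i j) s where
  grad x hx := by
    rw [linForm_sum]; exact HasFDerivAt.fun_sum fun k hk => (hf k hk).grad x hx
  hess x hx i := by
    rw [linForm_sum]; exact HasFDerivAt.fun_sum fun k hk => (hf k hk).hess x hx i

theorem HasHessianOn.mul {f g : EuclideanSpace ℝ (Fin n) → ℝ} {f1 f2 g1 g2}
    (hf : HasHessianOn f f1 f2 s) (hg : HasHessianOn g g1 g2 s) :
    HasHessianOn (fun x => f x * g x) (fun x i => f x * g1 x i + g x * f1 x i)
      (fun x i j => (f x * g2 x i j + g1 x i * f1 x j) + (g x * f2 x i j + f1 x i * g1 x j)) s where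
  grad x hx := by
    rw [linForm_add, linForm_smul, linForm_smul]
    exact (hf.grad x hx).mul (hg.grad x hx)
  hess x hx i := by
    rw [linForm_add, linForm_add, linForm_add, linForm_smul, linForm_smul, linForm_smul,
      linForm_smul]
    exact ((hf.grad x hx).mul (hg.hess x hx i)).add ((hg.grad x hx).mul (hf.hess x hx i))

theorem HasHessianOn.affine (r : ℝ) (w : Fin n → ℝ) (x0 : EuclideanSpace ℝ (Fin n)) :
    HasHessianOn (fun x => r + ∑ i, w i * (x i - x0 i)) (fun _ i => w i) (fun _ _ _ => 0) s where
  grad x _ := by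
    have h := ((linForm w).hasFDerivAt (x := x - x0)).comp x ((hasFDerivAt_id x).sub_const x0)
    have h' := h.const_add r
    refine h'.congr_of_eventuallyEq (Eventually.of_forall fun y => ?_)
    simp [linForm_apply]
  hess x _ i := by
    have : linForm (fun _ : Fin n => (0 : ℝ)) = 0 := by ext v; simp [linForm_apply]
    rw [this]; exact hasFDerivAt_const _ _

end

/-- On `B`, the field `H` is the (symmetric) derivative of `p` and `J` the continuous, fully
symmetric derivative of `H`. -/
structure HessianJet {n : ℕ} (B : Set (EuclideanSpace ℝ (Fin n)))
    (p : EuclideanSpace ℝ (Fin n) → Fin n → ℝ)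
    (H : EuclideanSpace ℝ (Fin n) → Matrix (Fin n) (Fin n) ℝ)
    (J : EuclideanSpace ℝ (Fin n) → Fin n → Matrix (Fin n) (Fin n) ℝ) : Prop where
  isOpen : IsOpen B
  strict_p : ∀ x ∈ B, ∀ b, HasStrictFDerivAt (fun y => p y b) (linForm fun a => H x a b) x
  strict_H : ∀ x ∈ B, ∀ a b, HasStrictFDerivAt (fun y => H y a b) (linForm fun i => J x i a b) x
  cont_J : ∀ i a b, ContinuousOn (fun y => J y i a b) B
  symm_H : ∀ x ∈ B, ∀ a b, H x a b = H x b a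
  symm_J : ∀ x ∈ B, ∀ i a b, J x i a b = J x i b a
  symm_J' : ∀ x ∈ B, ∀ i a b, J x i a b = J x a i b

section
variable {n : ℕ}

theorem HasHessianOn.translate {s t : Set (EuclideanSpace ℝ (Fin n))}
    {f : EuclideanSpace ℝ (Fin n) → ℝ} {f1 f2}
    (hf : HasHessianOn f f1 f2 t) (v : EuclideanSpace ℝ (Fin n)) (hs : ∀ x ∈ s, x + v ∈ t) :
    HasHessianOn (fun x => f (x + v)) (fun x i => f1 (x + v) i)
      (fun x i j => f2 (x + v) i j) s where
  grad x hx := by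
    simpa [Function.comp_def] using (hf.grad _ (hs x hx)).comp x ((hasFDerivAt_id x).add_const v)
  hess x hx i := by
    simpa [Function.comp_def] using (hf.hess _ (hs x hx) i).comp x ((hasFDerivAt_id x).add_const v)

theorem HasHessianOn.mono {s t : Set (EuclideanSpace ℝ (Fin n))}
    {f : EuclideanSpace ℝ (Fin n) → ℝ} {f1 f2}
    (hf : HasHessianOn f f1 f2 t) (hs : s ⊆ t) : HasHessianOn f f1 f2 s where
  grad _ hx := hf.grad _ (hs hx)
  hess _ hx := hf.hess _ (hs hx)

theorem HasHessianOn.const_mul {s : Set (EuclideanSpace ℝ (Fin n))}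
    {f : EuclideanSpace ℝ (Fin n) → ℝ} {f1 f2}
    (hf : HasHessianOn f f1 f2 s) (r : ℝ) :
    HasHessianOn (fun x => r * f x) (fun x i => r * f1 x i) (fun x i j => r * f2 x i j) s where
  grad x hx := by rw [linForm_smul]; exact (hf.grad _ hx).const_mul r
  hess x hx i := by rw [linForm_smul]; exact (hf.hess _ hx i).const_mul r

theorem linForm_sub (a b : Fin n → ℝ) : linForm (fun i => a i - b i) = linForm a - linForm b := by
  ext v; simp [linForm_apply, sub_mul, Finset.sum_sub_distrib]

theorem HasHessianOn.sub {s : Set (EuclideanSpace ℝ (Fin n))}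
    {f g : EuclideanSpace ℝ (Fin n) → ℝ} {f1 f2 g1 g2}
    (hf : HasHessianOn f f1 f2 s) (hg : HasHessianOn g g1 g2 s) :
    HasHessianOn (fun x => f x - g x) (fun x i => f1 x i - g1 x i)
      (fun x i j => f2 x i j - g2 x i j) s where
  grad x hx := by rw [linForm_sub]; exact (hf.grad x hx).sub (hg.grad x hx)
  hess x hx i := by rw [linForm_sub]; exact (hf.hess x hx i).sub (hg.hess x hx i)

theorem HasHessianOn.sqDist (x0 : EuclideanSpace ℝ (Fin n)) (s : Set (EuclideanSpace ℝ (Fin n))) :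
    HasHessianOn (fun x => ∑ i, (x i - x0 i) ^ 2) (fun x i => 2 * (x i - x0 i))
      (fun _ i j => if i = j then 2 else 0) s where
  grad x _ := by
    rw [linForm_sum_single]
    refine HasFDerivAt.fun_sum fun i _ => ?_
    have h : HasFDerivAt (fun y : EuclideanSpace ℝ (Fin n) => y i - x0 i)
      (EuclideanSpace.proj i : EuclideanSpace ℝ (Fin n) →L[ℝ] ℝ) x :=
      (EuclideanSpace.proj i : EuclideanSpace ℝ (Fin n) →L[ℝ] ℝ).hasFDerivAt.sub_const _
    have := h.pow 2
    simpa using this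
  hess x _ i := by
    have h : HasFDerivAt (fun y : EuclideanSpace ℝ (Fin n) => y i - x0 i)
      (EuclideanSpace.proj i : EuclideanSpace ℝ (Fin n) →L[ℝ] ℝ) x :=
      (EuclideanSpace.proj i : EuclideanSpace ℝ (Fin n) →L[ℝ] ℝ).hasFDerivAt.sub_const _
    refine (h.const_mul 2).congr_fderiv ?_
    ext v
    simp [linForm_apply]
where
  linForm_sum_single (w : Fin n → ℝ) :
    linForm w = ∑ i, w i • (EuclideanSpace.proj i : EuclideanSpace ℝ (Fin n) →L[ℝ] ℝ) := rfl

variable {B : Set (EuclideanSpace ℝ (Fin n))} {p : EuclideanSpace ℝ (Fin n) → Fin n → ℝ}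
  {H : EuclideanSpace ℝ (Fin n) → Matrix (Fin n) (Fin n) ℝ}
  {J : EuclideanSpace ℝ (Fin n) → Fin n → Matrix (Fin n) (Fin n) ℝ}

theorem HessianJet.hasHessianOn (hd : HessianJet B p H J) (b : Fin n) :
    HasHessianOn (fun x => p x b) (fun x i => H x i b) (fun x i j => J x j i b) B where
  grad x hx := (hd.strict_p x hx b).hasFDerivAt
  hess x hx i := (hd.strict_H x hx i b).hasFDerivAt

theorem HessianJet.tendsto_quot_p (hd : HessianJet B p H J) {ι : Type*} {l : Filter ι}
    {x : ι → EuclideanSpace ℝ (Fin n)} {h : ι → ℝ} {a : EuclideanSpace ℝ (Fin n)} (ha : a ∈ B)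
    (hx : Tendsto x l (𝓝 a)) (hh : Tendsto h l (𝓝 0)) (hne : ∀ k, h k ≠ 0) (i b : Fin n) :
    Tendsto (fun k => (h k)⁻¹ * (p (x k + h k • EuclideanSpace.single i 1) b - p (x k) b)) l
      (𝓝 (H a i b)) := by
  have := (hd.strict_p a ha b).tendsto_diffQuot hx hh hne (EuclideanSpace.single i 1)
  rwa [linForm_single] at this

theorem HessianJet.tendsto_quot_H (hd : HessianJet B p H J) {ι : Type*} {l : Filter ι}
    {x : ι → EuclideanSpace ℝ (Fin n)} {h : ι → ℝ} {a : EuclideanSpace ℝ (Fin n)} (ha : a ∈ B)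
    (hx : Tendsto x l (𝓝 a)) (hh : Tendsto h l (𝓝 0)) (hne : ∀ k, h k ≠ 0) (i b c : Fin n) :
    Tendsto (fun k => (h k)⁻¹ * (H (x k + h k • EuclideanSpace.single i 1) b c - H (x k) b c)) l
      (𝓝 (J a i b c)) := by
  have := (hd.strict_H a ha b c).tendsto_diffQuot hx hh hne (EuclideanSpace.single i 1)
  rwa [linForm_single] at this

/-- The limit of the traces of the difference quotients of `J` against `c` at `x1` is `G`. -/
def IsTraceLimit (c : EuclideanSpace ℝ (Fin n) → Fin n → Fin n → ℝ)
    (J : EuclideanSpace ℝ (Fin n) → Fin n → Matrix (Fin n) (Fin n) ℝ)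
    (x1 : EuclideanSpace ℝ (Fin n)) (G : Fin n → Fin n → ℝ) : Prop :=
  ∀ (l : Filter ℕ) (x : ℕ → EuclideanSpace ℝ (Fin n)) (h : ℕ → ℝ), Tendsto x l (𝓝 x1) →
    Tendsto h l (𝓝 0) → (∀ k, h k ≠ 0) → ∀ a b, Tendsto (fun k => ∑ i, ∑ j, c (x k) i j *
      ((h k)⁻¹ * (J (x k + h k • EuclideanSpace.single a 1) j i b - J (x k) j i b))) l (𝓝 (G a b))

theorem HessianJet.second_order_of_strict_min (hd : HessianJet B p H J)
    {c : EuclideanSpace ℝ (Fin n) → Fin n → Fin n → ℝ} (hcs : ∀ x ∈ B, ∀ i j, c x i j = c x j i)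
    (hcp : ∀ x ∈ B, ∀ ξ : Fin n → ℝ, 0 ≤ ∑ i, ∑ j, c x i j * ξ i * ξ j)
    (hcc : ∀ i j, ContinuousOn (fun x => c x i j) B)
    {x1 : EuclideanSpace ℝ (Fin n)} (hx1 : x1 ∈ B) {G : Fin n → Fin n → ℝ}
    (hG : IsTraceLimit c J x1 G)
    {W : Fin n → Fin n → EuclideanSpace ℝ (Fin n) → ℝ}
    {W1 : Fin n → Fin n → EuclideanSpace ℝ (Fin n) → Fin n → ℝ}
    {W2 : Fin n → Fin n → EuclideanSpace ℝ (Fin n) → Fin n → Fin n → ℝ}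
    (hW : ∀ a b, HasHessianOn (W a b) (W1 a b) (W2 a b) Set.univ)
    (hW2 : ∀ a b i j, Continuous fun x => W2 a b x i j)
    {ψ : EuclideanSpace ℝ (Fin n) → ℝ} {ψ1 : EuclideanSpace ℝ (Fin n) → Fin n → ℝ}
    {ψ2 : EuclideanSpace ℝ (Fin n) → Fin n → Fin n → ℝ}
    (hψ : HasHessianOn ψ ψ1 ψ2 Set.univ) (hψ2 : ∀ i j, Continuous fun x => ψ2 x i j)
    {ρ : ℝ} (hρ : 0 < ρ)
    (hmin : ∀ x ∈ closedBall x1 ρ, x ≠ x1 → (∑ a, ∑ b, W a b x1 * H x1 a b) + ψ x1 <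
      (∑ a, ∑ b, W a b x * H x a b) + ψ x) :
    0 ≤ ∑ a, ∑ b, (W a b x1 * G a b + ∑ i, ∑ j, c x1 i j *
        (W1 a b x1 i * J x1 a j b + (H x1 a b * W2 a b x1 i j + J x1 a i b * W1 a b x1 j)))
      + ∑ i, ∑ j, c x1 i j * ψ2 x1 i j := by
  obtain ⟨r, hr, hrB⟩ := Metric.isOpen_iff.1 hd.isOpen x1 hx1
  set R := min ρ (r / 3) with hR
  have hR0 : 0 < R := lt_min hρ (by positivity)
  have hRr : R ≤ r / 3 := min_le_right _ _
  have hRB : ∀ x ∈ closedBall x1 R, x ∈ B := fun x hx =>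
    hrB (by rw [mem_ball]; have := mem_closedBall.1 hx; linarith)
  set h : ℕ → ℝ := fun k => R * (1 / ((k : ℝ) + 1)) with hh
  have hpos : ∀ k, 0 < h k := fun k => by positivity
  have hne : ∀ k, h k ≠ 0 := fun k => (hpos k).ne'
  have hle : ∀ k, h k ≤ R := fun k => by
    have : 1 / ((k : ℝ) + 1) ≤ 1 := by
      rw [div_le_one (by positivity)]; linarith [Nat.cast_nonneg (α := ℝ) k]
    calc h k ≤ R * 1 := mul_le_mul_of_nonneg_left this hR0.le
      _ = R := mul_one R
  have hshift : ∀ k a, ∀ x ∈ ball x1 (2 * R), x + h k • EuclideanSpace.single a (1 : ℝ) ∈ B := by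
    intro k a x hx
    refine hrB (mem_ball.2 ?_)
    calc dist (x + h k • EuclideanSpace.single a (1 : ℝ)) x1
        ≤ dist (x + h k • EuclideanSpace.single a (1 : ℝ)) x + dist x x1 := dist_triangle _ _ _
      _ = h k + dist x x1 := by
        rw [dist_eq_norm, add_sub_cancel_left, norm_smul]
        simp [abs_of_pos (hpos k)]
      _ < r := by have := hle k; have := mem_ball.1 hx; linarith
  have hballB : ball x1 (2 * R) ⊆ B := fun x hx =>
    hrB (by rw [mem_ball]; have := mem_ball.1 hx; linarith)
  have hHk : ∀ k a b, HasHessianOn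
      (fun x => (h k)⁻¹ * (p (x + h k • EuclideanSpace.single a 1) b - p x b))
      (fun x i => (h k)⁻¹ * (H (x + h k • EuclideanSpace.single a 1) i b - H x i b))
      (fun x i j => (h k)⁻¹ * (J (x + h k • EuclideanSpace.single a 1) j i b - J x j i b))
      (ball x1 (2 * R)) := fun k a b =>
    (((hd.hasHessianOn b).translate _ (hshift k a)).sub
      ((hd.hasHessianOn b).mono hballB)).const_mul _
  have hTk := fun k => (HasHessianOn.sum Finset.univ fun a _ => HasHessianOn.sum Finset.univ
    fun b _ => ((hW a b).mono (Set.subset_univ _)).mul (hHk k a b)).add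
      (hψ.mono (Set.subset_univ (ball x1 (2 * R))))
  set T : ℕ → EuclideanSpace ℝ (Fin n) → ℝ := fun k x => (∑ a, ∑ b, W a b x *
    ((h k)⁻¹ * (p (x + h k • EuclideanSpace.single a 1) b - p x b))) + ψ x with hT
  have hsub : closedBall x1 R ⊆ ball x1 (2 * R) := closedBall_subset_ball (by linarith)
  have hmink : ∀ k, ∃ x ∈ closedBall x1 R, IsMinOn (T k) (closedBall x1 R) x := fun k =>
    (isCompact_closedBall x1 R).exists_isMinOn ⟨x1, mem_closedBall_self hR0.le⟩
      (fun x hx => ((hTk k).grad x (hsub hx)).continuousAt.continuousWithinAt)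
  choose x hx hxmin using hmink
  set l : Ultrafilter ℕ := hyperfilter ℕ with hl
  obtain ⟨a0, ha0, hla0⟩ := (isCompact_closedBall x1 R).ultrafilter_le_nhds (l.map x)
    (by rw [Ultrafilter.coe_map, le_principal_iff]; exact Filter.mem_map.2 (Filter.univ_mem' hx))
  have hxl : Tendsto x l (𝓝 a0) := hla0
  have hhl : Tendsto h l (𝓝 0) := by
    have : Tendsto h atTop (𝓝 0) := by
      simpa [hh] using (tendsto_one_div_add_atTop_nhds_zero_nat (𝕜 := ℝ)).const_mul R
    exact this.mono_left Nat.hyperfilter_le_atTop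
  have hlim : ∀ (y : ℕ → EuclideanSpace ℝ (Fin n)) (y0 : EuclideanSpace ℝ (Fin n)),
      y0 ∈ B → Tendsto y l (𝓝 y0) →
      Tendsto (fun k => T k (y k)) l (𝓝 ((∑ a, ∑ b, W a b y0 * H y0 a b) + ψ y0)) := by
    intro y y0 hy0 hy
    refine Tendsto.add (tendsto_finsetSum Finset.univ fun a _ =>
      tendsto_finsetSum Finset.univ fun b _ => ?_) ?_
    · exact (((hW a b).grad y0 trivial).continuousAt.tendsto.comp hy).mul
        (hd.tendsto_quot_p hy0 hy hhl hne a b)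
    · exact (hψ.grad y0 trivial).continuousAt.tendsto.comp hy
  have hcmp : (∑ a, ∑ b, W a b a0 * H a0 a b) + ψ a0 ≤ (∑ a, ∑ b, W a b x1 * H x1 a b) + ψ x1 :=
    le_of_tendsto_of_tendsto' (hlim x a0 (hRB _ ha0) hxl)
      (hlim (fun _ => x1) x1 hx1 tendsto_const_nhds) fun k =>
        hxmin k (mem_closedBall_self hR0.le)
  have ha01 : a0 = x1 := by
    by_contra hne'
    exact absurd hcmp (not_le.2 (hmin a0 (closedBall_subset_closedBall (min_le_left _ _) ha0) hne'))
  subst ha01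
  have hcl : ∀ i j, Tendsto (fun k => c (x k) i j) l (𝓝 (c a0 i j)) := fun i j =>
    ((hcc i j).continuousAt (hd.isOpen.mem_nhds hx1)).tendsto.comp hxl
  have hW0 : ∀ a b, Tendsto (fun k => W a b (x k)) l (𝓝 (W a b a0)) := fun a b =>
    ((hW a b).grad a0 trivial).continuousAt.tendsto.comp hxl
  have hW1 : ∀ a b i, Tendsto (fun k => W1 a b (x k) i) l (𝓝 (W1 a b a0 i)) := fun a b i =>
    ((hW a b).hess a0 trivial i).continuousAt.tendsto.comp hxl
  have hW2' : ∀ a b i j, Tendsto (fun k => W2 a b (x k) i j) l (𝓝 (W2 a b a0 i j)) :=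
    fun a b i j => (hW2 a b i j).continuousAt.tendsto.comp hxl
  have hψ2' : ∀ i j, Tendsto (fun k => ψ2 (x k) i j) l (𝓝 (ψ2 a0 i j)) :=
    fun i j => (hψ2 i j).continuousAt.tendsto.comp hxl
  have hq := fun a b => hd.tendsto_quot_p hx1 hxl hhl hne a b
  have hqH := fun a b i => hd.tendsto_quot_H hx1 hxl hhl hne a b i
  have hGl := hG l x h hxl hhl hne
  have hfin := (Tendsto.add (tendsto_finsetSum Finset.univ fun a _ =>
    tendsto_finsetSum Finset.univ fun b _ =>
      ((hW0 a b).mul (hGl a b)).add (tendsto_finsetSum Finset.univ fun i _ =>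
      tendsto_finsetSum Finset.univ fun j _ => (hcl i j).mul (((hW1 a b i).mul (hqH a j b)).add
        (((hq a b).mul (hW2' a b i j)).add ((hqH a i b).mul (hW1 a b j))))))
    (tendsto_finsetSum Finset.univ fun i _ => tendsto_finsetSum Finset.univ fun j _ =>
      (hcl i j).mul (hψ2' i j)))
  refine ge_of_tendsto hfin ?_
  have hev : ∀ᶠ k in (l : Filter ℕ), x k ∈ ball a0 R := hxl.eventually (ball_mem_nhds a0 hR0)
  filter_upwards [hev] with k hk
  have hlm : IsLocalMin (T k) (x k) := (hxmin k).isLocalMin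
    (mem_of_superset (isOpen_ball.mem_nhds hk) ball_subset_closedBall)
  have key := sum_mul_nonneg_of_quadForm (hcs (x k) (hRB _ (hx k))) (hcp (x k) (hRB _ (hx k)))
    ((hTk k).isLocalMin isOpen_ball (hsub (hx k)) hlm)
  refine key.trans_eq ?_
  simp only [mul_add, Finset.mul_sum, Finset.sum_add_distrib]
  congr 1
  simp only [← Finset.sum_add_distrib, ← mul_add]
  have swap : ∀ f : Fin n → Fin n → Fin n → Fin n → ℝ,
      ∑ i, ∑ j, ∑ a, ∑ b, f i j a b = ∑ a, ∑ b, ∑ i, ∑ j, f i j a b := by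
    intro f
    calc _ = ∑ i, ∑ a, ∑ j, ∑ b, f i j a b := Finset.sum_congr rfl fun i _ => Finset.sum_comm
      _ = ∑ a, ∑ i, ∑ j, ∑ b, f i j a b := Finset.sum_comm
      _ = ∑ a, ∑ i, ∑ b, ∑ j, f i j a b := Finset.sum_congr rfl fun a _ =>
          Finset.sum_congr rfl fun i _ => Finset.sum_comm
      _ = _ := Finset.sum_congr rfl fun a _ => Finset.sum_comm
  rw [swap]
  refine Finset.sum_congr rfl fun a _ => Finset.sum_congr rfl fun b _ => ?_
  refine Finset.sum_congr rfl fun i _ => Finset.sum_congr rfl fun j _ => ?_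
  ring

theorem HessianJet.second_order_of_isLocalMin (hd : HessianJet B p H J)
    {c : EuclideanSpace ℝ (Fin n) → Fin n → Fin n → ℝ} (hcs : ∀ x ∈ B, ∀ i j, c x i j = c x j i)
    (hcp : ∀ x ∈ B, ∀ ξ : Fin n → ℝ, 0 ≤ ∑ i, ∑ j, c x i j * ξ i * ξ j)
    (hcc : ∀ i j, ContinuousOn (fun x => c x i j) B)
    {x1 : EuclideanSpace ℝ (Fin n)} (hx1 : x1 ∈ B) {G : Fin n → Fin n → ℝ}
    (hG : IsTraceLimit c J x1 G)
    {W : Fin n → Fin n → EuclideanSpace ℝ (Fin n) → ℝ}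
    {W1 : Fin n → Fin n → EuclideanSpace ℝ (Fin n) → Fin n → ℝ}
    {W2 : Fin n → Fin n → EuclideanSpace ℝ (Fin n) → Fin n → Fin n → ℝ}
    (hW : ∀ a b, HasHessianOn (W a b) (W1 a b) (W2 a b) Set.univ)
    (hW2 : ∀ a b i j, Continuous fun x => W2 a b x i j)
    {φ : EuclideanSpace ℝ (Fin n) → ℝ} {φ1 : EuclideanSpace ℝ (Fin n) → Fin n → ℝ}
    {φ2 : EuclideanSpace ℝ (Fin n) → Fin n → Fin n → ℝ}
    (hφ : HasHessianOn φ φ1 φ2 Set.univ) (hφ2 : ∀ i j, Continuous fun x => φ2 x i j)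
    (hmin : IsLocalMin (fun x => (∑ a, ∑ b, W a b x * H x a b) - φ x) x1) :
    ∑ i, ∑ j, c x1 i j * φ2 x1 i j ≤
      ∑ a, ∑ b, (W a b x1 * G a b + ∑ i, ∑ j, c x1 i j *
        (2 * (J x1 i a b * W1 a b x1 j) + H x1 a b * W2 a b x1 i j)) := by
  obtain ⟨ρ, hρ, hρmin⟩ := Metric.nhds_basis_closedBall.eventually_iff.1 hmin
  have hδ : ∀ δ : ℝ, 0 < δ → ∑ i, ∑ j, c x1 i j * φ2 x1 i j ≤
      ∑ a, ∑ b, (W a b x1 * G a b + ∑ i, ∑ j, c x1 i j *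
        (W1 a b x1 i * J x1 a j b + (H x1 a b * W2 a b x1 i j + J x1 a i b * W1 a b x1 j)))
      + (∑ i, c x1 i i * 2) * δ := by
    intro δ hδ
    have h := hd.second_order_of_strict_min hcs hcp hcc hx1 hG hW hW2
      (((HasHessianOn.sqDist x1 Set.univ).const_mul δ).sub hφ)
      (fun i j => continuous_const.sub (hφ2 i j)) hρ (by
        intro x hx hne
        have h1 := hρmin hx
        have h2 : 0 < ∑ i, (x i - x1 i) ^ 2 := by
          obtain ⟨i, hi⟩ : ∃ i, x i ≠ x1 i := by
            by_contra! hall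
            exact hne (by ext i; exact hall i)
          exact Finset.sum_pos' (fun _ _ => sq_nonneg _)
            ⟨i, Finset.mem_univ i, by have := sub_ne_zero.2 hi; positivity⟩
        have h3 := mul_pos hδ h2
        simp only [sub_self, ne_eq, OfNat.ofNat_ne_zero, not_false_eq_true, zero_pow,
          Finset.sum_const_zero, mul_zero]
        linarith)
    have e : ∑ i, ∑ j, c x1 i j * (δ * (if i = j then 2 else 0) - φ2 x1 i j)
        = (∑ i, c x1 i i * 2) * δ - ∑ i, ∑ j, c x1 i j * φ2 x1 i j := by
      simp only [mul_sub, Finset.sum_sub_distrib, mul_ite, mul_zero, Finset.sum_ite_eq,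
        Finset.mem_univ, if_true, Finset.sum_mul]
      congr 1
      exact Finset.sum_congr rfl fun i _ => by ring
    rw [e] at h
    linarith
  have hlim : ∑ i, ∑ j, c x1 i j * φ2 x1 i j ≤
      ∑ a, ∑ b, (W a b x1 * G a b + ∑ i, ∑ j, c x1 i j *
        (W1 a b x1 i * J x1 a j b + (H x1 a b * W2 a b x1 i j + J x1 a i b * W1 a b x1 j))) := by
    have ht : Tendsto (fun δ : ℝ => ∑ a, ∑ b, (W a b x1 * G a b + ∑ i, ∑ j, c x1 i j *
        (W1 a b x1 i * J x1 a j b + (H x1 a b * W2 a b x1 i j + J x1 a i b * W1 a b x1 j)))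
        + (∑ i, c x1 i i * 2) * δ) (𝓝[>] 0) (𝓝 (∑ a, ∑ b, (W a b x1 * G a b + ∑ i, ∑ j, c x1 i j *
        (W1 a b x1 i * J x1 a j b + (H x1 a b * W2 a b x1 i j + J x1 a i b * W1 a b x1 j)))
        + (∑ i, c x1 i i * 2) * 0)) :=
      (Continuous.tendsto (by fun_prop) 0).mono_left nhdsWithin_le_nhds
    rw [mul_zero, add_zero] at ht
    exact ge_of_tendsto ht (eventually_mem_nhdsWithin.mono fun δ h => hδ δ h)
  refine hlim.trans_eq (Finset.sum_congr rfl fun a _ => Finset.sum_congr rfl fun b _ => ?_)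
  congr 1
  have e1 : ∑ i, ∑ j, c x1 i j * (W1 a b x1 i * J x1 j a b)
      = ∑ i, ∑ j, c x1 i j * (J x1 i a b * W1 a b x1 j) := by
    rw [Finset.sum_comm]
    refine Finset.sum_congr rfl fun i _ => Finset.sum_congr rfl fun j _ => ?_
    rw [hcs x1 hx1 j i]; ring
  have e2 : ∀ i, J x1 a i b = J x1 i a b := fun i => hd.symm_J' x1 hx1 a i b
  simp only [mul_add, Finset.sum_add_distrib, e2, e1]
  simp only [← Finset.sum_add_distrib]
  refine Finset.sum_congr rfl fun i _ => Finset.sum_congr rfl fun j _ => ?_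
  ring

theorem HessianJet.first_order_of_isLocalMin (hd : HessianJet B p H J)
    {x1 : EuclideanSpace ℝ (Fin n)} (hx1 : x1 ∈ B)
    {W : Fin n → Fin n → EuclideanSpace ℝ (Fin n) → ℝ}
    {W1 : Fin n → Fin n → EuclideanSpace ℝ (Fin n) → Fin n → ℝ}
    {W2 : Fin n → Fin n → EuclideanSpace ℝ (Fin n) → Fin n → Fin n → ℝ}
    (hW : ∀ a b, HasHessianOn (W a b) (W1 a b) (W2 a b) Set.univ)
    {φ : EuclideanSpace ℝ (Fin n) → ℝ} {φ1 : EuclideanSpace ℝ (Fin n) → Fin n → ℝ}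
    {φ2 : EuclideanSpace ℝ (Fin n) → Fin n → Fin n → ℝ}
    (hφ : HasHessianOn φ φ1 φ2 Set.univ)
    (hmin : IsLocalMin (fun x => (∑ a, ∑ b, W a b x * H x a b) - φ x) x1) (i : Fin n) :
    φ1 x1 i = ∑ a, ∑ b, (W a b x1 * J x1 i a b + H x1 a b * W1 a b x1 i) := by
  have h : HasFDerivAt (fun x => (∑ a, ∑ b, W a b x * H x a b) - φ x)
      (linForm fun i => (∑ a, ∑ b, (W a b x1 * J x1 i a b + H x1 a b * W1 a b x1 i)) - φ1 x1 i)
      x1 := by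
    simp only [linForm_sub, linForm_sum, linForm_add, linForm_smul]
    exact (HasFDerivAt.fun_sum fun a _ => HasFDerivAt.fun_sum fun b _ =>
      ((hW a b).grad x1 trivial).mul (hd.strict_H x1 hx1 a b).hasFDerivAt).sub (hφ.grad x1 trivial)
  have := linForm_single (fun i => (∑ a, ∑ b, (W a b x1 * J x1 i a b + H x1 a b * W1 a b x1 i))
    - φ1 x1 i) i
  rw [hmin.hasFDerivAt_eq_zero h] at this
  simp only [zero_apply] at this
  linarith

end

open Matrix in
theorem Matrix.PosDef.eventually_sub_smul {n : ℕ} {P N : Matrix (Fin n) (Fin n) ℝ} (hP : P.PosDef)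
    (hN : N.IsHermitian) : ∀ᶠ t in 𝓝 (0 : ℝ), (P - t • N).PosDef := by
  have hev : ∀ᶠ t in 𝓝 (0 : ℝ), ∀ ξ ∈ sphere (0 : Fin n → ℝ) 1, 0 < ξ ⬝ᵥ ((P - t • N) *ᵥ ξ) := by
    refine (isCompact_sphere _ _).eventually_forall_of_forall_eventually fun ξ hξ => ?_
    have hc : Continuous fun q : ℝ × (Fin n → ℝ) => q.2 ⬝ᵥ ((P - q.1 • N) *ᵥ q.2) := by fun_prop
    refine (hc.continuousAt (x := (0, ξ))).eventually (lt_mem_nhds ?_)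
    have hne : ξ ≠ 0 := by
      rintro rfl
      simp at hξ
    simpa using (Matrix.posDef_iff_dotProduct_mulVec.1 hP).2 hne
  filter_upwards [hev] with t ht
  refine Matrix.posDef_iff_dotProduct_mulVec.2
    ⟨hP.isHermitian.sub (hN.smul (IsSelfAdjoint.all t)), fun ξ hξ => ?_⟩
  have hnorm : 0 < ‖ξ‖ := norm_pos_iff.2 hξ
  have h := ht (‖ξ‖⁻¹ • ξ) (by simp [norm_smul, hnorm.ne'])
  rw [Matrix.mulVec_smul, smul_dotProduct, dotProduct_smul, smul_eq_mul, smul_eq_mul] at h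
  rw [star_trivial]
  have h1 : 0 < ‖ξ‖⁻¹ := inv_pos.2 hnorm
  exact pos_of_mul_pos_right (pos_of_mul_pos_right h h1.le) h1.le

theorem Matrix.continuousAt_inv_apply {n : ℕ} {X : Type*} [TopologicalSpace X]
    {f : X → Matrix (Fin n) (Fin n) ℝ} {x : X} (hf : ContinuousAt f x) (hx : (f x).det ≠ 0) :
    ContinuousAt (fun y => (f y)⁻¹) x := by
  have h1 : ContinuousAt (fun y => (f y).det⁻¹ • (f y).adjugate) x := by
    have hd : ContinuousAt (fun y => (f y).det) x :=
      (Continuous.matrix_det continuous_id).continuousAt.comp hf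
    have ha : ContinuousAt (fun y => (f y).adjugate) x :=
      (Continuous.matrix_adjugate continuous_id).continuousAt.comp hf
    exact (hd.inv₀ hx).smul ha
  refine h1.congr (Eventually.of_forall fun y => ?_)
  simp [Matrix.inv_def]

theorem hasDerivAt_inv_sub_smul {n : ℕ} {P N : Matrix (Fin n) (Fin n) ℝ} {s : ℝ}
    (hs : ∀ᶠ t in 𝓝 s, (P - t • N).det ≠ 0) (i j : Fin n) :
    HasDerivAt (fun t : ℝ => (P - t • N)⁻¹ i j)
      (((P - s • N)⁻¹ * N * (P - s • N)⁻¹) i j) s := by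
  rw [hasDerivAt_iff_tendsto_slope]
  have hc : ContinuousAt (fun t : ℝ => ((P - t • N)⁻¹ * N * (P - s • N)⁻¹) i j) s := by
    have h1 : ContinuousAt (fun t : ℝ => (P - t • N)⁻¹) s :=
      Matrix.continuousAt_inv_apply (by fun_prop) hs.self_of_nhds
    have h2 : Continuous fun M : Matrix (Fin n) (Fin n) ℝ => (M * N * (P - s • N)⁻¹) i j := by
      fun_prop
    exact h2.continuousAt.comp h1
  refine (hc.tendsto.mono_left nhdsWithin_le_nhds).congr' ?_
  filter_upwards [nhdsWithin_le_nhds hs, self_mem_nhdsWithin] with t ht hts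
  have hts' : t - s ≠ 0 := sub_ne_zero.2 hts
  have hut : IsUnit (P - t • N).det := isUnit_iff_ne_zero.2 ht
  have hus : IsUnit (P - s • N).det := isUnit_iff_ne_zero.2 hs.self_of_nhds
  have e : (P - t • N)⁻¹ - (P - s • N)⁻¹ = (t - s) • ((P - t • N)⁻¹ * N * (P - s • N)⁻¹) := by
    calc (P - t • N)⁻¹ - (P - s • N)⁻¹
        = (P - t • N)⁻¹ * ((P - s • N) * (P - s • N)⁻¹)
          - ((P - t • N)⁻¹ * (P - t • N)) * (P - s • N)⁻¹ := by
          rw [Matrix.mul_nonsing_inv _ hus, Matrix.nonsing_inv_mul _ hut, mul_one, one_mul]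
      _ = (P - t • N)⁻¹ * ((t - s) • N) * (P - s • N)⁻¹ := by
          rw [sub_smul]; noncomm_ring
      _ = _ := by simp
  rw [slope_def_field]
  have e' := congrFun (congrFun e i) j
  rw [Matrix.sub_apply, Matrix.smul_apply, smul_eq_mul] at e'
  rw [e', mul_div_assoc, mul_comm, div_mul_cancel₀ _ hts']

/-- Local convexity of `(A, s, x) ↦ F (A⁻¹, p, s, x)` near positive definite `A`, with `x ∈ B`. -/
def InverseConvex {n : ℕ} (B : Set (EuclideanSpace ℝ (Fin n)))
    (F : (Fin n → Fin n → ℝ) × (Fin n → ℝ) × ℝ × EuclideanSpace ℝ (Fin n) → ℝ) : Prop :=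
  ∀ p : Fin n → ℝ,
      ∀ z ∈ {w : (Fin n → Fin n → ℝ) × ℝ × EuclideanSpace ℝ (Fin n) |
          (Matrix.of w.1).PosDef ∧ w.2.2 ∈ B},
        ∃ t, IsOpen t ∧ z ∈ t ∧
          ConvexOn ℝ
            ({w : (Fin n → Fin n → ℝ) × ℝ × EuclideanSpace ℝ (Fin n) |
                (Matrix.of w.1).PosDef ∧ w.2.2 ∈ B} ∩ t)
            (fun w => F (fun i j => (Matrix.of w.1)⁻¹ i j, p, w.2.1, w.2.2))

section
variable {n : ℕ} {B : Set (EuclideanSpace ℝ (Fin n))}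
  {F : (Fin n → Fin n → ℝ) × (Fin n → ℝ) × ℝ × EuclideanSpace ℝ (Fin n) → ℝ}

theorem InverseConvex.second_deriv_nonneg_of_posDef (hB : IsOpen B)
    (hF : ContDiffOn ℝ 2 F {z | z.2.2.2 ∈ B}) (hconv : InverseConvex B F)
    {A N : Matrix (Fin n) (Fin n) ℝ} (hA : A.PosDef) (hN : N.IsHermitian) (p : Fin n → ℝ)
    (s₀ s : ℝ) {x : EuclideanSpace ℝ (Fin n)} (hx : x ∈ B) (y : EuclideanSpace ℝ (Fin n)) :
    0 ≤ fderiv ℝ (fderiv ℝ F) (A, p, s₀, x) (A * N * A, 0, s, y) (A * N * A, 0, s, y)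
      + fderiv ℝ F (A, p, s₀, x) ((2 : ℝ) • (A * N * A * N * A), 0, 0, 0) := by
  have hopen : IsOpen {z : (Fin n → Fin n → ℝ) × (Fin n → ℝ) × ℝ × EuclideanSpace ℝ (Fin n) |
      z.2.2.2 ∈ B} := hB.preimage (by fun_prop)
  set P := A⁻¹ with hP
  have hAu : IsUnit A.det := isUnit_iff_ne_zero.2 hA.det_pos.ne'
  have hPinv : P⁻¹ = A := Matrix.nonsing_inv_nonsing_inv A hAu
  have hpd : ∀ᶠ t in 𝓝 (0 : ℝ), (P - t • N).PosDef := hA.inv.eventually_sub_smul hN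
  have hxt : ∀ᶠ t in 𝓝 (0 : ℝ), x + t • y ∈ B := by
    have : ContinuousAt (fun t : ℝ => x + t • y) 0 := by fun_prop
    exact this.eventually (hB.mem_nhds (by simpa using hx))
  set R : ℝ → Matrix (Fin n) (Fin n) ℝ := fun t => (P - t • N)⁻¹ with hR
  have hR0 : R 0 = A := by simp [hR, hPinv]
  have hRd : ∀ᶠ t in 𝓝 (0 : ℝ), ∀ i j, HasDerivAt (fun t => R t i j) ((R t * N * R t) i j) t := by
    filter_upwards [hpd.eventually_nhds] with t ht i j
    exact hasDerivAt_inv_sub_smul (ht.mono fun τ h => h.det_pos.ne') i j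
  set γ : ℝ → (Fin n → Fin n → ℝ) × (Fin n → ℝ) × ℝ × EuclideanSpace ℝ (Fin n) :=
    fun t => (R t, p, s₀ + t * s, x + t • y) with hγ
  set γ' : ℝ → (Fin n → Fin n → ℝ) × (Fin n → ℝ) × ℝ × EuclideanSpace ℝ (Fin n) :=
    fun t => (R t * N * R t, 0, s, y) with hγ'
  have hγd : ∀ᶠ t in 𝓝 (0 : ℝ), HasDerivAt γ (γ' t) t := by
    filter_upwards [hRd] with t ht
    refine HasDerivAt.prodMk (hasDerivAt_pi.2 fun i => hasDerivAt_pi.2 fun j => ht i j)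
      ((hasDerivAt_const t p).prodMk (HasDerivAt.prodMk ?_ ?_))
    · simpa using ((hasDerivAt_id t).mul_const s).const_add s₀
    · have := ((hasDerivAt_id t).smul_const y).const_add x
      rwa [one_smul] at this
  have hγ'd : HasDerivAt γ' ((2 : ℝ) • (A * N * A * N * A), 0, 0, 0) 0 := by
    refine HasDerivAt.prodMk (hasDerivAt_pi.2 fun i => hasDerivAt_pi.2 fun j => ?_)
      ((hasDerivAt_const _ _).prodMk ((hasDerivAt_const _ _).prodMk (hasDerivAt_const _ _)))
    have h0 := hRd.self_of_nhds
    have h1 : HasDerivAt (fun t => ∑ l, (∑ k, R t i k * N k l) * R t l j)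
        (∑ l, ((∑ k, (R 0 * N * R 0) i k * N k l) * R 0 l j
          + (∑ k, R 0 i k * N k l) * (R 0 * N * R 0) l j)) 0 :=
      HasDerivAt.fun_sum fun l _ => (HasDerivAt.fun_sum fun k _ =>
        (h0 i k).mul_const (N k l)).mul (h0 l j)
    have e1 : (fun t => (R t * N * R t) i j) = fun t => ∑ l, (∑ k, R t i k * N k l) * R t l j := by
      ext t; simp [Matrix.mul_apply]
    have e2 : ∑ l, ((∑ k, (R 0 * N * R 0) i k * N k l) * R 0 l j
          + (∑ k, R 0 i k * N k l) * (R 0 * N * R 0) l j)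
        = ((2 : ℝ) • (A * N * A * N * A)) i j := by
      have : (2 : ℝ) • (A * N * A * N * A) = (A * N * A) * N * A + (A * N) * (A * N * A) := by
        rw [two_smul]; noncomm_ring
      rw [this, hR0, Matrix.add_apply, Matrix.mul_apply (M := A * N * A * N),
        Matrix.mul_apply (M := A * N), ← Finset.sum_add_distrib]
      refine Finset.sum_congr rfl fun l _ => ?_
      rw [Matrix.mul_apply (M := A * N * A), Matrix.mul_apply (M := A)]
    rw [← e2]
    exact h1.congr_of_eventuallyEq (Eventually.of_forall fun t => congrFun e1 t)
  have hγ0 : γ 0 = (A, p, s₀, x) := by simp [hγ, hR0]; rfl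
  have hγ'0 : γ' 0 = (A * N * A, 0, s, y) := by simp [hγ', hR0]; rfl
  have hfd : ∀ᶠ t in 𝓝 (0 : ℝ), HasDerivAt (fun t => F (γ t)) (fderiv ℝ F (γ t) (γ' t)) t := by
    filter_upwards [hγd, hxt] with t ht hxt
    have hFt : HasFDerivAt F (fderiv ℝ F (γ t)) (γ t) :=
      ((hF.contDiffAt (hopen.mem_nhds hxt)).differentiableAt two_ne_zero).hasFDerivAt
    exact hFt.comp_hasDerivAt t ht
  have hF2 : HasFDerivAt (fderiv ℝ F) (fderiv ℝ (fderiv ℝ F) (γ 0)) (γ 0) := by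
    have : ContDiffAt ℝ 2 F (γ 0) := hF.contDiffAt (hopen.mem_nhds (by rw [hγ0]; exact hx))
    exact ((this.fderiv_right (m := 1) (by norm_num)).differentiableAt one_ne_zero).hasFDerivAt
  have hfd2 : HasDerivAt (fun t => fderiv ℝ F (γ t) (γ' t))
      (fderiv ℝ (fderiv ℝ F) (γ 0) (γ' 0) (γ' 0)
        + fderiv ℝ F (γ 0) ((2 : ℝ) • (A * N * A * N * A), 0, 0, 0)) 0 :=
    (hF2.comp_hasDerivAt 0 hγd.self_of_nhds).clm_apply hγ'd
  have hmid : ∀ᶠ t in 𝓝 (0 : ℝ), 2 * F (γ 0) ≤ F (γ t) + F (γ (-t)) := by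
    obtain ⟨V, hVo, hV, hVc⟩ := hconv p (P, s₀, x) ⟨hA.inv, hx⟩
    set w : ℝ → (Fin n → Fin n → ℝ) × ℝ × EuclideanSpace ℝ (Fin n) :=
      fun t => (P - t • N, s₀ + t * s, x + t • y) with hw
    have hw0 : w 0 = (P, s₀, x) := by simp [hw]; rfl
    have hwc : Continuous w := by
      refine Continuous.prodMk ?_ (by fun_prop)
      exact (by fun_prop : Continuous fun t : ℝ => P - t • N)
    have hwV : ∀ᶠ t in 𝓝 (0 : ℝ), w t ∈ {w : (Fin n → Fin n → ℝ) × ℝ × EuclideanSpace ℝ (Fin n) |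
                (Matrix.of w.1).PosDef ∧ w.2.2 ∈ B} ∩ V := by
      filter_upwards [hpd, hxt, hwc.continuousAt.eventually (hVo.mem_nhds (hw0 ▸ hV))]
        with t h1 h2 h3
      exact ⟨⟨h1, h2⟩, h3⟩
    have hneg : Tendsto (fun t : ℝ => -t) (𝓝 0) (𝓝 0) := by
      simpa using (continuous_neg (G := ℝ)).tendsto 0
    filter_upwards [hwV, hneg.eventually hwV] with t h1 h2
    have h := hVc.2 h1 h2 (by norm_num : (0 : ℝ) ≤ 1 / 2) (by norm_num : (0 : ℝ) ≤ 1 / 2)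
      (by norm_num)
    have e : (1 / 2 : ℝ) • w t + (1 / 2 : ℝ) • w (-t) = w 0 := by
      have e1 : (1 / 2 : ℝ) • (P - t • N) + (1 / 2 : ℝ) • (P - (-t) • N) = P - (0 : ℝ) • N := by
        module
      have e2 : (1 / 2 : ℝ) * (s₀ + t * s) + (1 / 2 : ℝ) * (s₀ + (-t) * s) = s₀ + 0 * s := by ring
      have e3 : (1 / 2 : ℝ) • (x + t • y) + (1 / 2 : ℝ) • (x + (-t) • y) = x + (0 : ℝ) • y := by
        module
      exact Prod.ext e1 (Prod.ext e2 e3)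
    rw [e] at h
    have h' : F (γ 0) ≤ (1 / 2 : ℝ) * F (γ t) + (1 / 2 : ℝ) * F (γ (-t)) := h
    linarith
  have := second_deriv_nonneg_of_midpoint hfd hfd2 hmid
  rwa [hγ0, hγ'0] at this

theorem InverseConvex.second_deriv_nonneg (hB : IsOpen B)
    (hF : ContDiffOn ℝ 2 F {z | z.2.2.2 ∈ B}) (hconv : InverseConvex B F)
    {A N : Matrix (Fin n) (Fin n) ℝ} (hA : A.PosSemidef) (hN : N.IsHermitian) (p : Fin n → ℝ)
    (s₀ s : ℝ) {x : EuclideanSpace ℝ (Fin n)} (hx : x ∈ B) (y : EuclideanSpace ℝ (Fin n)) :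
    0 ≤ fderiv ℝ (fderiv ℝ F) (A, p, s₀, x) (A * N * A, 0, s, y) (A * N * A, 0, s, y)
      + fderiv ℝ F (A, p, s₀, x) ((2 : ℝ) • (A * N * A * N * A), 0, 0, 0) := by
  have hopen : IsOpen {z : (Fin n → Fin n → ℝ) × (Fin n → ℝ) × ℝ × EuclideanSpace ℝ (Fin n) |
      z.2.2.2 ∈ B} := hB.preimage (by fun_prop)
  have hF2 : ContDiffAt ℝ 2 F ((A : Fin n → Fin n → ℝ), p, s₀, x) :=
    hF.contDiffAt (hopen.mem_nhds hx)
  have hF1 : ContDiffAt ℝ 1 (fderiv ℝ F) ((A : Fin n → Fin n → ℝ), p, s₀, x) :=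
    hF2.fderiv_right (by norm_num)
  have hF0 : ContDiffAt ℝ 0 (fderiv ℝ (fderiv ℝ F)) ((A : Fin n → Fin n → ℝ), p, s₀, x) :=
    hF1.fderiv_right (by norm_num)
  set Aε : ℝ → Matrix (Fin n) (Fin n) ℝ := fun ε => A + ε • 1 with hAε
  have hA0 : Aε 0 = A := by simp [hAε]
  have hAc : Continuous Aε := by fun_prop
  have hwc : Continuous fun ε =>
      (((Aε ε : Matrix (Fin n) (Fin n) ℝ) : Fin n → Fin n → ℝ), p, s₀, x) :=
    Continuous.prodMk hAc continuous_const
  have hζ : Continuous fun ε => (((Aε ε * N * Aε ε : Matrix (Fin n) (Fin n) ℝ) :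
      Fin n → Fin n → ℝ), (0 : Fin n → ℝ), s, y) :=
    Continuous.prodMk (by fun_prop : Continuous fun ε => Aε ε * N * Aε ε) continuous_const
  have hζ2 : Continuous fun ε => ((((2 : ℝ) • (Aε ε * N * Aε ε * N * Aε ε) :
      Matrix (Fin n) (Fin n) ℝ) : Fin n → Fin n → ℝ), (0 : Fin n → ℝ), (0 : ℝ),
      (0 : EuclideanSpace ℝ (Fin n))) :=
    Continuous.prodMk (by fun_prop : Continuous fun ε => (2 : ℝ) • (Aε ε * N * Aε ε * N * Aε ε))
      continuous_const
  have hw0 : (((Aε 0 : Matrix (Fin n) (Fin n) ℝ) : Fin n → Fin n → ℝ), p, s₀, x)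
      = ((A : Fin n → Fin n → ℝ), p, s₀, x) := by rw [hA0]
  have hlim := ((((hw0 ▸ hF0.continuousAt).comp (f := fun ε =>
      (((Aε ε : Matrix (Fin n) (Fin n) ℝ) : Fin n → Fin n → ℝ), p, s₀, x))
      hwc.continuousAt).clm_apply hζ.continuousAt).clm_apply hζ.continuousAt).add
    (((hw0 ▸ hF1.continuousAt).comp (f := fun ε =>
      (((Aε ε : Matrix (Fin n) (Fin n) ℝ) : Fin n → Fin n → ℝ), p, s₀, x))
      hwc.continuousAt).clm_apply hζ2.continuousAt)
  have hl := hlim.tendsto.mono_left (nhdsWithin_le_nhds (s := Set.Ioi (0 : ℝ)))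
  have key : 0 ≤ fderiv ℝ (fderiv ℝ F) (Aε 0, p, s₀, x) (Aε 0 * N * Aε 0, 0, s, y)
      (Aε 0 * N * Aε 0, 0, s, y)
      + fderiv ℝ F (Aε 0, p, s₀, x) ((2 : ℝ) • (Aε 0 * N * Aε 0 * N * Aε 0), 0, 0, 0) :=
    ge_of_tendsto hl (eventually_mem_nhdsWithin.mono fun ε (hε : 0 < ε) =>
    hconv.second_deriv_nonneg_of_posDef hB hF
      (Matrix.PosDef.posSemidef_add hA (Matrix.PosDef.one.smul hε)) hN p s₀ s hx y)
  rwa [hA0] at key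

end

/-- The space of values `(A, p, s, x)`. -/
abbrev JetSpace (n : ℕ) : Type :=
  (Fin n → Fin n → ℝ) × (Fin n → ℝ) × ℝ × EuclideanSpace ℝ (Fin n)

section
variable {n : ℕ}

/-- The 2-jet of `u` at `x`. -/
def jetPt (u : EuclideanSpace ℝ (Fin n) → ℝ) (p : EuclideanSpace ℝ (Fin n) → Fin n → ℝ)
    (H : EuclideanSpace ℝ (Fin n) → Matrix (Fin n) (Fin n) ℝ) (x : EuclideanSpace ℝ (Fin n)) :
    JetSpace n := (H x, p x, u x, x)

/-- The derivative of the 2-jet in the `i`-th coordinate direction. -/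
noncomputable def jetDir (p : EuclideanSpace ℝ (Fin n) → Fin n → ℝ)
    (H : EuclideanSpace ℝ (Fin n) → Matrix (Fin n) (Fin n) ℝ)
    (J : EuclideanSpace ℝ (Fin n) → Fin n → Matrix (Fin n) (Fin n) ℝ)
    (x : EuclideanSpace ℝ (Fin n)) (i : Fin n) : JetSpace n :=
  (J x i, H x i, p x i, EuclideanSpace.single i 1)

/-- The symmetrized derivative of `F` in the matrix entries. -/
noncomputable def symbolF (F : JetSpace n → ℝ) (z : JetSpace n) (i j : Fin n) : ℝ :=
  (fderiv ℝ F z (Matrix.single i j (1 : ℝ), 0, 0, 0)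
    + fderiv ℝ F z (Matrix.single j i (1 : ℝ), 0, 0, 0)) / 2

theorem symbolF_comm (F : JetSpace n → ℝ) (z : JetSpace n) (i j : Fin n) :
    symbolF F z i j = symbolF F z j i := by
  rw [symbolF, symbolF, add_comm]

theorem fderiv_matrix_eq_sum (F : JetSpace n → ℝ) (z : JetSpace n) (A : Matrix (Fin n) (Fin n) ℝ) :
    fderiv ℝ F z (A, 0, 0, 0)
      = ∑ i, ∑ j, fderiv ℝ F z (Matrix.single i j (1 : ℝ), 0, 0, 0) * A i j := by
  set L : Matrix (Fin n) (Fin n) ℝ →ₗ[ℝ] ℝ :=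
    { toFun := fun A => fderiv ℝ F z (A, 0, 0, 0)
      map_add' := fun A A' => by
        rw [← map_add]
        refine congrArg _ (Prod.ext rfl (Prod.ext (add_zero _).symm
          (Prod.ext (add_zero _).symm (add_zero _).symm)))
      map_smul' := fun r A => by
        rw [RingHom.id_apply, ← map_smul]
        refine congrArg _ (Prod.ext rfl (Prod.ext (smul_zero _).symm
          (Prod.ext (smul_zero _).symm (smul_zero _).symm))) } with hL
  have h := congrArg L (Matrix.matrix_eq_sum_single A)
  have h2 : L A = ∑ i, ∑ j, L (Matrix.single i j (A i j)) := by
    rw [← map_sum_sum]; exact h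
  refine h2.trans (Finset.sum_congr rfl fun i _ => Finset.sum_congr rfl fun j _ => ?_)
  have e : Matrix.single i j (A i j) = A i j • Matrix.single i j (1 : ℝ) := by
    simp
  rw [e, map_smul, smul_eq_mul, mul_comm]
  rfl
where
  map_sum_sum {L : Matrix (Fin n) (Fin n) ℝ →ₗ[ℝ] ℝ}
    {f : Fin n → Fin n → Matrix (Fin n) (Fin n) ℝ} :
    L (∑ i, ∑ j, f i j) = ∑ i, ∑ j, L (f i j) := by
    simp [map_sum]

theorem sum_symbolF_mul (F : JetSpace n → ℝ) (z : JetSpace n) {A : Matrix (Fin n) (Fin n) ℝ}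
    (hA : ∀ i j, A i j = A j i) :
    ∑ i, ∑ j, symbolF F z i j * A i j = fderiv ℝ F z (A, 0, 0, 0) := by
  rw [fderiv_matrix_eq_sum]
  set f := fun i j => fderiv ℝ F z (Matrix.single i j (1 : ℝ), 0, 0, 0) with hf
  have e : ∑ i, ∑ j, f j i * A i j = ∑ i, ∑ j, f i j * A i j := by
    rw [Finset.sum_comm]
    exact Finset.sum_congr rfl fun i _ => Finset.sum_congr rfl fun j _ => by rw [hA j i]
  calc ∑ i, ∑ j, symbolF F z i j * A i j
      = (∑ i, ∑ j, f i j * A i j + ∑ i, ∑ j, f j i * A i j) / 2 := by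
        rw [← Finset.sum_add_distrib, Finset.sum_div]
        refine Finset.sum_congr rfl fun i _ => ?_
        rw [← Finset.sum_add_distrib, Finset.sum_div]
        exact Finset.sum_congr rfl fun j _ => by simp only [symbolF, hf]; ring
    _ = _ := by rw [e]; ring

/-- `u` is a solution of `F (D²u, Du, u, x) = 0` on `B` with derivatives `p`, `H`, `J`. -/
structure IsSolutionJet (B : Set (EuclideanSpace ℝ (Fin n))) (F : JetSpace n → ℝ)
    (u : EuclideanSpace ℝ (Fin n) → ℝ) (p : EuclideanSpace ℝ (Fin n) → Fin n → ℝ)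
    (H : EuclideanSpace ℝ (Fin n) → Matrix (Fin n) (Fin n) ℝ)
    (J : EuclideanSpace ℝ (Fin n) → Fin n → Matrix (Fin n) (Fin n) ℝ) : Prop
    extends HessianJet B p H J where
  contDiff_F : ContDiffOn ℝ 2 F {z | z.2.2.2 ∈ B}
  strict_u : ∀ x ∈ B, HasStrictFDerivAt u (linForm (p x)) x
  eqn : ∀ x ∈ B, F (jetPt u p H x) = 0

/-- The value at `x` of the linearized operator applied to the Hessian entry `H a b`, as predicted
by differentiating the equation twice. -/
noncomputable def linearizedHess (F : JetSpace n → ℝ)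
    (u : EuclideanSpace ℝ (Fin n) → ℝ) (p : EuclideanSpace ℝ (Fin n) → Fin n → ℝ)
    (H : EuclideanSpace ℝ (Fin n) → Matrix (Fin n) (Fin n) ℝ)
    (J : EuclideanSpace ℝ (Fin n) → Fin n → Matrix (Fin n) (Fin n) ℝ)
    (x : EuclideanSpace ℝ (Fin n)) (a b : Fin n) : ℝ :=
  -fderiv ℝ (fderiv ℝ F) (jetPt u p H x) (jetDir p H J x a) (jetDir p H J x b)
    - fderiv ℝ F (jetPt u p H x) (0, J x a b, H x a b, 0)

variable {B : Set (EuclideanSpace ℝ (Fin n))} {F : JetSpace n → ℝ}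
  {u : EuclideanSpace ℝ (Fin n) → ℝ} {p : EuclideanSpace ℝ (Fin n) → Fin n → ℝ}
  {H : EuclideanSpace ℝ (Fin n) → Matrix (Fin n) (Fin n) ℝ}
  {J : EuclideanSpace ℝ (Fin n) → Fin n → Matrix (Fin n) (Fin n) ℝ}

theorem HessianJet.continuousAt_p (hd : HessianJet B p H J) {x : EuclideanSpace ℝ (Fin n)}
    (hx : x ∈ B) : ContinuousAt p x :=
  continuousAt_pi.2 fun b => (hd.strict_p x hx b).hasFDerivAt.continuousAt

theorem HessianJet.continuousAt_H (hd : HessianJet B p H J) {x : EuclideanSpace ℝ (Fin n)}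
    (hx : x ∈ B) : ContinuousAt H x :=
  continuousAt_pi.2 fun a => continuousAt_pi.2 fun b =>
    (hd.strict_H x hx a b).hasFDerivAt.continuousAt

theorem HessianJet.continuousAt_J (hd : HessianJet B p H J) {x : EuclideanSpace ℝ (Fin n)}
    (hx : x ∈ B) : ContinuousAt J x :=
  continuousAt_pi.2 fun i => continuousAt_pi.2 fun a => continuousAt_pi.2 fun b =>
    (hd.cont_J i a b).continuousAt (hd.isOpen.mem_nhds hx)

theorem HessianJet.continuousAt_jetDir (hd : HessianJet B p H J) {x : EuclideanSpace ℝ (Fin n)}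
    (hx : x ∈ B) (i : Fin n) : ContinuousAt (fun y => jetDir p H J y i) x :=
  (continuousAt_pi.1 (hd.continuousAt_J hx) i).prodMk
    ((continuousAt_pi.1 (hd.continuousAt_H hx) i).prodMk
      ((continuousAt_pi.1 (hd.continuousAt_p hx) i).prodMk continuousAt_const))

theorem IsSolutionJet.contDiffAt_F (hs : IsSolutionJet B F u p H J)
    {x : EuclideanSpace ℝ (Fin n)} (hx : x ∈ B) : ContDiffAt ℝ 2 F (jetPt u p H x) := by
  have hopen : IsOpen {z : JetSpace n | z.2.2.2 ∈ B} := hs.isOpen.preimage (by fun_prop)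
  exact hs.contDiff_F.contDiffAt (hopen.mem_nhds hx)

theorem IsSolutionJet.strict_jetPt (hs : IsSolutionJet B F u p H J)
    {x : EuclideanSpace ℝ (Fin n)} (hx : x ∈ B) :
    ∃ L : EuclideanSpace ℝ (Fin n) →L[ℝ] JetSpace n, HasStrictFDerivAt (jetPt u p H) L x ∧
      ∀ i, L (EuclideanSpace.single i 1) = jetDir p H J x i := by
  refine ⟨_, HasStrictFDerivAt.prodMk (hasStrictFDerivAt_pi.2 fun a => hasStrictFDerivAt_pi.2
    fun b => hs.strict_H x hx a b) (HasStrictFDerivAt.prodMk (hasStrictFDerivAt_pi.2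
    fun b => hs.strict_p x hx b) ((hs.strict_u x hx).prodMk (hasStrictFDerivAt_id x))), fun i => ?_⟩
  refine Prod.ext (funext fun a => funext fun b => linForm_single _ i)
    (Prod.ext (funext fun b => linForm_single _ i) (Prod.ext (linForm_single _ i) rfl))

theorem IsSolutionJet.continuousAt_jetPt (hs : IsSolutionJet B F u p H J)
    {x : EuclideanSpace ℝ (Fin n)} (hx : x ∈ B) : ContinuousAt (jetPt u p H) x := by
  obtain ⟨L, hL, -⟩ := hs.strict_jetPt hx
  exact hL.hasFDerivAt.continuousAt

theorem IsSolutionJet.continuousAt_fderiv (hs : IsSolutionJet B F u p H J)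
    {x : EuclideanSpace ℝ (Fin n)} (hx : x ∈ B) :
    ContinuousAt (fun y => fderiv ℝ F (jetPt u p H y)) x :=
  ContinuousAt.comp (g := fderiv ℝ F)
    ((hs.contDiffAt_F hx).fderiv_right (m := 1) (by norm_num)).continuousAt
    (hs.continuousAt_jetPt hx)

theorem IsSolutionJet.continuousAt_fderiv_fderiv (hs : IsSolutionJet B F u p H J)
    {x : EuclideanSpace ℝ (Fin n)} (hx : x ∈ B) :
    ContinuousAt (fun y => fderiv ℝ (fderiv ℝ F) (jetPt u p H y)) x :=
  ContinuousAt.comp (g := fderiv ℝ (fderiv ℝ F))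
    (((hs.contDiffAt_F hx).fderiv_right (m := 1) (by norm_num)).fderiv_right (m := 0)
      (by norm_num)).continuousAt (hs.continuousAt_jetPt hx)

theorem IsSolutionJet.fderiv_jetDir (hs : IsSolutionJet B F u p H J)
    {x : EuclideanSpace ℝ (Fin n)} (hx : x ∈ B) (i : Fin n) :
    fderiv ℝ F (jetPt u p H x) (jetDir p H J x i) = 0 := by
  obtain ⟨L, hL, hLi⟩ := hs.strict_jetPt hx
  have h := ((hs.contDiffAt_F hx).differentiableAt two_ne_zero).hasFDerivAt.comp x hL.hasFDerivAt
  have h0 : HasFDerivAt (F ∘ jetPt u p H) (0 : EuclideanSpace ℝ (Fin n) →L[ℝ] ℝ) x :=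
    (hasFDerivAt_const (0 : ℝ) x).congr_of_eventuallyEq (by
      filter_upwards [hs.isOpen.mem_nhds hx] with y hy using hs.eqn y hy)
  have := congrArg (fun T => T (EuclideanSpace.single i (1 : ℝ))) (h.unique h0)
  simpa [hLi] using this

theorem IsSolutionJet.isTraceLimit (hs : IsSolutionJet B F u p H J)
    {x1 : EuclideanSpace ℝ (Fin n)} (hx1 : x1 ∈ B) :
    IsTraceLimit (fun x => symbolF F (jetPt u p H x)) J x1 (linearizedHess F u p H J x1) := by
  intro l x h hx hh hne a b
  set e : EuclideanSpace ℝ (Fin n) := EuclideanSpace.single a 1 with he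
  have hxe : Tendsto (fun k => x k + h k • e) l (𝓝 x1) := by
    simpa using hx.add (hh.smul_const e)
  have hB := hs.isOpen.mem_nhds hx1
  obtain ⟨L, hL, hLi⟩ := hs.strict_jetPt hx1
  have hDF : HasStrictFDerivAt (fderiv ℝ F) (fderiv ℝ (fderiv ℝ F) (jetPt u p H x1))
      (jetPt u p H x1) :=
    ((hs.contDiffAt_F hx1).fderiv_right (m := 1) (by norm_num)).hasStrictFDerivAt one_ne_zero
  have h1 := (hDF.comp x1 hL).tendsto_diffQuot hx hh hne e
  have h2 : Tendsto (fun k => jetDir p H J (x k + h k • e) b) l (𝓝 (jetDir p H J x1 b)) :=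
    (hs.continuousAt_jetDir hx1 b).tendsto.comp hxe
  have h3 : Tendsto (fun k => fderiv ℝ F (jetPt u p H (x k))) l (𝓝 (fderiv ℝ F (jetPt u p H x1))) :=
    (hs.continuousAt_fderiv hx1).tendsto.comp hx
  have h4 : Tendsto (fun k => ((0 : Fin n → Fin n → ℝ),
      (fun c => (h k)⁻¹ * (H (x k + h k • e) b c - H (x k) b c)),
      (h k)⁻¹ * (p (x k + h k • e) b - p (x k) b), (0 : EuclideanSpace ℝ (Fin n)))) l
      (𝓝 (0, J x1 a b, H x1 a b, 0)) :=
    tendsto_const_nhds.prodMk_nhds (Tendsto.prodMk_nhds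
      (tendsto_pi_nhds.2 fun c => hs.tendsto_quot_H hx1 hx hh hne a b c)
      ((hs.tendsto_quot_p hx1 hx hh hne a b).prodMk_nhds tendsto_const_nhds))
  have hev := (isBoundedBilinearMap_apply (𝕜 := ℝ) (E := JetSpace n) (F := ℝ)).continuous
  have hfin := (((hev.tendsto (_, _)).comp (h1.prodMk_nhds h2)).neg).sub
    ((hev.tendsto (_, _)).comp (h3.prodMk_nhds h4))
  dsimp only at hfin
  rw [ContinuousLinearMap.comp_apply, hLi] at hfin
  refine hfin.congr' ?_
  filter_upwards [hx.eventually hB, hxe.eventually hB] with k hk hke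
  have hsym : ∀ i j, ((h k)⁻¹ • (J (x k + h k • e) b - J (x k) b)) i j
      = ((h k)⁻¹ • (J (x k + h k • e) b - J (x k) b)) j i := fun i j => by
    simp [hs.symm_J _ hk b i j, hs.symm_J _ hke b i j]
  have hsum : ∑ i, ∑ j, symbolF F (jetPt u p H (x k)) i j *
      ((h k)⁻¹ * (J (x k + h k • e) j i b - J (x k) j i b))
      = fderiv ℝ F (jetPt u p H (x k)) ((h k)⁻¹ • (J (x k + h k • e) b - J (x k) b), 0, 0, 0) := by
    rw [← sum_symbolF_mul F _ hsym]
    refine Finset.sum_congr rfl fun i _ => Finset.sum_congr rfl fun j _ => ?_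
    have : ∀ y ∈ B, J y j i b = J y b i j := fun y hy => by
      rw [hs.symm_J y hy j i b, hs.symm_J' y hy j b i, hs.symm_J y hy b j i]
    rw [this _ hk, this _ hke]
    rfl
  have hsplit : (h k)⁻¹ • (jetDir p H J (x k + h k • e) b - jetDir p H J (x k) b)
      = (((h k)⁻¹ • (J (x k + h k • e) b - J (x k) b), 0, 0, 0) : JetSpace n)
        + ((0 : Fin n → Fin n → ℝ), (fun c => (h k)⁻¹ * (H (x k + h k • e) b c - H (x k) b c)),
      (h k)⁻¹ * (p (x k + h k • e) b - p (x k) b), (0 : EuclideanSpace ℝ (Fin n))) := by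
    refine Prod.ext (add_zero _).symm (Prod.ext (zero_add _).symm (Prod.ext (zero_add _).symm ?_))
    simp [jetDir]
  have hz : fderiv ℝ F (jetPt u p H (x k))
      ((h k)⁻¹ • (jetDir p H J (x k + h k • e) b - jetDir p H J (x k) b))
      + ((h k)⁻¹ • (fderiv ℝ F (jetPt u p H (x k + h k • e)) - fderiv ℝ F (jetPt u p H (x k))))
        (jetDir p H J (x k + h k • e) b) = 0 := by
    simp only [map_smul, map_sub, smul_apply, sub_apply,
      hs.fderiv_jetDir hk, hs.fderiv_jetDir hke, smul_eq_mul]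
    ring
  rw [hsplit, map_add] at hz
  rw [hsum]
  simp only [Function.comp_apply]
  linarith

end

section
variable {n : ℕ} {B : Set (EuclideanSpace ℝ (Fin n))}

theorem pd_coe (f : EuclideanSpace ℝ (Fin n) → ℝ) (x : EuclideanSpace ℝ (Fin n)) (i : Fin n) :
    pd f x i = fderiv ℝ f x (EuclideanSpace.single i 1) := by
  simp [pd]

theorem ContDiffOn.pd {m k : WithTop ℕ∞} {f : EuclideanSpace ℝ (Fin n) → ℝ} (hB : IsOpen B)
    (hf : ContDiffOn ℝ k f B) (hmk : m + 1 ≤ k) (i : Fin n) :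
    ContDiffOn ℝ m (fun x => pd f x i) B := by
  simp only [pd_coe]
  exact (hf.fderiv_of_isOpen hB hmk).clm_apply contDiffOn_const

theorem ContDiffOn.hasStrictFDerivAt_linForm_pd {k : WithTop ℕ∞}
    {f : EuclideanSpace ℝ (Fin n) → ℝ} (hB : IsOpen B)
    (hf : ContDiffOn ℝ k f B) (hk : k ≠ 0) {x : EuclideanSpace ℝ (Fin n)} (hx : x ∈ B) :
    HasStrictFDerivAt f (linForm fun i => _root_.pd f x i) x := by
  have h := (hf.contDiffAt (hB.mem_nhds hx)).hasStrictFDerivAt hk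
  rw [eq_linForm (fderiv ℝ f x)] at h
  simpa only [pd_coe] using h

theorem ContDiffOn.pd_comm {k : WithTop ℕ∞}
    {f : EuclideanSpace ℝ (Fin n) → ℝ} (hB : IsOpen B)
    (hf : ContDiffOn ℝ k f B) (hk : 2 ≤ k) {x : EuclideanSpace ℝ (Fin n)} (hx : x ∈ B)
    (i j : Fin n) :
    _root_.pd (fun y => _root_.pd f y j) x i = _root_.pd (fun y => _root_.pd f y i) x j := by
  have hfx := hf.contDiffAt (hB.mem_nhds hx)
  have hsymm := hfx.isSymmSndFDerivAt (by simpa using hk)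
  have hd : DifferentiableAt ℝ (fderiv ℝ f) x :=
    (hfx.fderiv_right (m := 1) (by simpa [one_add_one_eq_two] using hk)).differentiableAt
      one_ne_zero
  have key : ∀ i j : Fin n, _root_.pd (fun y => _root_.pd f y j) x i
      = fderiv ℝ (fderiv ℝ f) x (EuclideanSpace.single i 1) (EuclideanSpace.single j 1) := by
    intro i j
    simp only [pd_coe]
    rw [fderiv_clm_apply hd (differentiableAt_const _)]
    simp
  rw [key, key]
  exact hsymm _ _

/-- The third derivatives of `u`. -/
noncomputable def thirdDeriv (u : EuclideanSpace ℝ (Fin n) → ℝ) (x : EuclideanSpace ℝ (Fin n))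
    (i : Fin n) : Matrix (Fin n) (Fin n) ℝ :=
  Matrix.of fun a b => pd (fun y => hessM u y a b) x i

theorem isSolutionJet_of_contDiffOn (hB : IsOpen B) {F : JetSpace n → ℝ}
    {u : EuclideanSpace ℝ (Fin n) → ℝ} (hF : ContDiffOn ℝ 2 F {z | z.2.2.2 ∈ B})
    (hu : ContDiffOn ℝ 3 u B)
    (heq : ∀ x ∈ B, F (fun i j => hessM u x i j, fun l => pd u x l, u x, x) = 0) :
    IsSolutionJet B F u (fun x b => pd u x b) (hessM u) (thirdDeriv u) := by
  have hp : ∀ b : Fin n, ContDiffOn ℝ 2 (fun x => pd u x b) B := fun b =>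
    hu.pd hB (by norm_num) b
  have hH : ∀ a b : Fin n, ContDiffOn ℝ 1 (fun x => hessM u x a b) B := fun a b =>
    (hp b).pd hB (by norm_num) a
  have hsymm : ∀ x ∈ B, ∀ a b, hessM u x a b = hessM u x b a := fun x hx a b =>
    hu.pd_comm hB (by norm_num) hx a b
  exact
  { isOpen := hB
    strict_p := fun x hx b => (hp b).hasStrictFDerivAt_linForm_pd hB two_ne_zero hx
    strict_H := fun x hx a b => (hH a b).hasStrictFDerivAt_linForm_pd hB one_ne_zero hx
    cont_J := fun i a b => ((hH a b).pd hB (m := 0) (by norm_num) i).continuousOn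
    symm_H := hsymm
    symm_J := fun x hx i a b => by
      simp only [thirdDeriv, Matrix.of_apply, pd_coe]
      rw [Filter.EventuallyEq.fderiv_eq]
      filter_upwards [hB.mem_nhds hx] with y hy using hsymm y hy a b
    symm_J' := fun x hx i a b => (hp b).pd_comm hB le_rfl hx i a
    contDiff_F := hF
    strict_u := fun x hx => hu.hasStrictFDerivAt_linForm_pd hB three_ne_zero hx
    eqn := heq }

theorem Fmat_eq_fderiv {F : JetSpace n → ℝ} {u : EuclideanSpace ℝ (Fin n) → ℝ}
    {x : EuclideanSpace ℝ (Fin n)}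
    (hF : DifferentiableAt ℝ F (jetPt u (fun x b => pd u x b) (hessM u) x)) (i j : Fin n) :
    Fmat F u x i j = fderiv ℝ F (jetPt u (fun x b => pd u x b) (hessM u) x)
      (Matrix.single i j (1 : ℝ), 0, 0, 0) := by
  have hi : HasFDerivAt (fun A : Fin n → Fin n → ℝ => ((A, fun l => pd u x l, u x, x) : JetSpace n))
      (ContinuousLinearMap.inl ℝ (Fin n → Fin n → ℝ) ((Fin n → ℝ) × ℝ × EuclideanSpace ℝ (Fin n)))
      (fun a b => hessM u x a b) := hasFDerivAt_prodMk_left _ _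
  have h := HasFDerivAt.comp (fun a b => hessM u x a b) (g := F) hF.hasFDerivAt hi
  have h' := h.fderiv
  rw [Fmat]
  have e : (fun a b => if a = i ∧ b = j then (1 : ℝ) else 0) = Matrix.single i j (1 : ℝ) := by
    funext a b
    simp [Matrix.single_apply, eq_comm]
  rw [e]
  exact congrArg (fun T => T (Matrix.single i j (1 : ℝ))) h'

theorem sum_symbolF_quad (F : JetSpace n → ℝ) (z : JetSpace n) (ξ : Fin n → ℝ) :
    ∑ i, ∑ j, symbolF F z i j * ξ i * ξ j
      = ∑ i, ∑ j, fderiv ℝ F z (Matrix.single i j (1 : ℝ), 0, 0, 0) * ξ i * ξ j := by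
  simp only [mul_assoc]
  have h := sum_symbolF_mul F z (A := Matrix.of fun i j => ξ i * ξ j) fun i j => mul_comm _ _
  rw [fderiv_matrix_eq_sum] at h
  exact h

theorem ConvexOn.sum_hessian_nonneg {u : EuclideanSpace ℝ (Fin n) → ℝ}
    {p : EuclideanSpace ℝ (Fin n) → Fin n → ℝ}
    {H : EuclideanSpace ℝ (Fin n) → Matrix (Fin n) (Fin n) ℝ} (huc : ConvexOn ℝ B u)
    (hB : IsOpen B) (hu : HasHessianOn u p H B) {x : EuclideanSpace ℝ (Fin n)} (hx : x ∈ B)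
    (w : Fin n → ℝ) : 0 ≤ ∑ i, ∑ j, H x i j * w i * w j := by
  set W : EuclideanSpace ℝ (Fin n) := WithLp.toLp 2 w with hW
  have hWi : ∀ i, W i = w i := fun i => rfl
  set γ : ℝ → EuclideanSpace ℝ (Fin n) := fun t => x + t • W with hγ
  have hγd : ∀ t, HasDerivAt γ W t := fun t => by
    have := ((hasDerivAt_id t).smul_const W).const_add x
    rwa [one_smul] at this
  have hγ0 : γ 0 = x := by simp [hγ]
  have hγc : Tendsto γ (𝓝 0) (𝓝 x) := by
    have := (hγd 0).continuousAt.tendsto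
    rwa [hγ0] at this
  have hev : ∀ᶠ t in 𝓝 (0 : ℝ), γ t ∈ B := hγc.eventually (hB.mem_nhds hx)
  have hneg : Tendsto (fun t : ℝ => -t) (𝓝 0) (𝓝 0) := by
    simpa using (continuous_neg (G := ℝ)).tendsto 0
  refine second_deriv_nonneg_of_midpoint (f := fun t => u (γ t))
    (f' := fun t => ∑ i, p (γ t) i * w i) ?_ ?_ ?_
  · filter_upwards [hev] with t ht
    refine ((hu.grad _ ht).comp_hasDerivAt t (hγd t)).congr_deriv ?_
    simp [linForm_apply, hWi]
  · have h : HasDerivAt (fun t => ∑ i, p (γ t) i * w i)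
        (∑ i, (linForm (H x i)) W * w i) 0 := by
      refine HasDerivAt.fun_sum fun i _ => ?_
      have h1 : HasFDerivAt (fun y => p y i) (linForm (H x i)) (γ 0) := by
        rw [hγ0]; exact hu.hess x hx i
      exact (h1.comp_hasDerivAt (0 : ℝ) (hγd 0)).mul_const _
    refine h.congr_deriv (Finset.sum_congr rfl fun i _ => ?_)
    rw [linForm_apply, Finset.sum_mul]
    exact Finset.sum_congr rfl fun j _ => by rw [hWi]; ring
  · filter_upwards [hev, hneg.eventually hev] with t ht ht'
    have hconv := huc.2
    have h := hconv ht ht' (a := 1 / 2) (b := 1 / 2) (by norm_num) (by norm_num) (by norm_num)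
    have e : (1 / 2 : ℝ) • γ t + (1 / 2 : ℝ) • γ (-t) = x := by
      simp only [hγ]
      module
    rw [e] at h
    simp only [smul_eq_mul] at h
    rw [hγ0]
    linarith

end

/-- `N` inverts `H` on the range of the orthogonal projection `1 - R`. -/
structure Matrix.IsPartialInv {n : ℕ} (R H N : Matrix (Fin n) (Fin n) ℝ) : Prop where
  symm_R : R.transpose = R
  symm_H : H.transpose = H
  symm_N : N.transpose = N
  mul_left : R * N = 0
  mul_right : N * R = 0
  mul_one_sub : N * H * (1 - R) = 1 - R

/-- The compression of `H` to the range of `1 - R`, completed by `R`. -/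
def Matrix.compressAdd {n : ℕ} (R H : Matrix (Fin n) (Fin n) ℝ) : Matrix (Fin n) (Fin n) ℝ :=
  (1 - R) * H * (1 - R) + R

section
open Matrix
variable {n : ℕ} {R H N : Matrix (Fin n) (Fin n) ℝ}

theorem Matrix.PosSemidef.exists_ker_projection (hH : H.PosSemidef) :
    ∃ R : Matrix (Fin n) (Fin n) ℝ, R.transpose = R ∧ R * R = R ∧ H * R = 0 ∧
      (H + R).det ≠ 0 := by
  set U : Matrix (Fin n) (Fin n) ℝ := (hH.1.eigenvectorUnitary : Matrix (Fin n) (Fin n) ℝ)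
  set l := hH.1.eigenvalues with hl
  have hUU : star U * U = 1 := Unitary.coe_star_mul_self _
  have hUU' : U * star U = 1 := Unitary.coe_mul_star_self _
  have hs : H = U * diagonal l * star U := by
    have := hH.1.spectral_theorem
    simpa [Unitary.conjStarAlgAut_apply, Function.comp_def] using this
  have hmul : ∀ d e : Fin n → ℝ, (U * diagonal d * star U) * (U * diagonal e * star U)
      = U * diagonal (fun i => d i * e i) * star U := fun d e => by
    rw [← diagonal_mul_diagonal]
    calc _ = U * diagonal d * (star U * U) * diagonal e * star U := by simp only [mul_assoc]
      _ = _ := by rw [hUU, mul_one]; simp only [mul_assoc]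
  set k : Fin n → ℝ := fun i => if l i = 0 then 1 else 0 with hk
  have hadd : ∀ d e : Fin n → ℝ, (U * diagonal d * star U) + (U * diagonal e * star U)
      = U * diagonal (fun i => d i + e i) * star U := fun d e => by
    rw [← diagonal_add, mul_add, add_mul]
  refine ⟨U * diagonal k * star U, ?_, ?_, ?_, ?_⟩
  · rw [star_eq_conjTranspose, conjTranspose_eq_transpose_of_trivial]
    simp [transpose_mul, mul_assoc]
  · rw [hmul]
    congr 3; funext i; simp [hk]
  · conv_lhs => rw [hs]
    rw [hmul]
    have : (fun i => l i * k i) = 0 := by funext i; simp [hk]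
    rw [this]; simp
  · conv_lhs => rw [hs]
    rw [hadd, det_mul, det_mul, det_diagonal]
    have h1 := congrArg det hUU'
    rw [det_mul, det_one] at h1
    refine mul_ne_zero (mul_ne_zero ?_ (Finset.prod_ne_zero_iff.2 fun i _ => ?_)) ?_
    · rintro h; simp [h] at h1
    · by_cases h : l i = 0 <;> simp [hk, h]
    · rintro h; simp [h] at h1

theorem Matrix.compressAdd_eq (hH : H.transpose = H) (hR : R.transpose = R) (hHR : H * R = 0) :
    compressAdd R H = H + R := by
  have hRH : R * H = 0 := by
    have := congrArg transpose hHR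
    rwa [transpose_mul, hH, hR, transpose_zero] at this
  simp [compressAdd, mul_sub, sub_mul, hHR, hRH]

theorem Matrix.isPartialInv_inv_compressAdd (hR : R.transpose = R) (hRR : R * R = R)
    (hH : H.transpose = H) (hdet : (compressAdd R H).det ≠ 0) :
    IsPartialInv R H ((compressAdd R H)⁻¹ - R) := by
  set G := compressAdd R H with hG
  have hu : IsUnit G.det := isUnit_iff_ne_zero.2 hdet
  have hGR : G * R = R := by
    simp [hG, compressAdd, mul_assoc, add_mul, sub_mul, mul_sub, hRR]
  have hRG : R * G = R := by
    simp only [hG, compressAdd, mul_add, mul_sub, sub_mul, one_mul, mul_one, ← mul_assoc, hRR,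
      sub_self, zero_add]
  have hiR : G⁻¹ * R = R := by
    rw [← hGR, ← mul_assoc, nonsing_inv_mul _ hu, one_mul, hGR]
  have hRi : R * G⁻¹ = R := by
    conv_lhs => rw [← hRG]
    rw [mul_assoc, mul_nonsing_inv _ hu, mul_one]
  have hGt : G.transpose = G := by
    simp [hG, compressAdd, transpose_mul, hR, hH, mul_assoc]
  refine ⟨hR, hH, ?_, ?_, ?_, ?_⟩
  · rw [transpose_sub, transpose_nonsing_inv, hGt, hR]
  · rw [mul_sub, hRi, hRR, sub_self]
  · rw [sub_mul, hiR, hRR, sub_self]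
  · have h1 : (G⁻¹ - R) * R = 0 := by rw [sub_mul, hiR, hRR, sub_self]
    calc (G⁻¹ - R) * H * (1 - R) = (G⁻¹ - R) * ((1 - R) * H * (1 - R)) := by
          rw [mul_assoc, mul_assoc (1 - R), ← mul_assoc _ (1 - R), mul_sub (G⁻¹ - R) 1 R, h1,
            sub_zero, mul_one]
      _ = (G⁻¹ - R) * (G - R) := by rw [hG, compressAdd, add_sub_cancel_right]
      _ = 1 - R := by
        rw [mul_sub, h1, sub_zero, sub_mul, nonsing_inv_mul _ hu, hRG]

namespace Matrix.IsPartialInv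

theorem mul_mul_self (h : IsPartialInv R H N) : N * H * N = N := by
  have e : (1 - R) * N = N := by rw [sub_mul, h.mul_left, sub_zero, one_mul]
  calc N * H * N = N * H * (1 - R) * N := by rw [mul_assoc (N * H), e]
    _ = N := by rw [h.mul_one_sub, e]

theorem proj_mul_R (h : IsPartialInv R H N) : (1 - N * H) * R = 1 - N * H := by
  have := h.mul_one_sub
  rw [mul_sub, mul_one] at this
  rw [sub_mul, one_mul]
  rw [sub_eq_sub_iff_add_eq_add] at this ⊢
  rw [add_comm, this, add_comm]

theorem R_mul_proj (h : IsPartialInv R H N) : R * (1 - N * H) = R := by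
  rw [mul_sub, ← mul_assoc, h.mul_left, zero_mul, sub_zero, mul_one]

theorem transpose_proj (h : IsPartialInv R H N) : (1 - N * H).transpose = 1 - H * N := by
  rw [transpose_sub, transpose_mul, h.symm_H, h.symm_N, transpose_one]

theorem N_mul_H_mul_proj (h : IsPartialInv R H N) : N * H * (1 - N * H) = 0 := by
  rw [mul_sub, mul_one, ← mul_assoc, h.mul_mul_self, sub_self]

theorem proj_H_N (h : IsPartialInv R H N) : (1 - H * N) * H * N = 0 := by
  have := h.mul_mul_self
  rw [sub_mul, sub_mul, one_mul, mul_assoc (H * N), mul_assoc H N, ← mul_assoc N, this, sub_self]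

theorem schur_eq (H N : Matrix (Fin n) (Fin n) ℝ) : H - H * N * H = H * (1 - N * H) := by
  rw [mul_sub, mul_one, mul_assoc]

theorem schur_eq' (h : IsPartialInv R H N) : H - H * N * H = (1 - H * N) * H * (1 - N * H) := by
  rw [mul_sub ((1 - H * N) * H), ← mul_assoc, h.proj_H_N, zero_mul, sub_zero, mul_one, sub_mul,
    one_mul]

theorem schur_transpose (h : IsPartialInv R H N) : (H - H * N * H).transpose = H - H * N * H := by
  simp only [transpose_sub, transpose_mul, h.symm_H, h.symm_N, mul_assoc]

theorem schur_mul_R (h : IsPartialInv R H N) : (H - H * N * H) * R = H - H * N * H := by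
  rw [schur_eq, mul_assoc, h.proj_mul_R]

theorem R_mul_schur (h : IsPartialInv R H N) : R * (H - H * N * H) = H - H * N * H := by
  have := congrArg transpose h.schur_mul_R
  rwa [transpose_mul, h.schur_transpose, h.symm_R] at this

theorem posSemidef_N (h : IsPartialInv R H N) (hH : H.PosSemidef) : N.PosSemidef := by
  have := hH.conjTranspose_mul_mul_same N
  rwa [conjTranspose_eq_transpose_of_trivial, h.symm_N, h.mul_mul_self] at this

theorem posSemidef_schur (h : IsPartialInv R H N) (hH : H.PosSemidef) :
    (H - H * N * H).PosSemidef := by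
  have := hH.conjTranspose_mul_mul_same (1 - N * H)
  rwa [conjTranspose_eq_transpose_of_trivial, h.transpose_proj, ← h.schur_eq'] at this

theorem posSemidef_sub_schur (h : IsPartialInv R H N) (hH : H.PosSemidef) :
    (H * N * H).PosSemidef := by
  have := (h.posSemidef_N hH).conjTranspose_mul_mul_same H
  rwa [conjTranspose_eq_transpose_of_trivial, h.symm_H] at this

theorem rank_eq_of_schur_eq_zero (h : IsPartialInv R H N) (h0 : H - H * N * H = 0) :
    H.rank = (1 - R).rank := by
  apply le_antisymm
  · have e : N = N * (1 - R) := by rw [mul_sub, h.mul_right, sub_zero, mul_one]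
    rw [sub_eq_zero] at h0
    have e2 : H = H * N * ((1 - R) * H) := by
      conv_lhs => rw [h0, e]
      simp only [mul_assoc]
    rw [e2]
    exact (rank_mul_le_right _ _).trans (rank_mul_le_left _ _)
  · rw [← h.mul_one_sub]
    exact (rank_mul_le_left _ _).trans (rank_mul_le_right _ _)

end Matrix.IsPartialInv

theorem Matrix.IsPartialInv.schur_eq_zero (hH : H.transpose = H) (hR : R.transpose = R)
    (hHR : H * R = 0) (h : IsPartialInv R H N) : H - H * N * H = 0 := by
  rw [← h.schur_mul_R]
  have hRH : R * H = 0 := by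
    have := congrArg transpose hHR
    rwa [transpose_mul, hH, hR, transpose_zero] at this
  rw [sub_mul, hHR, mul_assoc (H * N), hHR, mul_zero, sub_zero]

end

section
open Matrix
variable {n : ℕ}

/-- The vector field with value `v` and derivatives `v'` at `x1`. -/
def affineVec (v : Fin n → ℝ) (v' : Fin n → Fin n → ℝ) (x1 x : EuclideanSpace ℝ (Fin n)) :
    Fin n → ℝ :=
  fun a => v a + ∑ j, v' j a * (x j - x1 j)

@[simp]
theorem affineVec_self (v : Fin n → ℝ) (v' : Fin n → Fin n → ℝ) (x1 : EuclideanSpace ℝ (Fin n)) :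
    affineVec v v' x1 x1 = v := by
  funext a; simp [affineVec]

theorem dotProduct_mulVec_eq_sum (A : Matrix (Fin n) (Fin n) ℝ) (v w : Fin n → ℝ) :
    v ⬝ᵥ A *ᵥ w = ∑ a, ∑ b, A a b * (v a * w b) := by
  simp only [dotProduct, mulVec, Finset.mul_sum]
  exact Finset.sum_congr rfl fun a _ => Finset.sum_congr rfl fun b _ => by ring

theorem dotProduct_mulVec_swap {A : Matrix (Fin n) (Fin n) ℝ} (hA : ∀ a b, A a b = A b a)
    (v w : Fin n → ℝ) : ∑ a, ∑ b, A a b * (v b * w a) = v ⬝ᵥ A *ᵥ w := by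
  rw [dotProduct_mulVec_eq_sum, Finset.sum_comm]
  exact Finset.sum_congr rfl fun a _ => Finset.sum_congr rfl fun b _ => by rw [hA a b]

theorem hasHessianOn_affineVec_mul (v : Fin n → ℝ) (v' : Fin n → Fin n → ℝ)
    (x1 : EuclideanSpace ℝ (Fin n)) (a b : Fin n) :
    HasHessianOn (fun x => affineVec v v' x1 x a * affineVec v v' x1 x b)
      (fun x i => affineVec v v' x1 x a * v' i b + affineVec v v' x1 x b * v' i a)
      (fun _ i j => v' i b * v' j a + v' i a * v' j b) Set.univ := by
  have h := (HasHessianOn.affine (s := Set.univ) (v a) (fun j => v' j a) x1).mul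
    (HasHessianOn.affine (v b) (fun j => v' j b) x1)
  simpa only [mul_zero, zero_add, affineVec] using h

theorem hasHessianOn_sum_affineVec_mul {ι : Type*} [Fintype ι] (v : ι → Fin n → ℝ)
    (v' : ι → Fin n → Fin n → ℝ) (x1 : EuclideanSpace ℝ (Fin n)) (a b : Fin n) :
    HasHessianOn (fun x => ∑ κ, affineVec (v κ) (v' κ) x1 x a * affineVec (v κ) (v' κ) x1 x b)
      (fun x i => ∑ κ, (affineVec (v κ) (v' κ) x1 x a * v' κ i b
        + affineVec (v κ) (v' κ) x1 x b * v' κ i a))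
      (fun _ i j => ∑ κ, (v' κ i b * v' κ j a + v' κ i a * v' κ j b)) Set.univ :=
  HasHessianOn.sum Finset.univ fun κ _ => hasHessianOn_affineVec_mul (v κ) (v' κ) x1 a b

theorem sum_sum_tuple_eq {ι : Type*} [Fintype ι] {G : Fin n → Fin n → ℝ} {c : Fin n → Fin n → ℝ}
    {J : Fin n → Matrix (Fin n) (Fin n) ℝ} {H : Matrix (Fin n) (Fin n) ℝ}
    (hJ : ∀ i a b, J i a b = J i b a) (hH : ∀ a b, H a b = H b a)
    (v : ι → Fin n → ℝ) (v' : ι → Fin n → Fin n → ℝ) :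
    ∑ a, ∑ b, ((∑ κ, v κ a * v κ b) * G a b + ∑ i, ∑ j, c i j *
        (2 * (J i a b * ∑ κ, (v κ a * v' κ j b + v κ b * v' κ j a))
          + H a b * ∑ κ, (v' κ i b * v' κ j a + v' κ i a * v' κ j b)))
      = ∑ κ, ((∑ a, ∑ b, v κ a * v κ b * G a b) + ∑ i, ∑ j, c i j *
          (4 * (v κ ⬝ᵥ J i *ᵥ v' κ j) + 2 * (v' κ i ⬝ᵥ H *ᵥ v' κ j))) := by
  have e1 : ∑ a, ∑ b, (∑ κ, v κ a * v κ b) * G a b = ∑ κ, ∑ a, ∑ b, v κ a * v κ b * G a b := by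
    simp only [Finset.sum_mul]
    rw [Finset.sum_comm' (t' := Finset.univ) (s' := fun _ => Finset.univ) (by simp)]
    rw [Finset.sum_comm]
    conv_rhs => rw [Finset.sum_comm]
    refine Finset.sum_congr rfl fun a _ => ?_
    rw [Finset.sum_comm]
  have e2 : ∀ i j, ∑ a, ∑ b, (2 * (J i a b * ∑ κ, (v κ a * v' κ j b + v κ b * v' κ j a))
      + H a b * ∑ κ, (v' κ i b * v' κ j a + v' κ i a * v' κ j b))
      = ∑ κ, (4 * (v κ ⬝ᵥ J i *ᵥ v' κ j) + 2 * (v' κ i ⬝ᵥ H *ᵥ v' κ j)) := by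
    intro i j
    have : ∀ κ, 4 * (v κ ⬝ᵥ J i *ᵥ v' κ j) + 2 * (v' κ i ⬝ᵥ H *ᵥ v' κ j)
        = ∑ a, ∑ b, (2 * (J i a b * (v κ a * v' κ j b + v κ b * v' κ j a))
          + H a b * (v' κ i b * v' κ j a + v' κ i a * v' κ j b)) := fun κ => by
      have h1 := dotProduct_mulVec_swap (hJ i) (v κ) (v' κ j)
      have h2 := dotProduct_mulVec_swap hH (v' κ i) (v' κ j)
      have h3 := dotProduct_mulVec_eq_sum (J i) (v κ) (v' κ j)
      have h4 := dotProduct_mulVec_eq_sum H (v' κ i) (v' κ j)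
      simp only [mul_add, Finset.sum_add_distrib, ← Finset.mul_sum]
      rw [h1, h2, ← h3, ← h4]
      ring
    simp only [this]
    rw [Finset.sum_comm (γ := ι)]
    refine Finset.sum_congr rfl fun a _ => ?_
    rw [Finset.sum_comm (γ := ι)]
    refine Finset.sum_congr rfl fun b _ => ?_
    simp only [Finset.mul_sum]
    rw [← Finset.sum_add_distrib]
  have e3 : ∑ a, ∑ b, ∑ i, ∑ j, c i j *
        (2 * (J i a b * ∑ κ, (v κ a * v' κ j b + v κ b * v' κ j a))
          + H a b * ∑ κ, (v' κ i b * v' κ j a + v' κ i a * v' κ j b))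
      = ∑ κ, ∑ i, ∑ j, c i j *
          (4 * (v κ ⬝ᵥ J i *ᵥ v' κ j) + 2 * (v' κ i ⬝ᵥ H *ᵥ v' κ j)) := by
    have hL : ∀ f : Fin n → Fin n → Fin n → Fin n → ℝ,
        ∑ a, ∑ b, ∑ i, ∑ j, f a b i j = ∑ i, ∑ j, ∑ a, ∑ b, f a b i j := fun f => by
      calc ∑ a, ∑ b, ∑ i, ∑ j, f a b i j
          = ∑ a, ∑ i, ∑ j, ∑ b, f a b i j := Finset.sum_congr rfl fun a _ => by
            rw [Finset.sum_comm]
            exact Finset.sum_congr rfl fun i _ => Finset.sum_comm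
        _ = ∑ i, ∑ j, ∑ a, ∑ b, f a b i j := by
            rw [Finset.sum_comm]
            exact Finset.sum_congr rfl fun i _ => Finset.sum_comm
    rw [hL, Finset.sum_comm (γ := ι)]
    refine Finset.sum_congr rfl fun i _ => ?_
    rw [Finset.sum_comm (γ := ι)]
    refine Finset.sum_congr rfl fun j _ => ?_
    simp only [← Finset.mul_sum, e2]
  simp only [Finset.sum_add_distrib] at e1 e3 ⊢
  rw [e1, e3]

variable {B : Set (EuclideanSpace ℝ (Fin n))} {F : JetSpace n → ℝ}
  {u : EuclideanSpace ℝ (Fin n) → ℝ} {p : EuclideanSpace ℝ (Fin n) → Fin n → ℝ}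
  {H : EuclideanSpace ℝ (Fin n) → Matrix (Fin n) (Fin n) ℝ}
  {J : EuclideanSpace ℝ (Fin n) → Fin n → Matrix (Fin n) (Fin n) ℝ}
  {φ : EuclideanSpace ℝ (Fin n) → ℝ} {φ1 : EuclideanSpace ℝ (Fin n) → Fin n → ℝ}
  {φ2 : EuclideanSpace ℝ (Fin n) → Fin n → Fin n → ℝ}

theorem IsSolutionJet.continuousAt_symbolF (hs : IsSolutionJet B F u p H J)
    {x : EuclideanSpace ℝ (Fin n)} (hx : x ∈ B) (i j : Fin n) :
    ContinuousAt (fun y => symbolF F (jetPt u p H y) i j) x :=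
  (((hs.continuousAt_fderiv hx).clm_apply continuousAt_const).add
    ((hs.continuousAt_fderiv hx).clm_apply continuousAt_const)).div_const 2

theorem sum_affineVec_eq {ι : Type*} [Fintype ι] (v : ι → Fin n → ℝ) (v' : ι → Fin n → Fin n → ℝ)
    (A : Matrix (Fin n) (Fin n) ℝ) (x1 x : EuclideanSpace ℝ (Fin n)) :
    ∑ κ, affineVec (v κ) (v' κ) x1 x ⬝ᵥ A *ᵥ affineVec (v κ) (v' κ) x1 x
      = ∑ a, ∑ b, (∑ κ, affineVec (v κ) (v' κ) x1 x a * affineVec (v κ) (v' κ) x1 x b)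
          * A a b := by
  simp only [dotProduct_mulVec_eq_sum, Finset.sum_mul]
  rw [Finset.sum_comm]
  refine Finset.sum_congr rfl fun a _ => ?_
  rw [Finset.sum_comm]
  exact Finset.sum_congr rfl fun b _ => Finset.sum_congr rfl fun κ _ => mul_comm _ _

theorem IsSolutionJet.second_order_of_tuple (hs : IsSolutionJet B F u p H J)
    (hell : ∀ x ∈ B, ∀ ξ : Fin n → ℝ,
      0 ≤ ∑ i, ∑ j, symbolF F (jetPt u p H x) i j * ξ i * ξ j)
    {x1 : EuclideanSpace ℝ (Fin n)} (hx1 : x1 ∈ B) {ι : Type*} [Fintype ι]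
    (v : ι → Fin n → ℝ) (v' : ι → Fin n → Fin n → ℝ)
    (hφ : HasHessianOn φ φ1 φ2 Set.univ) (hφ2 : ∀ i j, Continuous fun x => φ2 x i j)
    (hmin : IsLocalMin (fun x => (∑ κ, affineVec (v κ) (v' κ) x1 x ⬝ᵥ
      H x *ᵥ affineVec (v κ) (v' κ) x1 x) - φ x) x1) :
    ∑ i, ∑ j, symbolF F (jetPt u p H x1) i j * φ2 x1 i j ≤
      ∑ κ, ((∑ a, ∑ b, v κ a * v κ b * linearizedHess F u p H J x1 a b)
        + ∑ i, ∑ j, symbolF F (jetPt u p H x1) i j *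
          (4 * (v κ ⬝ᵥ J x1 i *ᵥ v' κ j) + 2 * (v' κ i ⬝ᵥ H x1 *ᵥ v' κ j))) := by
  simp only [sum_affineVec_eq] at hmin
  have h := hs.toHessianJet.second_order_of_isLocalMin
    (c := fun x => symbolF F (jetPt u p H x)) (fun x _ => symbolF_comm F _) hell
    (fun i j x hx => (hs.continuousAt_symbolF hx i j).continuousWithinAt) hx1
    (hs.isTraceLimit hx1)
    (hasHessianOn_sum_affineVec_mul v v' x1)
    (fun a b i j => continuous_const) hφ hφ2 hmin
  simp only [affineVec_self] at h
  rwa [sum_sum_tuple_eq (hs.symm_J x1 hx1) (hs.symm_H x1 hx1)] at h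

theorem HessianJet.first_order_of_tuple (hd : HessianJet B p H J)
    {x1 : EuclideanSpace ℝ (Fin n)} (hx1 : x1 ∈ B) {ι : Type*} [Fintype ι]
    (v : ι → Fin n → ℝ) (v' : ι → Fin n → Fin n → ℝ)
    (hφ : HasHessianOn φ φ1 φ2 Set.univ)
    (hmin : IsLocalMin (fun x => (∑ κ, affineVec (v κ) (v' κ) x1 x ⬝ᵥ
      H x *ᵥ affineVec (v κ) (v' κ) x1 x) - φ x) x1) (i : Fin n) :
    φ1 x1 i = ∑ κ, (v κ ⬝ᵥ J x1 i *ᵥ v κ + 2 * (v κ ⬝ᵥ H x1 *ᵥ v' κ i)) := by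
  simp only [sum_affineVec_eq] at hmin
  have h := hd.first_order_of_isLocalMin hx1
    (hasHessianOn_sum_affineVec_mul v v' x1) hφ hmin i
  simp only [affineVec_self] at h
  rw [h]
  have : ∀ κ, v κ ⬝ᵥ J x1 i *ᵥ v κ + 2 * (v κ ⬝ᵥ H x1 *ᵥ v' κ i) = ∑ a, ∑ b,
      (v κ a * v κ b * J x1 i a b + H x1 a b * (v κ a * v' κ i b + v κ b * v' κ i a)) := fun κ => by
    have h2 := dotProduct_mulVec_swap (hd.symm_H x1 hx1) (v κ) (v' κ i)
    have h3 := dotProduct_mulVec_eq_sum (J x1 i) (v κ) (v κ)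
    have h4 := dotProduct_mulVec_eq_sum (H x1) (v κ) (v' κ i)
    simp only [mul_add, Finset.sum_add_distrib]
    rw [h2, ← h4, h3, two_mul]
    simp only [mul_comm]
  simp only [this]
  rw [Finset.sum_comm (γ := ι)]
  refine Finset.sum_congr rfl fun a _ => ?_
  rw [Finset.sum_comm (γ := ι)]
  refine Finset.sum_congr rfl fun b _ => ?_
  simp only [Finset.mul_sum, Finset.sum_mul]
  rw [← Finset.sum_add_distrib]

end

section
open Matrix
variable {n : ℕ}

theorem mulVec_dotProduct_eq (A : Matrix (Fin n) (Fin n) ℝ) (v w : Fin n → ℝ) :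
    (A *ᵥ v) ⬝ᵥ w = v ⬝ᵥ A.transpose *ᵥ w := by
  rw [dotProduct_mulVec, vecMul_transpose]

/-- The Frobenius inner product. -/
def frob (A B : Matrix (Fin n) (Fin n) ℝ) : ℝ := ∑ a, ∑ b, A a b * B a b

/-- The vectors `A b c • e d - δ c d • e b` together with the standard basis. -/
def testVec (A : Matrix (Fin n) (Fin n) ℝ) : (Fin n × Fin n × Fin n) ⊕ Fin n → Fin n → ℝ
  | .inl (b, c, d) => A b c • Pi.single d 1 - (if c = d then (1 : ℝ) else 0) • Pi.single b 1
  | .inr d => Pi.single d 1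

/-- The linear part of `testVec`. -/
def testDir (A : Matrix (Fin n) (Fin n) ℝ) : (Fin n × Fin n × Fin n) ⊕ Fin n → Fin n → ℝ
  | .inl (b, c, d) => A b c • Pi.single d 1
  | .inr _ => 0

theorem single_dotProduct_mulVec_single (A : Matrix (Fin n) (Fin n) ℝ) (a b : Fin n) :
    (Pi.single a 1 : Fin n → ℝ) ⬝ᵥ A *ᵥ Pi.single b 1 = A a b := by
  simp

theorem sum_mul_diag (A : Matrix (Fin n) (Fin n) ℝ) (f : Fin n → Fin n → ℝ) :
    ∑ b, ∑ c, ∑ d, f b c * A d d = (∑ b, ∑ c, f b c) * A.trace := by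
  simp only [← Finset.mul_sum, ← Finset.sum_mul]
  rfl

theorem sum_testDir (A Z Z' : Matrix (Fin n) (Fin n) ℝ) :
    ∑ κ, testDir Z κ ⬝ᵥ A *ᵥ testDir Z' κ = frob Z Z' * A.trace := by
  rw [Fintype.sum_sum_type, Fintype.sum_prod_type]
  simp only [Fintype.sum_prod_type, testDir, mulVec_smul, smul_dotProduct, dotProduct_smul,
    single_dotProduct_mulVec_single, smul_eq_mul, zero_dotProduct, Finset.sum_const_zero, add_zero,
    frob]
  rw [← sum_mul_diag]
  refine Finset.sum_congr rfl fun b _ => Finset.sum_congr rfl fun c _ =>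
    Finset.sum_congr rfl fun d _ => by ring

theorem sum_testVec_testDir (A Y Z : Matrix (Fin n) (Fin n) ℝ) :
    ∑ κ, testVec Y κ ⬝ᵥ A *ᵥ testDir Z κ = frob Y Z * A.trace - frob Z A := by
  rw [Fintype.sum_sum_type, Fintype.sum_prod_type]
  have e : ∀ b c d, testVec Y (.inl (b, c, d)) ⬝ᵥ A *ᵥ testDir Z (.inl (b, c, d))
      = Y b c * Z b c * A d d - if c = d then Z b c * A b d else 0 := fun b c d => by
    simp only [testVec, testDir, mulVec_smul, sub_dotProduct, smul_dotProduct, dotProduct_smul,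
      single_dotProduct_mulVec_single, smul_eq_mul]
    split_ifs <;> ring
  have e' : ∀ d, testVec Y (.inr d) ⬝ᵥ A *ᵥ testDir Z (.inr d) = 0 := fun d => by
    simp [testDir]
  simp only [Fintype.sum_prod_type, e, e', Finset.sum_const_zero, add_zero,
    Finset.sum_sub_distrib, Finset.sum_ite_eq, Finset.mem_univ, if_true, frob, sum_mul_diag]

theorem sum_testVec (A Y : Matrix (Fin n) (Fin n) ℝ) (hA : ∀ a b, A a b = A b a) :
    ∑ κ, testVec Y κ ⬝ᵥ A *ᵥ testVec Y κ = frob Y Y * A.trace - 2 * frob Y A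
      + (n + 1) * A.trace := by
  rw [Fintype.sum_sum_type, Fintype.sum_prod_type]
  have e : ∀ b c d, testVec Y (.inl (b, c, d)) ⬝ᵥ A *ᵥ testVec Y (.inl (b, c, d))
      = Y b c * Y b c * A d d - (if c = d then 2 * (Y b c * A b d) else 0)
        + if c = d then A b b else 0 := fun b c d => by
    simp only [testVec, mulVec_sub, mulVec_smul, sub_dotProduct, dotProduct_sub, smul_dotProduct,
      dotProduct_smul, single_dotProduct_mulVec_single, smul_eq_mul]
    rw [hA d b]
    split_ifs <;> ring
  have e' : ∀ d, testVec Y (.inr d) ⬝ᵥ A *ᵥ testVec Y (.inr d) = A d d := fun d => by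
    simp [testVec]
  simp only [Fintype.sum_prod_type, e, e', Finset.sum_add_distrib,
    Finset.sum_sub_distrib, Finset.sum_ite_eq, Finset.mem_univ, if_true, frob, ← Finset.sum_mul,
    ← Finset.mul_sum, Finset.sum_const, Finset.card_univ, Fintype.card_fin, nsmul_eq_mul]
  simp only [trace, diag_apply]
  ring

theorem abs_testVec_le {A : Matrix (Fin n) (Fin n) ℝ} (hA : ∀ a b, |A a b| ≤ 1) (κ) (a : Fin n) :
    |testVec A κ a| ≤ 2 := by
  have hs : ∀ d : Fin n, |(Pi.single d 1 : Fin n → ℝ) a| ≤ 1 := fun d => by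
    by_cases h : a = d <;> simp [h]
  rcases κ with ⟨b, c, d⟩ | d
  · simp only [testVec, Pi.sub_apply, Pi.smul_apply, smul_eq_mul]
    refine (abs_sub _ _).trans ?_
    rw [abs_mul, abs_mul]
    have h1 := mul_le_mul (hA b c) (hs d) (abs_nonneg _) zero_le_one
    have h2 : |if c = d then (1 : ℝ) else 0| ≤ 1 := by split_ifs <;> simp
    have h3 := mul_le_mul h2 (hs b) (abs_nonneg _) zero_le_one
    linarith
  · exact (hs d).trans one_le_two

theorem testVec_add_sum {ι : Type*} (s : Finset ι) (A : Matrix (Fin n) (Fin n) ℝ)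
    (t : ι → ℝ) (Z : ι → Matrix (Fin n) (Fin n) ℝ) (κ) :
    testVec (A + ∑ j ∈ s, t j • Z j) κ = testVec A κ + ∑ j ∈ s, t j • testDir (Z j) κ := by
  rcases κ with ⟨b, c, d⟩ | d
  · funext a
    simp only [testVec, testDir, Matrix.add_apply, Matrix.sum_apply, Matrix.smul_apply, smul_eq_mul,
      Pi.sub_apply, Pi.smul_apply, Pi.add_apply, Finset.sum_apply, add_mul, Finset.sum_mul]
    simp only [mul_assoc]
    ring
  · simp [testVec, testDir]

theorem affineVec_eq (v : Fin n → ℝ) (v' : Fin n → Fin n → ℝ) (x1 x : EuclideanSpace ℝ (Fin n)) :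
    affineVec v v' x1 x = v + ∑ j, (x j - x1 j) • v' j := by
  funext a
  simp [affineVec, mul_comm]

/-- The test functional `(n + 1) tr A - |A|² / tr A`. -/
noncomputable def traceDefect (A : Matrix (Fin n) (Fin n) ℝ) : ℝ :=
  (n + 1) * A.trace - frob A A / A.trace

theorem Matrix.PosSemidef.abs_apply_le_trace {A : Matrix (Fin n) (Fin n) ℝ} (hA : A.PosSemidef)
    (a b : Fin n) : |A a b| ≤ A.trace := by
  obtain ⟨D, rfl⟩ := hA.exists_conjTranspose_mul_self
  rw [conjTranspose_eq_transpose_of_trivial]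
  have h1 : ∀ a, ∑ k, D k a ^ 2 ≤ (D.transpose * D).trace := fun a => by
    have : (D.transpose * D).trace = ∑ b, ∑ k, D k b ^ 2 := by
      simp only [trace, diag_apply, mul_apply, transpose_apply, sq]
    rw [this]
    exact Finset.single_le_sum (f := fun b => ∑ k, D k b ^ 2)
      (fun b _ => Finset.sum_nonneg fun k _ => sq_nonneg _) (Finset.mem_univ a)
  have h2 : |(D.transpose * D) a b| ≤ ∑ k, (D k a ^ 2 + D k b ^ 2) / 2 := by
    rw [mul_apply]
    refine (Finset.abs_sum_le_sum_abs _ _).trans (Finset.sum_le_sum fun k _ => ?_)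
    rw [transpose_apply, abs_le]
    constructor <;> nlinarith [sq_nonneg (D k a - D k b), sq_nonneg (D k a + D k b)]
  refine h2.trans ?_
  rw [← Finset.sum_div, Finset.sum_add_distrib]
  linarith [h1 a, h1 b]

theorem Matrix.PosSemidef.frob_self_le {A : Matrix (Fin n) (Fin n) ℝ} (hA : A.PosSemidef) :
    frob A A ≤ A.trace ^ 2 := by
  have hs : ∀ i j, A i j = A j i := fun i j => by
    have := congrFun (congrFun hA.1 j) i
    simpa using this
  have h := sum_mul_nonneg_of_quadForm (c := A)
    (A := fun i j => (if i = j then A.trace else 0) - A i j)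
    hs (fun ξ => by
      have := hA.dotProduct_mulVec_nonneg ξ
      rw [star_trivial, dotProduct_mulVec_eq_sum] at this
      simpa only [mul_assoc] using this) fun ξ => ?_
  · have e : ∑ i, ∑ j, A i j * ((if i = j then A.trace else 0) - A i j)
        = A.trace ^ 2 - frob A A := by
      simp only [mul_sub, Finset.sum_sub_distrib, mul_ite, mul_zero, Finset.sum_ite_eq,
        Finset.mem_univ, if_true, frob]
      rw [← Finset.sum_mul, sq]
      rfl
    linarith
  · obtain ⟨D, hD⟩ := hA.exists_conjTranspose_mul_self
    rw [conjTranspose_eq_transpose_of_trivial] at hD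
    have e : ∑ i, ∑ j, ((if i = j then A.trace else 0) - A i j) * ξ i * ξ j
        = A.trace * ∑ i, ξ i ^ 2 - ∑ k, (∑ i, D k i * ξ i) ^ 2 := by
      simp only [sub_mul, Finset.sum_sub_distrib, ite_mul, zero_mul, Finset.sum_ite_eq,
        Finset.mem_univ, if_true]
      congr 1
      · rw [Finset.mul_sum]; exact Finset.sum_congr rfl fun i _ => by ring
      · simp only [sq, Finset.sum_mul_sum]
        rw [Finset.sum_comm (γ := Fin n)]
        conv_rhs => rw [Finset.sum_comm]
        rw [Finset.sum_comm]
        refine Finset.sum_congr rfl fun i _ => ?_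
        conv_rhs => rw [Finset.sum_comm]
        refine Finset.sum_congr rfl fun j _ => ?_
        rw [hD, mul_apply, Finset.sum_mul, Finset.sum_mul]
        exact Finset.sum_congr rfl fun k _ => by rw [transpose_apply]; ring
    rw [e, sub_nonneg]
    have ht : A.trace = ∑ k, ∑ i, D k i ^ 2 := by
      rw [hD, Finset.sum_comm]
      simp only [trace, diag_apply, mul_apply, transpose_apply, sq]
    rw [ht, Finset.sum_mul]
    exact Finset.sum_le_sum fun k _ => Finset.sum_mul_sq_le_sq_mul_sq _ _ _

theorem Matrix.PosSemidef.mul_trace_le_traceDefect {A : Matrix (Fin n) (Fin n) ℝ}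
    (hA : A.PosSemidef) : n * A.trace ≤ traceDefect A := by
  have h0 : 0 ≤ A.trace := hA.trace_nonneg
  rw [traceDefect]
  have : frob A A / A.trace ≤ A.trace := div_le_of_le_mul₀ h0 h0 (by
    rw [← sq]; exact hA.frob_self_le)
  linarith

theorem traceDefect_le_sum_testVec {A : Matrix (Fin n) (Fin n) ℝ} (hA : A.PosSemidef)
    (Z : Matrix (Fin n) (Fin n) ℝ) :
    traceDefect A ≤ ∑ κ, testVec Z κ ⬝ᵥ A *ᵥ testVec Z κ := by
  have hs : ∀ i j, A i j = A j i := fun i j => by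
    have := congrFun (congrFun hA.1 j) i
    simpa using this
  rw [sum_testVec A Z hs, traceDefect]
  have h0 : 0 ≤ A.trace := hA.trace_nonneg
  rcases h0.eq_or_lt with h0 | h0
  · have hA0 : ∀ a b, A a b = 0 := fun a b => by
      have := hA.abs_apply_le_trace a b
      rw [← h0] at this
      exact abs_nonpos_iff.1 this
    have : frob Z A = 0 := by simp [frob, hA0]
    rw [this, ← h0]
    simp
  · have : 0 ≤ ∑ a, ∑ b, A.trace * (Z a b - A a b / A.trace) ^ 2 :=
      Finset.sum_nonneg fun a _ => Finset.sum_nonneg fun b _ => by positivity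
    have e : ∑ a, ∑ b, A.trace * (Z a b - A a b / A.trace) ^ 2
        = frob Z Z * A.trace - 2 * frob Z A + frob A A / A.trace := by
      simp only [frob, Finset.sum_mul, Finset.mul_sum, Finset.sum_div, ← Finset.sum_sub_distrib,
        ← Finset.sum_add_distrib]
      refine Finset.sum_congr rfl fun a _ => Finset.sum_congr rfl fun b _ => ?_
      field_simp
      ring
    linarith

theorem sum_testVec_div_trace {A : Matrix (Fin n) (Fin n) ℝ} (hs : ∀ a b, A a b = A b a) :
    ∑ κ, testVec (A.trace⁻¹ • A) κ ⬝ᵥ A *ᵥ testVec (A.trace⁻¹ • A) κ = traceDefect A := by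
  rw [sum_testVec _ _ hs, traceDefect]
  have e1 : frob (A.trace⁻¹ • A) (A.trace⁻¹ • A) = A.trace⁻¹ * A.trace⁻¹ * frob A A := by
    simp only [frob, Finset.mul_sum, Matrix.smul_apply, smul_eq_mul]
    exact Finset.sum_congr rfl fun a _ => Finset.sum_congr rfl fun b _ => by ring
  have e2 : frob (A.trace⁻¹ • A) A = A.trace⁻¹ * frob A A := by
    simp only [frob, Finset.mul_sum, Matrix.smul_apply, smul_eq_mul]
    exact Finset.sum_congr rfl fun a _ => Finset.sum_congr rfl fun b _ => by ring
  rw [e1, e2]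
  by_cases h : A.trace = 0
  · simp [h]
  · field_simp
    ring

end

section
open Matrix
variable {n : ℕ}

namespace Matrix.IsPartialInv
variable {R H N : Matrix (Fin n) (Fin n) ℝ}

theorem dotProduct_schur (h : IsPartialInv R H N) (y z : Fin n → ℝ) :
    ((1 - N * H) *ᵥ y) ⬝ᵥ H *ᵥ ((1 - N * H) *ᵥ z) = y ⬝ᵥ (H - H * N * H) *ᵥ z := by
  rw [mulVec_dotProduct_eq, h.transpose_proj, mulVec_mulVec, mulVec_mulVec, h.schur_eq']

theorem dotProduct_corrected (h : IsPartialInv R H N) (y η w : Fin n → ℝ) :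
    ((1 - N * H) *ᵥ y) ⬝ᵥ H *ᵥ ((1 - N * H) *ᵥ η - N *ᵥ w) = y ⬝ᵥ (H - H * N * H) *ᵥ η := by
  rw [mulVec_sub, dotProduct_sub, h.dotProduct_schur, mulVec_dotProduct_eq, h.transpose_proj,
    mulVec_mulVec, mulVec_mulVec, h.proj_H_N, zero_mulVec, dotProduct_zero, sub_zero]

theorem bracket_eq (h : IsPartialInv R H N) {J J' : Matrix (Fin n) (Fin n) ℝ}
    (hJ : J.transpose = J) (y η η' : Fin n → ℝ) :
    4 * (((1 - N * H) *ᵥ y) ⬝ᵥ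
        J *ᵥ ((1 - N * H) *ᵥ η' - N *ᵥ (J' *ᵥ ((1 - N * H) *ᵥ y))))
      + 2 * (((1 - N * H) *ᵥ η - N *ᵥ (J *ᵥ ((1 - N * H) *ᵥ y))) ⬝ᵥ
        H *ᵥ ((1 - N * H) *ᵥ η' - N *ᵥ (J' *ᵥ ((1 - N * H) *ᵥ y))))
      = 4 * (y ⬝ᵥ ((1 - H * N) * J * (1 - N * H)) *ᵥ η')
        + 2 * (η ⬝ᵥ (H - H * N * H) *ᵥ η')
        - 2 * ((J *ᵥ ((1 - N * H) *ᵥ y)) ⬝ᵥ N *ᵥ (J' *ᵥ ((1 - N * H) *ᵥ y))) := by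
  have hNHP : ∀ w w' : Fin n → ℝ, (N *ᵥ w) ⬝ᵥ H *ᵥ ((1 - N * H) *ᵥ w') = 0 := fun w w' => by
    rw [mulVec_dotProduct_eq, h.symm_N, mulVec_mulVec, mulVec_mulVec,
      h.N_mul_H_mul_proj, zero_mulVec, dotProduct_zero]
  have hNN : ∀ w w' : Fin n → ℝ, (N *ᵥ w) ⬝ᵥ H *ᵥ (N *ᵥ w') = w ⬝ᵥ N *ᵥ w' := fun w w' => by
    rw [mulVec_dotProduct_eq, h.symm_N, mulVec_mulVec, mulVec_mulVec,
      h.mul_mul_self]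
  set v := (1 - N * H) *ᵥ y with hv
  have h1 : v ⬝ᵥ J *ᵥ ((1 - N * H) *ᵥ η') = y ⬝ᵥ ((1 - H * N) * J * (1 - N * H)) *ᵥ η' := by
    rw [hv, mulVec_dotProduct_eq, h.transpose_proj, mulVec_mulVec, mulVec_mulVec, mul_assoc]
  have h2 : v ⬝ᵥ J *ᵥ (N *ᵥ (J' *ᵥ v)) = (J *ᵥ v) ⬝ᵥ N *ᵥ (J' *ᵥ v) := by
    rw [mulVec_dotProduct_eq J, hJ]
  rw [sub_dotProduct, h.dotProduct_corrected, mulVec_sub H, dotProduct_sub (N *ᵥ (J *ᵥ v)), hNHP,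
    hNN, mulVec_sub, dotProduct_sub, h1, h2]
  ring

theorem dotProduct_schur_le (h : IsPartialInv R H N) (hH : H.PosSemidef) (z : Fin n → ℝ) :
    (R *ᵥ z) ⬝ᵥ (H - H * N * H) *ᵥ (R *ᵥ z) ≤ z ⬝ᵥ H *ᵥ z := by
  have h1 := (h.posSemidef_sub_schur hH).dotProduct_mulVec_nonneg z
  rw [star_trivial] at h1
  rw [mulVec_dotProduct_eq, h.symm_R, mulVec_mulVec, mulVec_mulVec, h.R_mul_schur, h.schur_mul_R,
    sub_mulVec, dotProduct_sub]
  linarith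

theorem R_mulVec_proj (h : IsPartialInv R H N) (y : Fin n → ℝ) :
    R *ᵥ ((1 - N * H) *ᵥ y) = R *ᵥ y := by
  rw [mulVec_mulVec, h.R_mul_proj]

theorem R_mulVec_corrected (h : IsPartialInv R H N) (y w : Fin n → ℝ) :
    R *ᵥ ((1 - N * H) *ᵥ y - N *ᵥ w) = R *ᵥ y := by
  rw [mulVec_sub, mulVec_mulVec, h.R_mul_proj, mulVec_mulVec, h.mul_left, zero_mulVec, sub_zero]

end Matrix.IsPartialInv

/-- If the Schur complement `H - H N H` has `traceDefect` touched from below by `φ` at `x1`, then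
so is the quadratic expression of the corrected test vectors. -/
theorem isLocalMin_sum_affineVec {R : Matrix (Fin n) (Fin n) ℝ}
    {H N : EuclideanSpace ℝ (Fin n) → Matrix (Fin n) (Fin n) ℝ} {φ : EuclideanSpace ℝ (Fin n) → ℝ}
    {x1 : EuclideanSpace ℝ (Fin n)}
    (h : ∀ᶠ x in 𝓝 x1, (H x).PosSemidef ∧ Matrix.IsPartialInv R (H x) (N x))
    (J : Fin n → Matrix (Fin n) (Fin n) ℝ) (Y : Fin n → Matrix (Fin n) (Fin n) ℝ)
    {M : EuclideanSpace ℝ (Fin n) → Matrix (Fin n) (Fin n) ℝ}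
    (hM : ∀ x, M x = H x - H x * N x * H x)
    (hmin : IsLocalMin (fun x => traceDefect (M x) - φ x) x1)
    {v : (Fin n × Fin n × Fin n) ⊕ Fin n → Fin n → ℝ}
    (hv : ∀ κ, v κ = (1 - N x1 * H x1) *ᵥ testVec ((M x1).trace⁻¹ • M x1) κ) :
    IsLocalMin (fun x => (∑ κ, affineVec (v κ)
      (fun j => (1 - N x1 * H x1) *ᵥ testDir (Y j) κ - N x1 *ᵥ (J j *ᵥ v κ)) x1 x ⬝ᵥ
      H x *ᵥ affineVec (v κ)
        (fun j => (1 - N x1 * H x1) *ᵥ testDir (Y j) κ - N x1 *ᵥ (J j *ᵥ v κ)) x1 x) - φ x) x1 := by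
  obtain ⟨hH1, h1⟩ := h.self_of_nhds
  filter_upwards [h, hmin] with x ⟨hHx, hx⟩ hle
  have hself : ∑ κ, v κ ⬝ᵥ H x1 *ᵥ v κ = traceDefect (M x1) := by
    rw [← sum_testVec_div_trace (fun a b => by
      rw [hM]; exact congrFun (congrFun h1.schur_transpose b) a)]
    refine Finset.sum_congr rfl fun κ _ => ?_
    rw [hv, h1.dotProduct_schur, hM]
  simp only [affineVec_self]
  rw [hself]
  refine hle.trans (sub_le_sub_right ?_ _)
  refine (traceDefect_le_sum_testVec (by rw [hM]; exact hx.posSemidef_schur hHx)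
    ((M x1).trace⁻¹ • M x1 + ∑ j, (x j - x1 j) • Y j)).trans (Finset.sum_le_sum fun κ _ => ?_)
  refine le_trans (le_of_eq ?_) (hx.dotProduct_schur_le hHx _)
  have hR : R *ᵥ affineVec (v κ)
      (fun j => (1 - N x1 * H x1) *ᵥ testDir (Y j) κ - N x1 *ᵥ (J j *ᵥ v κ)) x1 x
      = R *ᵥ testVec ((M x1).trace⁻¹ • M x1 + ∑ j, (x j - x1 j) • Y j) κ := by
    rw [affineVec_eq, testVec_add_sum, mulVec_add, mulVec_add, mulVec_sum, mulVec_sum, hv,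
      h1.R_mulVec_proj]
    simp only [mulVec_smul, h1.R_mulVec_corrected]
  rw [hR, hM x, mulVec_dotProduct_eq R, hx.symm_R, mulVec_mulVec, mulVec_mulVec, hx.R_mul_schur,
    hx.schur_mul_R]

end

section
open Matrix
variable {n : ℕ}

theorem abs_mul_apply_le {A A' : Matrix (Fin n) (Fin n) ℝ} {K a a' : ℝ} (hK : (n : ℝ) ≤ K)
    (hA : ∀ i j, |A i j| ≤ a) (hA' : ∀ i j, |A' i j| ≤ a') (i j : Fin n) :
    |(A * A') i j| ≤ K * (a * a') := by
  have ha : 0 ≤ a := (abs_nonneg _).trans (hA i j)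
  have ha' : 0 ≤ a' := (abs_nonneg _).trans (hA' i j)
  rw [mul_apply]
  refine (Finset.abs_sum_le_sum_abs _ _).trans ?_
  refine (Finset.sum_le_card_nsmul _ _ (a * a') fun k _ => ?_).trans ?_
  · rw [abs_mul]
    exact mul_le_mul (hA i k) (hA' k j) (abs_nonneg _) ha
  · rw [Finset.card_univ, Fintype.card_fin, nsmul_eq_mul]
    exact mul_le_mul_of_nonneg_right hK (mul_nonneg ha ha')

theorem abs_dotProduct_le {v w : Fin n → ℝ} {K a a' : ℝ} (hK : (n : ℝ) ≤ K) (ha : 0 ≤ a)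
    (ha' : 0 ≤ a') (hv : ∀ i, |v i| ≤ a) (hw : ∀ i, |w i| ≤ a') :
    |v ⬝ᵥ w| ≤ K * (a * a') := by
  rw [dotProduct]
  refine (Finset.abs_sum_le_sum_abs _ _).trans ?_
  refine (Finset.sum_le_card_nsmul _ _ (a * a') fun k _ => ?_).trans ?_
  · rw [abs_mul]
    exact mul_le_mul (hv k) (hw k) (abs_nonneg _) ha
  · rw [Finset.card_univ, Fintype.card_fin, nsmul_eq_mul]
    exact mul_le_mul_of_nonneg_right hK (mul_nonneg ha ha')

theorem abs_mulVec_apply_le {A : Matrix (Fin n) (Fin n) ℝ} {w : Fin n → ℝ} {K a a' : ℝ}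
    (hK : (n : ℝ) ≤ K) (hA : ∀ i j, |A i j| ≤ a) (hw : ∀ i, |w i| ≤ a') (i : Fin n) :
    |(A *ᵥ w) i| ≤ K * (a * a') :=
  abs_dotProduct_le hK ((abs_nonneg _).trans (hA i i)) ((abs_nonneg _).trans (hw i)) (hA i) hw

theorem norm_pi_pi_le {A : Fin n → Fin n → ℝ} {a : ℝ} (ha : 0 ≤ a)
    (hA : ∀ i j, |A i j| ≤ a) : ‖A‖ ≤ a :=
  (pi_norm_le_iff_of_nonneg ha).2 fun i => (pi_norm_le_iff_of_nonneg ha).2 fun j => hA i j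

theorem norm_toLp_le {v : Fin n → ℝ} {K a : ℝ} (hK : (n : ℝ) ≤ K) (ha : 0 ≤ a)
    (hv : ∀ i, |v i| ≤ a) : ‖WithLp.toLp 2 v‖ ≤ K * a := by
  have h0 : 0 ≤ K := (Nat.cast_nonneg n).trans hK
  refine abs_le_of_sq_le_sq' ?_ (mul_nonneg h0 ha) |>.2
  rw [EuclideanSpace.norm_sq_eq]
  rcases n.eq_zero_or_pos with rfl | hn
  · simpa using sq_nonneg (K * a)
  have hK1 : 1 ≤ K := (by exact_mod_cast hn : (1 : ℝ) ≤ n).trans hK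
  refine (Finset.sum_le_card_nsmul _ _ (a ^ 2) fun k _ => ?_).trans ?_
  · exact pow_le_pow_left₀ (norm_nonneg _) (hv k) 2
  · rw [Finset.card_univ, Fintype.card_fin, nsmul_eq_mul, mul_pow]
    refine mul_le_mul_of_nonneg_right ?_ (sq_nonneg a)
    nlinarith

/-- The derivative of the 2-jet in the direction `v`. -/
noncomputable def jetDirSum (p : Fin n → ℝ) (H : Matrix (Fin n) (Fin n) ℝ)
    (J : Fin n → Matrix (Fin n) (Fin n) ℝ) (v : Fin n → ℝ) : JetSpace n :=
  (∑ a, v a • J a, H *ᵥ v, v ⬝ᵥ p, WithLp.toLp 2 v)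

variable {B : Set (EuclideanSpace ℝ (Fin n))} {F : JetSpace n → ℝ}
  {u : EuclideanSpace ℝ (Fin n) → ℝ} {p : EuclideanSpace ℝ (Fin n) → Fin n → ℝ}
  {H : EuclideanSpace ℝ (Fin n) → Matrix (Fin n) (Fin n) ℝ}
  {J : EuclideanSpace ℝ (Fin n) → Fin n → Matrix (Fin n) (Fin n) ℝ}
  {x : EuclideanSpace ℝ (Fin n)}

theorem sum_smul_jetDir (hH : ∀ a b, H x a b = H x b a) (v : Fin n → ℝ) :
    ∑ a, v a • jetDir p H J x a = jetDirSum (p x) (H x) (J x) v := by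
  refine Prod.ext ?_ (Prod.ext ?_ (Prod.ext ?_ ?_))
  · simp only [Prod.fst_sum, jetDirSum, jetDir]
    rfl
  · simp only [Prod.fst_sum, Prod.snd_sum, jetDirSum, jetDir]
    funext b
    simp only [Finset.sum_apply, mulVec, dotProduct]
    exact Finset.sum_congr rfl fun a _ => by rw [hH b a]; exact mul_comm _ _
  · simp only [Prod.fst_sum, Prod.snd_sum, jetDirSum, jetDir]
    rfl
  · simp only [Prod.snd_sum, jetDirSum, jetDir]
    ext b
    simp [Finset.sum_apply, Pi.single_apply]

theorem sum_linearizedHess (hH : ∀ a b, H x a b = H x b a) (v : Fin n → ℝ) :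
    ∑ a, ∑ b, v a * v b * linearizedHess F u p H J x a b =
      -fderiv ℝ (fderiv ℝ F) (jetPt u p H x) (jetDirSum (p x) (H x) (J x) v)
          (jetDirSum (p x) (H x) (J x) v)
        - fderiv ℝ F (jetPt u p H x)
          (0, fun c => ∑ a, ∑ b, v a * v b * J x a b c, v ⬝ᵥ H x *ᵥ v, 0) := by
  have e : ∑ a, ∑ b, (v a * v b) • ((0, J x a b, H x a b, 0) : JetSpace n)
      = (0, fun c => ∑ a, ∑ b, v a * v b * J x a b c, v ⬝ᵥ H x *ᵥ v, 0) := by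
    refine Prod.ext ?_ (Prod.ext ?_ (Prod.ext ?_ ?_))
    · simp [Prod.fst_sum]
    · funext c
      simp [Prod.fst_sum, Prod.snd_sum, Finset.sum_apply]
    · simp only [Prod.fst_sum, Prod.snd_sum, dotProduct_mulVec_eq_sum]
      exact Finset.sum_congr rfl fun a _ => Finset.sum_congr rfl fun b _ => by
        simp [mul_comm]
    · simp [Prod.snd_sum]
  rw [← e, ← sum_smul_jetDir hH]
  simp only [map_sum, map_smul, _root_.sum_apply, _root_.smul_apply, smul_eq_mul, linearizedHess,
    mul_sub, Finset.sum_sub_distrib, mul_neg, Finset.sum_neg_distrib, Finset.mul_sum]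
  congr 2
  rw [Finset.sum_comm]
  exact Finset.sum_congr rfl fun a _ => Finset.sum_congr rfl fun b _ => by ring

theorem IsSolutionJet.fderiv_matrix_le {z : JetSpace n} {K a : ℝ} (hK : ‖fderiv ℝ F z‖ ≤ K)
    (ha : 0 ≤ a) {A : Matrix (Fin n) (Fin n) ℝ} (hA : ∀ i j, |A i j| ≤ a) :
    |fderiv ℝ F z (A, 0, 0, 0)| ≤ K * a := by
  refine ((fderiv ℝ F z).le_of_opNorm_le hK _).trans
    (mul_le_mul_of_nonneg_left ?_ ((norm_nonneg _).trans hK))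
  simpa [Prod.norm_def, ha] using norm_pi_pi_le ha hA

theorem bilin_sub_le {E : Type*} [NormedAddCommGroup E] [NormedSpace ℝ E] {L : E →L[ℝ] E →L[ℝ] ℝ}
    {K : ℝ} (hK : ‖L‖ ≤ K) {z z' : E} {a b δ : ℝ} (hz : ‖z‖ ≤ a) (hz' : ‖z'‖ ≤ b)
    (hzz : ‖z - z'‖ ≤ δ) : |L z' z' - L z z| ≤ K * δ * (a + b) := by
  have e : L z' z' - L z z = -(L (z - z') z + L z' (z - z')) := by
    simp only [map_sub, _root_.sub_apply]
    ring
  have hK0 := L.opNorm_nonneg.trans hK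
  have h1 : |L (z - z') z| ≤ K * δ * a := (L.le_opNorm₂ _ _).trans
    (mul_le_mul (mul_le_mul hK hzz (norm_nonneg _) hK0) hz (norm_nonneg _)
      (mul_nonneg hK0 ((norm_nonneg _).trans hzz)))
  have h2 : |L z' (z - z')| ≤ K * b * δ := (L.le_opNorm₂ _ _).trans
    (mul_le_mul (mul_le_mul hK hz' (norm_nonneg _) hK0) hzz (norm_nonneg _)
      (mul_nonneg hK0 ((norm_nonneg _).trans hz')))
  rw [e, abs_neg]
  refine (abs_add_le _ _).trans ((add_le_add h1 h2).trans (le_of_eq ?_))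
  ring

/-- A bound for all the data of a solution at a point. -/
structure JetBound (F : JetSpace n → ℝ) (u : EuclideanSpace ℝ (Fin n) → ℝ)
    (p : EuclideanSpace ℝ (Fin n) → Fin n → ℝ)
    (H : EuclideanSpace ℝ (Fin n) → Matrix (Fin n) (Fin n) ℝ)
    (J : EuclideanSpace ℝ (Fin n) → Fin n → Matrix (Fin n) (Fin n) ℝ)
    (N : Matrix (Fin n) (Fin n) ℝ) (K : ℝ) (x : EuclideanSpace ℝ (Fin n)) : Prop where
  one_le : 1 ≤ K
  dim_le : (n : ℝ) ≤ K
  bound_p : ∀ b, |p x b| ≤ K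
  bound_H : ∀ a b, |H x a b| ≤ K
  bound_J : ∀ i a b, |J x i a b| ≤ K
  bound_N : ∀ a b, |N a b| ≤ K
  bound_fderiv : ‖fderiv ℝ F (jetPt u p H x)‖ ≤ K
  bound_fderiv_fderiv : ‖fderiv ℝ (fderiv ℝ F) (jetPt u p H x)‖ ≤ K

theorem IsSolutionJet.linearizedHess_sub_le (hs : IsSolutionJet B F u p H J)
    (hconv : InverseConvex B F) (hx : x ∈ B) (hH : (H x).PosSemidef)
    {R N : Matrix (Fin n) (Fin n) ℝ} (h : Matrix.IsPartialInv R (H x) N) {K ε : ℝ}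
    (hb : JetBound F u p H J N K x) (hε : 0 ≤ ε) {y v : Fin n → ℝ} (hy : ∀ a, |y a| ≤ 2)
    (hv : v = (1 - N * H x) *ᵥ y)
    (hD : ∀ i l, |(((1 - H x * N) * J x i * (1 - N * H x)) *ᵥ y) l| ≤ ε)
    (hM : ∀ l, |((H x - H x * N * H x) *ᵥ y) l| ≤ ε) :
    ∑ a, ∑ b, v a * v b * linearizedHess F u p H J x a b
      - 2 * ∑ i, ∑ j, symbolF F (jetPt u p H x) i j * ((J x i *ᵥ v) ⬝ᵥ N *ᵥ (J x j *ᵥ v))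
      ≤ 36 * K ^ 19 * ε := by
  obtain ⟨hK1, hn, hpK, hHK, hJK, hNK, hF1, hF2⟩ := hb
  have hK0 : 0 ≤ K := zero_le_one.trans hK1
  have hHs : (H x).transpose = H x := h.symm_H
  set X : Matrix (Fin n) (Fin n) ℝ := ∑ a, v a • J x a with hX
  have hXapp : ∀ i b, X i b = (J x i *ᵥ v) b := fun i b => by
    simp only [hX, Matrix.sum_apply, Matrix.smul_apply, smul_eq_mul, mulVec, dotProduct]
    exact Finset.sum_congr rfl fun a _ => by
      rw [hs.symm_J' x hx a i b, hs.symm_J x hx i a b, mul_comm]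
  have hXs : X.transpose = X := by
    ext i b
    simp only [hX, transpose_apply, Matrix.sum_apply, Matrix.smul_apply]
    exact Finset.sum_congr rfl fun a _ => by rw [hs.symm_J x hx a b i]
  set q := N * H x with hq
  have hqT : q.transpose = H x * N := by rw [hq, transpose_mul, hHs, h.symm_N]
  have hPT := h.transpose_proj
  set X' := H x * (N * X * N) * H x with hX'
  have hX'q : X' = q.transpose * X * q := by rw [hX', hqT, hq]; noncomm_ring
  -- the sizes of the various vectors and matrices
  have bq : ∀ i j, |q i j| ≤ K ^ 3 := fun i j =>
    (abs_mul_apply_le hn hNK hHK i j).trans (le_of_eq (by ring))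
  have bqT : ∀ i j, |q.transpose i j| ≤ K ^ 3 := fun i j => bq j i
  have hK3 : 1 ≤ K ^ 3 := one_le_pow₀ hK1
  have bP : ∀ i j, |(1 - q) i j| ≤ 2 * K ^ 3 := fun i j => by
    rw [Matrix.sub_apply]
    have : |(1 : Matrix (Fin n) (Fin n) ℝ) i j| ≤ 1 := by
      rw [Matrix.one_apply]; split_ifs <;> simp
    linarith [abs_sub ((1 : Matrix (Fin n) (Fin n) ℝ) i j) (q i j), bq i j]
  have bv : ∀ a, |v a| ≤ 4 * K ^ 4 := fun a => by
    rw [hv]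
    exact (abs_mulVec_apply_le hn bP hy a).trans (le_of_eq (by ring))
  have bX : ∀ i j, |X i j| ≤ 4 * K ^ 6 := fun i j => by
    rw [hXapp]
    exact (abs_mulVec_apply_le hn (hJK i) bv j).trans (le_of_eq (by ring))
  have bX' : ∀ i j, |X' i j| ≤ 4 * K ^ 14 := fun i j => by
    rw [hX'q]
    exact (abs_mul_apply_le hn (abs_mul_apply_le hn bqT bX) bq i j).trans (le_of_eq (by ring))
  have bXP : ∀ i l, |(X * (1 - q)) i l| ≤ ε := fun i l => by
    have e : (X * (1 - q)) i l = (((1 - H x * N) * J x i * (1 - q)) *ᵥ y) l := by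
      rw [← mulVec_mulVec, ← hv, ← mulVec_mulVec, ← hPT, mul_apply]
      simp only [mulVec, dotProduct, transpose_apply]
      exact Finset.sum_congr rfl fun b _ => by rw [hXapp i b, mul_comm]; rfl
    rw [e]
    exact hD i l
  have bPX : ∀ i l, |((X * (1 - q)).transpose) i l| ≤ ε := fun i l => bXP l i
  have hHv : H x *ᵥ v = (H x - H x * N * H x) *ᵥ y := by
    rw [hv, mulVec_mulVec, Matrix.IsPartialInv.schur_eq]
  have hXX' : X - X' = X * (1 - q) + (X * (1 - q)).transpose * q := by
    have e : (X * (1 - q)).transpose = (1 - q.transpose) * X := by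
      rw [transpose_mul, transpose_sub, transpose_one, hXs]
    rw [hX'q, e]
    noncomm_ring
  have bXX' : ∀ i j, |(X - X') i j| ≤ 2 * K ^ 4 * ε := fun i j => by
    rw [hXX', Matrix.add_apply]
    have h1 := abs_mul_apply_le hn bPX bq i j
    have h2 : ε ≤ K ^ 4 * ε := le_mul_of_one_le_left hε (one_le_pow₀ hK1)
    linarith [abs_add_le ((X * (1 - q)) i j) (((X * (1 - q)).transpose * q) i j), bXP i j]
  -- the second derivative along the two directions
  set z : JetSpace n := jetDirSum (p x) (H x) (J x) v with hz
  set z' : JetSpace n := (X', 0, v ⬝ᵥ p x, WithLp.toLp 2 v) with hz'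
  have hpow : ∀ {k l : ℕ}, k ≤ l → K ^ k ≤ K ^ l := fun hkl => pow_le_pow_right₀ hK1 hkl
  have bs : |v ⬝ᵥ p x| ≤ 4 * K ^ 6 :=
    (abs_dotProduct_le hn (by positivity) hK0 bv hpK).trans (le_of_eq (by ring))
  have bvv : ‖WithLp.toLp 2 v‖ ≤ 4 * K ^ 6 :=
    (norm_toLp_le hn (by positivity) bv).trans (by linarith [hpow (show 5 ≤ 6 by norm_num)])
  have nz : ‖z‖ ≤ 4 * K ^ 6 := by
    refine max_le (norm_pi_pi_le (by positivity) bX) (max_le ?_ (max_le bs bvv))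
    refine (pi_norm_le_iff_of_nonneg (by positivity)).2 fun a => ?_
    exact (abs_mulVec_apply_le hn hHK bv a).trans (le_of_eq (by ring))
  have h614 := hpow (show 6 ≤ 14 by norm_num)
  have nz' : ‖z'‖ ≤ 4 * K ^ 14 := by
    refine max_le (norm_pi_pi_le (by positivity) bX') (max_le ?_ (max_le ?_ ?_))
    · rw [norm_zero]; positivity
    · exact bs.trans (by linarith)
    · exact bvv.trans (by linarith)
  have hK4ε : ε ≤ 2 * K ^ 4 * ε := le_mul_of_one_le_left hε (by linarith [one_le_pow₀ (n := 4) hK1])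
  have nzz : ‖z - z'‖ ≤ 2 * K ^ 4 * ε := by
    refine max_le (norm_pi_pi_le (by positivity) bXX') (max_le ?_ (max_le ?_ ?_))
    · refine (pi_norm_le_iff_of_nonneg (by positivity)).2 fun a => ?_
      have e : (z - z').2.1 a = (H x *ᵥ v) a := sub_zero _
      rw [e, hHv]
      exact (hM a).trans hK4ε
    · have e : (z - z').2.2.1 = 0 := sub_self _
      rw [e, norm_zero]; positivity
    · have e : (z - z').2.2.2 = 0 := sub_self _
      rw [e, norm_zero]; positivity
  have hD2 := bilin_sub_le hF2 nz nz' nzz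
  -- the inverse convexity inequality
  have hNherm : (N * X * N).IsHermitian := by
    rw [IsHermitian, conjTranspose_eq_transpose_of_trivial, transpose_mul, transpose_mul, hXs,
      h.symm_N, mul_assoc]
  have hic := hconv.second_deriv_nonneg hs.isOpen hs.contDiff_F hH hNherm (p x) (u x)
    (v ⬝ᵥ p x) hx (WithLp.toLp 2 v)
  rw [← hX'] at hic
  have hTT' : X' * (N * X * N) * H x = q.transpose * (X * N * X) * q := by
    rw [hX']
    calc _ = H x * N * X * (N * H x * N) * X * (N * H x) := by noncomm_ring
      _ = _ := by rw [h.mul_mul_self, hqT, hq]; noncomm_ring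
  set T := X * N * X with hT
  set T' := q.transpose * T * q with hT'
  have hTs : ∀ i j, T i j = T j i := fun i j => by
    have : T.transpose = T := by
      rw [hT, transpose_mul, transpose_mul, hXs, h.symm_N, mul_assoc]
    exact congrFun (congrFun this j) i
  have hsum : ∑ i, ∑ j, symbolF F (jetPt u p H x) i j * ((J x i *ᵥ v) ⬝ᵥ N *ᵥ (J x j *ᵥ v))
      = fderiv ℝ F (jetPt u p H x) (T, 0, 0, 0) := by
    rw [← sum_symbolF_mul F _ hTs]
    refine Finset.sum_congr rfl fun i _ => Finset.sum_congr rfl fun j _ => ?_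
    congr 1
    have e : ∀ i, J x i *ᵥ v = X i := fun i => funext fun b => (hXapp i b).symm
    rw [e, e, hT, mul_assoc, mul_apply]
    refine Finset.sum_congr rfl fun a _ => ?_
    rw [mul_apply]
    congr 1
    simp only [mulVec, dotProduct]
    exact Finset.sum_congr rfl fun b _ => congrArg _ (congrFun (congrFun hXs b) j)
  have bT : ∀ i j, |(T - T') i j| ≤ 8 * K ^ 13 * ε := fun i j => by
    have e : T - T' = X * N * (X * (1 - q)) + (X * (1 - q)).transpose * (N * X * q) := by
      have e : (X * (1 - q)).transpose = (1 - q.transpose) * X := by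
        rw [transpose_mul, transpose_sub, transpose_one, hXs]
      rw [hT', hT, e]
      noncomm_ring
    have h1 := abs_mul_apply_le hn (abs_mul_apply_le hn bX hNK) bXP i j
    have h2 := abs_mul_apply_le hn bPX
      (abs_mul_apply_le hn (abs_mul_apply_le hn hNK bX) bq) i j
    have h3 : K ^ 9 * ε ≤ K ^ 13 * ε := mul_le_mul_of_nonneg_right (hpow (by norm_num)) hε
    rw [e, Matrix.add_apply]
    refine (abs_add_le _ _).trans ((add_le_add h1 h2).trans ?_)
    linarith
  have hDT := IsSolutionJet.fderiv_matrix_le hF1 (by positivity) bT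
  have hsubT : fderiv ℝ F (jetPt u p H x) (T - T', 0, 0, 0)
      = fderiv ℝ F (jetPt u p H x) (T, 0, 0, 0) - fderiv ℝ F (jetPt u p H x) (T', 0, 0, 0) := by
    rw [← map_sub]
    exact congrArg _ (Prod.ext rfl (Prod.ext (sub_zero _).symm
      (Prod.ext (sub_zero _).symm (sub_zero _).symm)))
  have hsmulT : fderiv ℝ F (jetPt u p H x) ((2 : ℝ) • T', 0, 0, 0)
      = 2 * fderiv ℝ F (jetPt u p H x) (T', 0, 0, 0) := by
    rw [← smul_eq_mul, ← map_smul]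
    exact congrArg _ (Prod.ext rfl (Prod.ext (smul_zero _).symm
      (Prod.ext (smul_zero _).symm (smul_zero _).symm)))
  -- the lower order term
  set w : JetSpace n := (0, fun c => ∑ a, ∑ b, v a * v b * J x a b c, v ⬝ᵥ H x *ᵥ v, 0) with hw
  have nw : ‖w‖ ≤ 4 * K ^ 6 * ε := by
    refine max_le ?_ (max_le ?_ (max_le ?_ ?_))
    · rw [norm_zero]; positivity
    · refine (pi_norm_le_iff_of_nonneg (by positivity)).2 fun c => ?_
      have e : w.2.1 c = ((X * (1 - q)) *ᵥ y) c := by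
        rw [← mulVec_mulVec, ← hv]
        simp only [mulVec, dotProduct, hX, Matrix.sum_apply, Matrix.smul_apply, smul_eq_mul,
          Finset.sum_mul, hw]
        rw [Finset.sum_comm]
        exact Finset.sum_congr rfl fun b _ => Finset.sum_congr rfl fun a _ => by
          rw [hs.symm_J x hx a b c]; ring
      rw [e]
      refine (abs_mulVec_apply_le hn bXP hy c).trans ?_
      have : K * ε ≤ K ^ 6 * ε := mul_le_mul_of_nonneg_right (le_self_pow₀ hK1 (by norm_num)) hε
      nlinarith
    · have e : w.2.2.1 = v ⬝ᵥ (H x - H x * N * H x) *ᵥ y := by rw [← hHv]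
      rw [e]
      refine (abs_dotProduct_le hn (by positivity) hε bv hM).trans ?_
      have : K ^ 5 * ε ≤ K ^ 6 * ε := mul_le_mul_of_nonneg_right (hpow (by norm_num)) hε
      linarith
    · rw [norm_zero]; positivity
  have hDw := (fderiv ℝ F (jetPt u p H x)).le_of_opNorm_le hF1 w
  have hDw' : K * ‖w‖ ≤ 4 * K ^ 7 * ε :=
    (mul_le_mul_of_nonneg_left nw hK0).trans (le_of_eq (by ring))
  rw [Real.norm_eq_abs] at hDw
  have hlin : ∑ a, ∑ b, v a * v b * linearizedHess F u p H J x a b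
      = -fderiv ℝ (fderiv ℝ F) (jetPt u p H x) z z - fderiv ℝ F (jetPt u p H x) w :=
    sum_linearizedHess (fun a b => hs.symm_H x hx a b) v
  rw [hTT'] at hic
  have hic' : 0 ≤ fderiv ℝ (fderiv ℝ F) (jetPt u p H x) z' z'
      + 2 * fderiv ℝ F (jetPt u p H x) (T', 0, 0, 0) := by
    rw [← hsmulT]
    exact hic
  rw [hlin, hsum]
  rw [hsubT] at hDT
  have k1 : K ^ 7 * ε ≤ K ^ 19 * ε := mul_le_mul_of_nonneg_right (hpow (by norm_num)) hε
  have k2 : K ^ 14 * ε ≤ K ^ 19 * ε := mul_le_mul_of_nonneg_right (hpow (by norm_num)) hε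
  have k3 : K * (2 * K ^ 4 * ε) * (4 * K ^ 6 + 4 * K ^ 14) ≤ 16 * K ^ 19 * ε := by
    have : K ^ 11 * ε ≤ K ^ 19 * ε := mul_le_mul_of_nonneg_right (hpow (by norm_num)) hε
    linarith
  have l1 := (abs_le.1 hD2).2
  have l2 := (abs_le.1 hDT).1
  have l3 := (abs_le.1 hDw).1
  linarith

end

section
open Matrix
variable {n : ℕ}

theorem frob_comm (A A' : Matrix (Fin n) (Fin n) ℝ) : frob A A' = frob A' A :=
  Finset.sum_congr rfl fun _ _ => Finset.sum_congr rfl fun _ _ => mul_comm _ _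

theorem frob_smul_left (r : ℝ) (A A' : Matrix (Fin n) (Fin n) ℝ) :
    frob (r • A) A' = r * frob A A' := by
  simp [frob, Finset.mul_sum, mul_assoc]

theorem frob_smul_right (r : ℝ) (A A' : Matrix (Fin n) (Fin n) ℝ) :
    frob A (r • A') = r * frob A A' := by
  rw [frob_comm, frob_smul_left, frob_comm]

theorem frob_sub_right (A A' A'' : Matrix (Fin n) (Fin n) ℝ) :
    frob A (A' - A'') = frob A A' - frob A A'' := by
  simp [frob, mul_sub, Finset.sum_sub_distrib]

theorem frob_self_nonneg (A : Matrix (Fin n) (Fin n) ℝ) : 0 ≤ frob A A :=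
  Finset.sum_nonneg fun _ _ => Finset.sum_nonneg fun _ _ => mul_self_nonneg _

theorem frob_sq_le (A A' : Matrix (Fin n) (Fin n) ℝ) :
    frob A A' ^ 2 ≤ frob A A * frob A' A' := by
  simp only [frob, ← Fintype.sum_prod_type']
  refine (Finset.sum_mul_sq_le_sq_mul_sq _ _ _).trans (le_of_eq ?_)
  simp only [sq]

theorem sq_apply_le_frob (A : Matrix (Fin n) (Fin n) ℝ) (a b : Fin n) : A a b ^ 2 ≤ frob A A := by
  simp only [frob, ← Fintype.sum_prod_type', ← sq]
  exact Finset.single_le_sum (f := fun x : Fin n × Fin n => A x.1 x.2 ^ 2)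
    (fun x _ => sq_nonneg _) (Finset.mem_univ (a, b))

theorem sum_mul_frob_ge {c : Fin n → Fin n → ℝ} {l : ℝ}
    (hc : ∀ ξ : Fin n → ℝ, l * ∑ i, ξ i ^ 2 ≤ ∑ i, ∑ j, c i j * ξ i * ξ j)
    (E : Fin n → Matrix (Fin n) (Fin n) ℝ) :
    l * ∑ i, frob (E i) (E i) ≤ ∑ i, ∑ j, c i j * frob (E i) (E j) := by
  have e1 : l * ∑ i, frob (E i) (E i) = ∑ a, ∑ b, l * ∑ i, E i a b ^ 2 := by
    simp only [frob, ← Finset.mul_sum, ← sq]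
    congr 1
    rw [Finset.sum_comm]
    exact Finset.sum_congr rfl fun a _ => Finset.sum_comm
  have e2 : ∑ i, ∑ j, c i j * frob (E i) (E j)
      = ∑ a, ∑ b, ∑ i, ∑ j, c i j * E i a b * E j a b := by
    simp only [frob, Finset.mul_sum]
    calc _ = ∑ i, ∑ a, ∑ j, ∑ b, c i j * (E i a b * E j a b) :=
          Finset.sum_congr rfl fun i _ => Finset.sum_comm
      _ = ∑ a, ∑ i, ∑ j, ∑ b, c i j * (E i a b * E j a b) := Finset.sum_comm
      _ = ∑ a, ∑ i, ∑ b, ∑ j, c i j * (E i a b * E j a b) :=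
          Finset.sum_congr rfl fun a _ => Finset.sum_congr rfl fun i _ => Finset.sum_comm
      _ = ∑ a, ∑ b, ∑ i, ∑ j, c i j * (E i a b * E j a b) :=
          Finset.sum_congr rfl fun a _ => Finset.sum_comm
      _ = _ := by simp only [mul_assoc]
  rw [e1, e2]
  exact Finset.sum_le_sum fun a _ => Finset.sum_le_sum fun b _ => hc _

variable {B : Set (EuclideanSpace ℝ (Fin n))} {F : JetSpace n → ℝ}
  {u : EuclideanSpace ℝ (Fin n) → ℝ} {p : EuclideanSpace ℝ (Fin n) → Fin n → ℝ}
  {H : EuclideanSpace ℝ (Fin n) → Matrix (Fin n) (Fin n) ℝ}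
  {J : EuclideanSpace ℝ (Fin n) → Fin n → Matrix (Fin n) (Fin n) ℝ}
  {φ : EuclideanSpace ℝ (Fin n) → ℝ} {φ1 : EuclideanSpace ℝ (Fin n) → Fin n → ℝ}
  {φ2 : EuclideanSpace ℝ (Fin n) → Fin n → Fin n → ℝ}

theorem hasHessianOn_zero (s : Set (EuclideanSpace ℝ (Fin n))) :
    HasHessianOn (fun _ => 0) (fun _ _ => 0) (fun _ _ _ => 0) s := by
  have e : linForm (fun _ : Fin n => (0 : ℝ)) = 0 := by
    ext x
    simp [linForm_apply]
  exact ⟨fun x _ => by rw [e]; exact hasFDerivAt_const 0 x,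
    fun x _ i => by rw [e]; exact hasFDerivAt_const 0 x⟩

theorem HessianJet.grad_eq_zero_of_schur_eq_zero (hd : HessianJet B p H J)
    (hH : ∀ x ∈ B, (H x).PosSemidef) {x1 : EuclideanSpace ℝ (Fin n)} (hx1 : x1 ∈ B)
    {R : Matrix (Fin n) (Fin n) ℝ} {N M : EuclideanSpace ℝ (Fin n) → Matrix (Fin n) (Fin n) ℝ}
    (hN : ∀ᶠ x in 𝓝 x1, Matrix.IsPartialInv R (H x) (N x))
    (hM : ∀ x, M x = H x - H x * N x * H x) (hφ : HasHessianOn φ φ1 φ2 Set.univ)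
    (hmin : IsLocalMin (fun x => traceDefect (M x) - φ x) x1) (h0 : M x1 = 0) (i : Fin n) :
    φ1 x1 i = 0 := by
  have hB : ∀ᶠ x in 𝓝 x1, (H x).PosSemidef := by
    filter_upwards [hd.isOpen.mem_nhds hx1] with x hx using hH x hx
  have h1 := hN.self_of_nhds
  set v := fun κ => (1 - N x1 * H x1) *ᵥ testVec ((M x1).trace⁻¹ • M x1) κ with hv
  have hf := hd.first_order_of_tuple hx1 v _ hφ
    (isLocalMin_sum_affineVec (hB.and hN) (J x1) (fun _ => 0) hM hmin (fun κ => rfl)) i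
  have hc := hd.first_order_of_tuple hx1 v (fun _ _ => 0) (hasHessianOn_zero _) (by
    have e0 : ∑ κ, v κ ⬝ᵥ H x1 *ᵥ v κ = 0 := Finset.sum_eq_zero fun κ _ => by
      rw [hv, h1.dotProduct_schur, ← hM, h0, zero_mulVec, dotProduct_zero]
    filter_upwards [hB] with x hx
    have e : ∀ κ x, affineVec (v κ) (fun _ => 0) x1 x = v κ := fun κ x => by
      funext a; simp [affineVec]
    simp only [e, e0]
    refine sub_le_sub_right (Finset.sum_nonneg fun κ _ => ?_) _
    simpa using hx.dotProduct_mulVec_nonneg (v κ)) i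
  rw [hf, hc]
  refine Finset.sum_congr rfl fun κ _ => ?_
  rw [hv, h1.dotProduct_corrected, ← hM, h0]
  simp

end

section
open Matrix
variable {n : ℕ}

variable {B : Set (EuclideanSpace ℝ (Fin n))} {F : JetSpace n → ℝ}
  {u : EuclideanSpace ℝ (Fin n) → ℝ} {p : EuclideanSpace ℝ (Fin n) → Fin n → ℝ}
  {H : EuclideanSpace ℝ (Fin n) → Matrix (Fin n) (Fin n) ℝ}
  {J : EuclideanSpace ℝ (Fin n) → Fin n → Matrix (Fin n) (Fin n) ℝ}
  {φ : EuclideanSpace ℝ (Fin n) → ℝ} {φ1 : EuclideanSpace ℝ (Fin n) → Fin n → ℝ}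
  {φ2 : EuclideanSpace ℝ (Fin n) → Fin n → Fin n → ℝ}

theorem absorb_le {a e τ φ Λ : ℝ} (hτ : 0 < τ) (hΛ : 0 < Λ) :
    a * (τ + φ + 3 * e) - 2 / τ * (Λ⁻¹ * e ^ 2) ≤ a * (τ + φ) + 9 / 8 * a ^ 2 * Λ * τ := by
  have h : 0 ≤ 2 / τ * Λ⁻¹ * (e - 3 / 4 * a * Λ * τ) ^ 2 := by positivity
  have e1 : 2 / τ * Λ⁻¹ * (e - 3 / 4 * a * Λ * τ) ^ 2
      = 2 / τ * (Λ⁻¹ * e ^ 2) - 3 * a * e + 9 / 8 * a ^ 2 * Λ * τ := by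
    field_simp
    ring
  linarith

/-- The differential inequality for the functional `traceDefect (H - H N H)`, in the sense of test
functions touching from below. -/
theorem IsSolutionJet.sum_symbolF_hess_le (hs : IsSolutionJet B F u p H J)
    (hconv : InverseConvex B F) (hH : ∀ x ∈ B, (H x).PosSemidef) {Λ : ℝ} (hΛ : 0 < Λ)
    (hell : ∀ x ∈ B, ∀ ξ : Fin n → ℝ,
      Λ⁻¹ * ∑ i, ξ i ^ 2 ≤ ∑ i, ∑ j, symbolF F (jetPt u p H x) i j * ξ i * ξ j)
    (hn : 0 < n) {x1 : EuclideanSpace ℝ (Fin n)} (hx1 : x1 ∈ B)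
    {R : Matrix (Fin n) (Fin n) ℝ} {N M : EuclideanSpace ℝ (Fin n) → Matrix (Fin n) (Fin n) ℝ}
    (hN : ∀ᶠ x in 𝓝 x1, Matrix.IsPartialInv R (H x) (N x))
    (hM : ∀ x, M x = H x - H x * N x * H x) {K : ℝ} (hb : JetBound F u p H J (N x1) K x1)
    (hφ : HasHessianOn φ φ1 φ2 Set.univ) (hφ2 : ∀ i j, Continuous fun x => φ2 x i j)
    (hmin : IsLocalMin (fun x => traceDefect (M x) - φ x) x1) (hτ : 0 < (M x1).trace)
    {a : ℝ} (ha : a = Fintype.card ((Fin n × Fin n × Fin n) ⊕ Fin n) * (72 * K ^ 20)) :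
    ∑ i, ∑ j, symbolF F (jetPt u p H x1) i j * φ2 x1 i j ≤
      a * ((M x1).trace + ∑ i, |φ1 x1 i|) + 9 / 8 * a ^ 2 * Λ * (M x1).trace := by
  have hB : ∀ᶠ x in 𝓝 x1, (H x).PosSemidef := by
    filter_upwards [hs.isOpen.mem_nhds hx1] with x hx using hH x hx
  have h1 := hN.self_of_nhds
  have hMpsd : (M x1).PosSemidef := by rw [hM]; exact h1.posSemidef_schur (hH x1 hx1)
  set τ := (M x1).trace with hτdef
  set c := symbolF F (jetPt u p H x1) with hc
  set Y := τ⁻¹ • M x1 with hY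
  have hMY : M x1 = τ • Y := by rw [hY, smul_smul, mul_inv_cancel₀ hτ.ne', one_smul]
  set D : Fin n → Matrix (Fin n) (Fin n) ℝ :=
    fun i => (1 - H x1 * N x1) * J x1 i * (1 - N x1 * H x1) with hD
  set E : Fin n → Matrix (Fin n) (Fin n) ℝ := fun i => D i - (D i).trace • Y with hE
  set v := fun κ => (1 - N x1 * H x1) *ᵥ testVec Y κ with hv
  set v' := fun κ j => (1 - N x1 * H x1) *ᵥ testDir (τ⁻¹ • E j) κ - N x1 *ᵥ (J x1 j *ᵥ v κ) with hv'
  have hJs : ∀ i, (J x1 i).transpose = J x1 i := fun i => by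
    ext k l
    exact hs.symm_J x1 hx1 i l k
  have hmin' := isLocalMin_sum_affineVec (v := v) (hB.and hN) (J x1) (fun j => τ⁻¹ • E j) hM hmin
    (fun κ => rfl)
  -- sizes
  have hYle : ∀ k l, |Y k l| ≤ 1 := fun k l => by
    rw [hY, Matrix.smul_apply, smul_eq_mul, abs_mul, abs_inv, abs_of_pos hτ,
      inv_mul_le_iff₀ hτ, mul_one]
    exact hMpsd.abs_apply_le_trace k l
  have hYY : frob Y Y ≤ 1 := by
    rw [hY, frob_smul_left, frob_smul_right, inv_mul_le_iff₀ hτ, inv_mul_le_iff₀ hτ]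
    calc _ ≤ τ ^ 2 := hMpsd.frob_self_le
      _ = _ := by ring
  set e := √(∑ i, frob (E i) (E i)) with he
  have hS0 : 0 ≤ ∑ i, frob (E i) (E i) := Finset.sum_nonneg fun i _ => frob_self_nonneg _
  have he0 : 0 ≤ e := Real.sqrt_nonneg _
  have he2 : e ^ 2 = ∑ i, frob (E i) (E i) := Real.sq_sqrt hS0
  have hEi : ∀ i, frob (E i) (E i) ≤ e ^ 2 := fun i => by
    rw [he2]
    exact Finset.single_le_sum (f := fun i => frob (E i) (E i))
      (fun i _ => frob_self_nonneg _) (Finset.mem_univ i)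
  have hEle : ∀ i k l, |E i k l| ≤ e := fun i k l =>
    abs_le_of_sq_le_sq ((sq_apply_le_frob _ k l).trans (hEi i)) he0
  have hYE : ∀ i, |frob Y (E i)| ≤ e := fun i => by
    refine abs_le_of_sq_le_sq ((frob_sq_le _ _).trans ?_) he0
    calc _ ≤ 1 * e ^ 2 := mul_le_mul hYY (hEi i) (frob_self_nonneg _) zero_le_one
      _ = _ := one_mul _
  set Φ := ∑ i, |φ1 x1 i| with hΦ
  have hΦi : ∀ i, |φ1 x1 i| ≤ Φ := fun i =>
    Finset.single_le_sum (f := fun i => |φ1 x1 i|) (fun i _ => abs_nonneg _) (Finset.mem_univ i)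
  have hDsymm : ∀ i k l, D i k l = D i l k := fun i k l => by
    have : (D i).transpose = D i := by
      simp only [hD]
      rw [transpose_mul, transpose_mul, hJs, h1.transpose_proj, ← h1.transpose_proj,
        transpose_transpose, mul_assoc]
    exact congrFun (congrFun this l) k
  -- the first order condition
  have hfirst : ∀ i, φ1 x1 i = (n + 1 - frob Y Y) * (D i).trace - 2 * frob Y (E i) := fun i => by
    rw [hs.toHessianJet.first_order_of_tuple hx1 v v' hφ hmin' i, Finset.sum_add_distrib,
      ← Finset.mul_sum]
    have e1 : ∑ κ, v κ ⬝ᵥ J x1 i *ᵥ v κ = ∑ κ, testVec Y κ ⬝ᵥ D i *ᵥ testVec Y κ :=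
      Finset.sum_congr rfl fun κ _ => by
        simp only [hv, hD]
        rw [mulVec_dotProduct_eq, h1.transpose_proj, mulVec_mulVec, mulVec_mulVec, mul_assoc]
    have e2 : ∑ κ, v κ ⬝ᵥ H x1 *ᵥ v' κ i = 0 := by
      have : ∑ κ, v κ ⬝ᵥ H x1 *ᵥ v' κ i
          = ∑ κ, testVec Y κ ⬝ᵥ M x1 *ᵥ testDir (τ⁻¹ • E i) κ :=
        Finset.sum_congr rfl fun κ _ => by
          simp only [hv, hv']
          rw [h1.dotProduct_corrected, hM]
      rw [this, sum_testVec_testDir, ← hτdef, frob_smul_left τ⁻¹ (E i) (M x1),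
        ← frob_smul_right τ⁻¹ (E i) (M x1), ← hY, frob_smul_right τ⁻¹ Y (E i), frob_comm (E i) Y]
      field_simp
      ring
    have e3 : frob Y (E i) = frob Y (D i) - (D i).trace * frob Y Y := by
      rw [← frob_smul_right (D i).trace Y Y, ← frob_sub_right]
    rw [e1, e2, sum_testVec _ _ (hDsymm i), e3]
    ring
  have hn1 : (1 : ℝ) ≤ n := by exact_mod_cast hn
  have htr : ∀ i, |(D i).trace| ≤ Φ + 2 * e := fun i => by
    have h2 : 1 * |(D i).trace| ≤ (n + 1 - frob Y Y) * |(D i).trace| :=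
      mul_le_mul_of_nonneg_right (by linarith) (abs_nonneg _)
    have h3 : (n + 1 - frob Y Y) * |(D i).trace| = |φ1 x1 i + 2 * frob Y (E i)| := by
      rw [hfirst i, sub_add_cancel, abs_mul, abs_of_nonneg (by linarith : 0 ≤ n + 1 - frob Y Y)]
    have h4 := abs_add_le (φ1 x1 i) (2 * frob Y (E i))
    rw [abs_mul, abs_two] at h4
    linarith [hΦi i, hYE i]
  have hDle : ∀ i k l, |D i k l| ≤ Φ + 3 * e := fun i k l => by
    have e1 : D i k l = E i k l + (D i).trace * Y k l := by simp [hE]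
    have h2 := mul_le_mul (htr i) (hYle k l) (abs_nonneg _)
      ((abs_nonneg _).trans (htr i))
    rw [← abs_mul] at h2
    rw [e1]
    linarith [abs_add_le (E i k l) ((D i).trace * Y k l), hEle i k l]
  -- the pointwise bound for each test vector
  have hy : ∀ κ k, |testVec Y κ k| ≤ 2 := abs_testVec_le hYle
  have hK0 : 0 ≤ K := zero_le_one.trans hb.one_le
  have hΦ0 : 0 ≤ Φ := Finset.sum_nonneg fun i _ => abs_nonneg _
  have hpt : ∀ κ, (∑ k, ∑ l, v κ k * v κ l * linearizedHess F u p H J x1 k l)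
      - 2 * ∑ i, ∑ j, c i j * ((J x1 i *ᵥ v κ) ⬝ᵥ N x1 *ᵥ (J x1 j *ᵥ v κ))
      ≤ 36 * K ^ 19 * (2 * K * (τ + Φ + 3 * e)) := fun κ => by
    refine hs.linearizedHess_sub_le hconv hx1 (hH x1 hx1) h1 hb (by positivity) (hy κ) rfl
      (fun i l => ?_) fun l => ?_
    · refine (abs_mulVec_apply_le hb.dim_le (hDle i) (hy κ) l).trans ?_
      nlinarith [mul_nonneg hK0 hτ.le]
    · rw [← hM]
      refine (abs_mulVec_apply_le hb.dim_le hMpsd.abs_apply_le_trace (hy κ) l).trans ?_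
      nlinarith [mul_nonneg hK0 hΦ0, mul_nonneg hK0 he0]
  -- the second order condition
  have hsecond := hs.second_order_of_tuple (fun x hx ξ => le_trans (by positivity) (hell x hx ξ))
    hx1 v v' hφ hφ2 hmin'
  have hbr : ∀ κ, ∑ i, ∑ j, c i j *
      (4 * (v κ ⬝ᵥ J x1 i *ᵥ v' κ j) + 2 * (v' κ i ⬝ᵥ H x1 *ᵥ v' κ j))
      = ∑ i, ∑ j, c i j * (4 * (testVec Y κ ⬝ᵥ D i *ᵥ testDir (τ⁻¹ • E j) κ)
          + 2 * (testDir (τ⁻¹ • E i) κ ⬝ᵥ M x1 *ᵥ testDir (τ⁻¹ • E j) κ))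
        - 2 * ∑ i, ∑ j, c i j * ((J x1 i *ᵥ v κ) ⬝ᵥ N x1 *ᵥ (J x1 j *ᵥ v κ)) := fun κ => by
    rw [Finset.mul_sum, ← Finset.sum_sub_distrib]
    refine Finset.sum_congr rfl fun i _ => ?_
    rw [Finset.mul_sum, ← Finset.sum_sub_distrib]
    refine Finset.sum_congr rfl fun j _ => ?_
    have := h1.bracket_eq (hJs i) (J' := J x1 j) (testVec Y κ) (testDir (τ⁻¹ • E i) κ)
      (testDir (τ⁻¹ • E j) κ)
    simp only [hv, hv']
    rw [this, ← hM]
    ring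
  have hcross : ∑ κ, ∑ i, ∑ j, c i j * (4 * (testVec Y κ ⬝ᵥ D i *ᵥ testDir (τ⁻¹ • E j) κ)
          + 2 * (testDir (τ⁻¹ • E i) κ ⬝ᵥ M x1 *ᵥ testDir (τ⁻¹ • E j) κ))
      = -(2 / τ) * ∑ i, ∑ j, c i j * frob (E i) (E j) := by
    rw [Finset.sum_comm, Finset.mul_sum]
    refine Finset.sum_congr rfl fun i _ => ?_
    rw [Finset.sum_comm, Finset.mul_sum]
    refine Finset.sum_congr rfl fun j _ => ?_
    rw [← Finset.mul_sum, Finset.sum_add_distrib, ← Finset.mul_sum, ← Finset.mul_sum,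
      sum_testVec_testDir, sum_testDir, ← hτdef]
    have e1 : frob (E j) (E i) = frob (E j) (D i) - (D i).trace * frob Y (E j) := by
      simp only [hE]
      rw [frob_sub_right, frob_smul_right, frob_comm Y]
    simp only [frob_smul_left, frob_smul_right]
    have e2 : frob (E j) (D i) = frob (E i) (E j) + (D i).trace * frob Y (E j) := by
      rw [frob_comm (E i), e1]; ring
    rw [e2]
    field_simp
    ring
  have hsum : ∑ κ, ((∑ k, ∑ l, v κ k * v κ l * linearizedHess F u p H J x1 k l)
        + ∑ i, ∑ j, c i j *
          (4 * (v κ ⬝ᵥ J x1 i *ᵥ v' κ j) + 2 * (v' κ i ⬝ᵥ H x1 *ᵥ v' κ j)))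
      ≤ a * (τ + Φ + 3 * e) - 2 / τ * (Λ⁻¹ * e ^ 2) := by
    have h2 := Finset.sum_le_card_nsmul Finset.univ _ _ fun κ _ => hpt κ
    rw [Finset.card_univ, nsmul_eq_mul] at h2
    have h3 := mul_le_mul_of_nonneg_left (sum_mul_frob_ge (hell x1 hx1) E)
      (by positivity : 0 ≤ 2 / τ)
    rw [← he2] at h3
    have h4 : ∑ κ, ((∑ k, ∑ l, v κ k * v κ l * linearizedHess F u p H J x1 k l)
        + ∑ i, ∑ j, c i j *
          (4 * (v κ ⬝ᵥ J x1 i *ᵥ v' κ j) + 2 * (v' κ i ⬝ᵥ H x1 *ᵥ v' κ j)))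
        = ∑ κ, ((∑ k, ∑ l, v κ k * v κ l * linearizedHess F u p H J x1 k l)
          - 2 * ∑ i, ∑ j, c i j * ((J x1 i *ᵥ v κ) ⬝ᵥ N x1 *ᵥ (J x1 j *ᵥ v κ)))
          + -(2 / τ) * ∑ i, ∑ j, c i j * frob (E i) (E j) := by
      rw [← hcross, ← Finset.sum_add_distrib]
      refine Finset.sum_congr rfl fun κ _ => ?_
      rw [hbr]
      ring
    rw [h4, ha]
    linarith
  exact hsecond.trans (hsum.trans (absorb_le hτ hΛ))

end

section
open Matrix
variable {n : ℕ}

theorem Matrix.PosSemidef.eq_zero_of_traceDefect {A : Matrix (Fin n) (Fin n) ℝ}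
    (hA : A.PosSemidef) (hn : 0 < n) (h : traceDefect A = 0) : A = 0 := by
  have hn' : (0 : ℝ) < n := by exact_mod_cast hn
  have h1 := hA.mul_trace_le_traceDefect
  rw [h] at h1
  have h2 : A.trace = 0 :=
    le_antisymm (nonpos_of_mul_nonpos_right h1 hn') hA.trace_nonneg
  ext a b
  have := hA.abs_apply_le_trace a b
  rw [h2] at this
  exact abs_nonpos_iff.1 this

theorem Matrix.PosSemidef.traceDefect_nonneg {A : Matrix (Fin n) (Fin n) ℝ} (hA : A.PosSemidef) :
    0 ≤ traceDefect A :=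
  (mul_nonneg n.cast_nonneg hA.trace_nonneg).trans hA.mul_trace_le_traceDefect

theorem continuousOn_traceDefect :
    ContinuousOn (traceDefect (n := n)) {A | A.PosSemidef} := by
  intro A hA
  have ht : Continuous fun A : Matrix (Fin n) (Fin n) ℝ => A.trace := by fun_prop
  have hf : Continuous fun A : Matrix (Fin n) (Fin n) ℝ => frob A A := by
    unfold frob
    fun_prop
  refine ContinuousWithinAt.sub (by fun_prop) ?_
  by_cases h0 : A.trace = 0
  · have hz : frob A A / A.trace = 0 := by rw [h0, div_zero]
    rw [ContinuousWithinAt, hz]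
    have h1 : Tendsto (fun A : Matrix (Fin n) (Fin n) ℝ => A.trace)
        (𝓝[{A | A.PosSemidef}] A) (𝓝 0) := by
      rw [← h0]
      exact ht.continuousAt.tendsto.mono_left nhdsWithin_le_nhds
    refine tendsto_of_tendsto_of_tendsto_of_le_of_le' tendsto_const_nhds h1 ?_ ?_
    · filter_upwards [self_mem_nhdsWithin] with A' hA'
      exact div_nonneg (frob_self_nonneg _) (Matrix.PosSemidef.trace_nonneg hA')
    · filter_upwards [self_mem_nhdsWithin] with A' hA'
      have h2 := Matrix.PosSemidef.trace_nonneg hA'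
      exact div_le_of_le_mul₀ h2 h2 (by rw [← sq]; exact Matrix.PosSemidef.frob_self_le hA')
  · exact (hf.continuousAt.div ht.continuousAt h0).continuousWithinAt

/-- `Q` is a supersolution of `c_{ij} D_{ij} Q ≤ C (Q + |DQ|)` in the sense of test functions
touching from below, with the additional information that `D Q = 0` where `Q = 0`. -/
structure TouchingSupersolution (c : EuclideanSpace ℝ (Fin n) → Fin n → Fin n → ℝ)
    (Q : EuclideanSpace ℝ (Fin n) → ℝ) (C : ℝ) (s : Set (EuclideanSpace ℝ (Fin n))) : Prop where
  grad : ∀ x ∈ s, ∀ φ φ1 φ2, HasHessianOn φ φ1 φ2 Set.univ → IsLocalMin (fun y => Q y - φ y) x →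
    Q x = 0 → ∀ i, φ1 x i = 0
  hess : ∀ x ∈ s, ∀ φ φ1 φ2, HasHessianOn φ φ1 φ2 Set.univ →
    (∀ i j, Continuous fun y => φ2 y i j) → IsLocalMin (fun y => Q y - φ y) x → 0 < Q x →
    ∑ i, ∑ j, c x i j * φ2 x i j ≤ C * (Q x + ∑ i, |φ1 x i|)

variable {B : Set (EuclideanSpace ℝ (Fin n))} {F : JetSpace n → ℝ}
  {u : EuclideanSpace ℝ (Fin n) → ℝ} {p : EuclideanSpace ℝ (Fin n) → Fin n → ℝ}
  {H : EuclideanSpace ℝ (Fin n) → Matrix (Fin n) (Fin n) ℝ}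
  {J : EuclideanSpace ℝ (Fin n) → Fin n → Matrix (Fin n) (Fin n) ℝ}

theorem IsSolutionJet.exists_jetBound (hs : IsSolutionJet B F u p H J)
    {N : EuclideanSpace ℝ (Fin n) → Matrix (Fin n) (Fin n) ℝ}
    {s : Set (EuclideanSpace ℝ (Fin n))} (hsc : IsCompact s) (hsB : s ⊆ B)
    (hN : ContinuousOn N s) : ∃ K, ∀ x ∈ s, JetBound F u p H J (N x) K x := by
  have hp : ContinuousOn p s := fun x hx => (hs.continuousAt_p (hsB hx)).continuousWithinAt
  have hH : ContinuousOn H s := fun x hx => (hs.continuousAt_H (hsB hx)).continuousWithinAt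
  have hJ : ContinuousOn J s := fun x hx => (hs.continuousAt_J (hsB hx)).continuousWithinAt
  have h1 : ContinuousOn (fun x => fderiv ℝ F (jetPt u p H x)) s := fun x hx =>
    (hs.continuousAt_fderiv (hsB hx)).continuousWithinAt
  have h2 : ContinuousOn (fun x => fderiv ℝ (fderiv ℝ F) (jetPt u p H x)) s := fun x hx =>
    (hs.continuousAt_fderiv_fderiv (hsB hx)).continuousWithinAt
  obtain ⟨K1, hK1⟩ := hsc.exists_bound_of_continuousOn hp
  obtain ⟨K2, hK2⟩ := hsc.exists_bound_of_continuousOn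
    (E := Fin n → Fin n → ℝ) (f := H) hH
  obtain ⟨K3, hK3⟩ := hsc.exists_bound_of_continuousOn
    (E := Fin n → Fin n → Fin n → ℝ) (f := J) hJ
  obtain ⟨K4, hK4⟩ := hsc.exists_bound_of_continuousOn
    (E := Fin n → Fin n → ℝ) (f := N) hN
  obtain ⟨K5, hK5⟩ := hsc.exists_bound_of_continuousOn h1
  obtain ⟨K6, hK6⟩ := hsc.exists_bound_of_continuousOn
    (E := JetSpace n →L[ℝ] JetSpace n →L[ℝ] ℝ) h2
  have hn : (0 : ℝ) ≤ n := n.cast_nonneg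
  refine ⟨1 + n + |K1| + |K2| + |K3| + |K4| + |K5| + |K6|, fun x hx => ?_⟩
  have a1 := abs_nonneg K1
  have a2 := abs_nonneg K2
  have a3 := abs_nonneg K3
  have a4 := abs_nonneg K4
  have a5 := abs_nonneg K5
  have a6 := abs_nonneg K6
  refine ⟨by linarith, by linarith, fun b => ?_, fun a b => ?_, fun i a b => ?_, fun a b => ?_,
    ?_, ?_⟩
  · linarith [(norm_le_pi_norm (p x) b).trans (hK1 x hx), le_abs_self K1,
      Real.norm_eq_abs (p x b)]
  · linarith [((norm_le_pi_norm (show Fin n → ℝ from H x a) b).trans (norm_le_pi_norm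
      (H x : Fin n → Fin n → ℝ) a)).trans (hK2 x hx), le_abs_self K2, Real.norm_eq_abs (H x a b)]
  · linarith [((norm_le_pi_norm (J x i a) b).trans ((norm_le_pi_norm
      (J x i : Fin n → Fin n → ℝ) a).trans (norm_le_pi_norm
      (show Fin n → Fin n → Fin n → ℝ from J x) i))).trans (hK3 x hx), le_abs_self K3,
      Real.norm_eq_abs (J x i a b)]
  · linarith [((norm_le_pi_norm (N x a) b).trans (norm_le_pi_norm
      (N x : Fin n → Fin n → ℝ) a)).trans (hK4 x hx), le_abs_self K4, Real.norm_eq_abs (N x a b)]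
  · linarith [hK5 x hx, le_abs_self K5]
  · linarith [hK6 x hx, le_abs_self K6]

/-- Near each point there is a supersolution whose zeros are points where the Hessian has a fixed
rank. -/
theorem IsSolutionJet.exists_touchingSupersolution (hs : IsSolutionJet B F u p H J)
    (hconv : InverseConvex B F) (hH : ∀ x ∈ B, (H x).PosSemidef) {Λ : ℝ} (hΛ : 0 < Λ)
    (hell : ∀ x ∈ B, ∀ ξ : Fin n → ℝ,
      Λ⁻¹ * ∑ i, ξ i ^ 2 ≤ ∑ i, ∑ j, symbolF F (jetPt u p H x) i j * ξ i * ξ j)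
    (hn : 0 < n) {x0 : EuclideanSpace ℝ (Fin n)} (hx0 : x0 ∈ B) :
    ∃ (r : ℝ) (Q : EuclideanSpace ℝ (Fin n) → ℝ) (C : ℝ) (k : ℕ), 0 < r ∧ 0 ≤ C ∧
      closedBall x0 r ⊆ B ∧ ContinuousOn Q (closedBall x0 r) ∧ (∀ x ∈ closedBall x0 r, 0 ≤ Q x) ∧
      Q x0 = 0 ∧ (∀ x ∈ closedBall x0 r, Q x = 0 → (H x).rank = k) ∧
      TouchingSupersolution (fun x => symbolF F (jetPt u p H x)) Q C (ball x0 r) := by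
  have hHt : ∀ x ∈ B, (H x).transpose = H x := fun x hx => by
    ext a b
    exact hs.symm_H x hx b a
  obtain ⟨R, hRs, hRR, hHR, hdet⟩ := (hH x0 hx0).exists_ker_projection
  set G := fun x => compressAdd R (H x) with hG
  set N := fun x => (G x)⁻¹ - R with hN
  set M := fun x => H x - H x * N x * H x with hM
  have hGc : ∀ x ∈ B, ContinuousAt G x := fun x hx => by
    have : Continuous fun A : Matrix (Fin n) (Fin n) ℝ => compressAdd R A := by
      unfold compressAdd
      fun_prop
    exact this.continuousAt.comp (hs.continuousAt_H hx)
  have hG0 : (G x0).det ≠ 0 := by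
    rw [hG]
    simpa only [compressAdd_eq (hHt x0 hx0) hRs hHR] using hdet
  have hev : ∀ᶠ x in 𝓝 x0, x ∈ B ∧ (G x).det ≠ 0 :=
    Filter.Eventually.and (hs.isOpen.mem_nhds hx0)
      (((Continuous.matrix_det continuous_id).continuousAt.comp (hGc x0 hx0)).eventually_ne hG0)
  obtain ⟨r, hr, hball⟩ := Metric.nhds_basis_closedBall.eventually_iff.1 hev
  have hNc : ∀ x ∈ closedBall x0 r, ContinuousAt N x := fun x hx =>
    (Matrix.continuousAt_inv_apply (hGc x (hball hx).1) (hball hx).2).sub continuousAt_const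
  have hpi : ∀ x ∈ closedBall x0 r, IsPartialInv R (H x) (N x) := fun x hx =>
    isPartialInv_inv_compressAdd hRs hRR (hHt x (hball hx).1) (hball hx).2
  have hMpsd : ∀ x ∈ closedBall x0 r, (M x).PosSemidef := fun x hx =>
    (hpi x hx).posSemidef_schur (hH x (hball hx).1)
  have hMc : ContinuousOn M (closedBall x0 r) := fun x hx => by
    have h1 := hs.continuousAt_H (hball hx).1
    have h2 := hNc x hx
    exact (h1.sub ((h1.mul h2).mul h1)).continuousWithinAt
  have hx0r : x0 ∈ closedBall x0 r := mem_closedBall_self hr.le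
  obtain ⟨K, hK⟩ := hs.exists_jetBound (isCompact_closedBall x0 r) (fun x hx => (hball hx).1)
    (N := N) fun x hx => (hNc x hx).continuousWithinAt
  have hK1 := (hK x0 hx0r).one_le
  set a : ℝ := Fintype.card ((Fin n × Fin n × Fin n) ⊕ Fin n) * (72 * K ^ 20) with ha
  have ha0 : 0 ≤ a := by positivity
  have hnear : ∀ x ∈ ball x0 r, ∀ᶠ y in 𝓝 x, IsPartialInv R (H y) (N y) := fun x hx => by
    filter_upwards [isOpen_ball.mem_nhds hx] with y hy using hpi y (ball_subset_closedBall hy)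
  refine ⟨r, fun x => traceDefect (M x), a + 9 / 8 * a ^ 2 * Λ, (1 - R).rank, hr, by positivity,
    fun x hx => (hball hx).1, continuousOn_traceDefect.comp hMc hMpsd,
    fun x hx => (hMpsd x hx).traceDefect_nonneg, ?_, fun x hx h0 => ?_,
    fun x hx φ φ1 φ2 hφ hmin h0 => ?_,
    fun x hx φ φ1 φ2 hφ hφ2 hmin h0 => ?_⟩
  · have : M x0 = 0 := (hpi x0 hx0r).schur_eq_zero (hHt x0 hx0) hRs hHR
    simp only [this]
    simp [traceDefect, frob]
  · exact (hpi x hx).rank_eq_of_schur_eq_zero ((hMpsd x hx).eq_zero_of_traceDefect hn h0)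
  · have hx' := ball_subset_closedBall hx
    exact hs.toHessianJet.grad_eq_zero_of_schur_eq_zero hH (hball hx').1 (hnear x hx)
      (fun _ => rfl) hφ hmin ((hMpsd x hx').eq_zero_of_traceDefect hn h0)
  · have hx' := ball_subset_closedBall hx
    have hn1 : (1 : ℝ) ≤ n := by exact_mod_cast hn
    have htr0 := (hMpsd x hx').trace_nonneg
    have htr : (M x).trace ≤ traceDefect (M x) :=
      (le_mul_of_one_le_left htr0 hn1).trans (hMpsd x hx').mul_trace_le_traceDefect
    have hpos : 0 < (M x).trace := by
      refine htr0.lt_of_ne fun h => ?_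
      simp [traceDefect, ← h] at h0
    refine (hs.sum_symbolF_hess_le hconv hH hΛ hell hn (hball hx').1 (hnear x hx)
      (fun _ => rfl) (hK x hx') hφ hφ2 hmin hpos ha).trans ?_
    have hS : 0 ≤ ∑ i, |φ1 x i| := Finset.sum_nonneg fun i _ => abs_nonneg _
    have h3 : 0 ≤ 9 / 8 * a ^ 2 * Λ := by positivity
    nlinarith [mul_le_mul_of_nonneg_left htr ha0, mul_le_mul_of_nonneg_left htr h3,
      mul_nonneg h3 hS]

end

section
variable {n : ℕ}

/-- The quadratic polynomial `r - |x - y|² - |x - x0|²`. -/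
noncomputable def barrier (r : ℝ) (y x0 x : EuclideanSpace ℝ (Fin n)) : ℝ :=
  r - ‖x - y‖ ^ 2 - ‖x - x0‖ ^ 2

noncomputable def barrierGrad (y x0 x : EuclideanSpace ℝ (Fin n)) (i : Fin n) : ℝ :=
  -2 * ((x - y) + (x - x0)) i

theorem hasHessianOn_barrier (r : ℝ) (y x0 : EuclideanSpace ℝ (Fin n)) :
    HasHessianOn (barrier r y x0) (barrierGrad y x0) (fun _ i j => if i = j then -4 else 0)
      Set.univ := by
  have h := ((HasHessianOn.affine r 0 x0).sub (HasHessianOn.sqDist y Set.univ)).sub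
    (HasHessianOn.sqDist x0 Set.univ)
  convert h using 1
  · funext x
    simp [barrier, EuclideanSpace.real_norm_sq_eq]
  · funext x i
    simp [barrierGrad]
    ring
  · funext x i j
    split_ifs <;> norm_num

theorem sum_barrierGrad_sq (y x0 x : EuclideanSpace ℝ (Fin n)) :
    ∑ i, barrierGrad y x0 x i ^ 2 = 4 * ‖(x - y) + (x - x0)‖ ^ 2 := by
  rw [EuclideanSpace.real_norm_sq_eq, Finset.mul_sum]
  refine Finset.sum_congr rfl fun i _ => ?_
  rw [barrierGrad]
  ring

theorem norm_barrier_bounds {d s : ℝ} {y x0 x : EuclideanSpace ℝ (Fin n)} (hd : dist x0 y = d)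
    (hs : s ≤ d / 4) (hx : dist x x0 ≤ s) :
    d / 2 ≤ ‖(x - y) + (x - x0)‖ ∧ ‖(x - y) + (x - x0)‖ ≤ 2 * d ∧
      |barrier (d ^ 2) y x0 x| ≤ 3 * d * s := by
  rw [dist_eq_norm] at hd hx
  have hs0 : 0 ≤ s := (norm_nonneg _).trans hx
  have e : (x - y) + (x - x0) = (x0 - y) + ((x - x0) + (x - x0)) := by abel
  have h1 := norm_add_le (x - x0) (x - x0)
  have h2 := norm_add_le (x0 - y) ((x - x0) + (x - x0))
  have h3 := norm_sub_le_norm_add (x0 - y) ((x - x0) + (x - x0))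
  have h4 : ‖x - y‖ ≤ d + s := by
    have := norm_add_le (x - x0) (x0 - y)
    rw [sub_add_sub_cancel] at this
    linarith
  have h5 : d - s ≤ ‖x - y‖ := by
    have := norm_sub_norm_le (x0 - y) (x0 - x)
    rw [sub_sub_sub_cancel_left, norm_sub_rev x0 x] at this
    linarith
  have h6 := norm_nonneg (x - x0)
  rw [e]
  refine ⟨by linarith, by linarith, ?_⟩
  rw [barrier, abs_le]
  constructor <;> nlinarith

/-- The composition `ε (q + A q²)`. -/
theorem HasHessianOn.quadratic_comp {q : EuclideanSpace ℝ (Fin n) → ℝ} {q1 q2}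
    {s : Set (EuclideanSpace ℝ (Fin n))} (hq : HasHessianOn q q1 q2 s) (ε A : ℝ) :
    HasHessianOn (fun x => ε * (q x * (1 + A * q x)))
      (fun x i => ε * ((1 + 2 * A * q x) * q1 x i))
      (fun x i j => ε * ((1 + 2 * A * q x) * q2 x i j + 2 * A * (q1 x i * q1 x j))) s := by
  convert (hq.add ((hq.mul hq).const_mul A)).const_mul ε using 1
  · funext x; ring
  · funext x i; ring
  · funext x i j; ring

theorem sum_diag_le {c : Fin n → Fin n → ℝ} {l : ℝ}
    (hc : ∀ ξ : Fin n → ℝ, ∑ i, ∑ j, c i j * ξ i * ξ j ≤ l * ∑ i, ξ i ^ 2) :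
    ∑ i, c i i ≤ n * l := by
  calc ∑ i, c i i ≤ ∑ _i : Fin n, l := Finset.sum_le_sum fun k _ => by
        simpa [Pi.single_apply, ite_pow] using hc (Pi.single k 1)
    _ = n * l := by simp

/-- The elliptic operator applied to the barrier dominates the lower order terms. -/
theorem lt_sum_mul_hess_barrier {c : Fin n → Fin n → ℝ} {Λ C d A ε b Q : ℝ} {q1 : Fin n → ℝ}
    (hΛ : 0 < Λ) (hC : 0 ≤ C) (hd : 0 < d) (hε : 0 < ε)
    (hA : A = Λ * (6 * n * Λ + C * (2 * d ^ 2 + 6 * n * d) + 1) / (2 * d ^ 2))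
    (hell : ∀ ξ : Fin n → ℝ, Λ⁻¹ * ∑ i, ξ i ^ 2 ≤ ∑ i, ∑ j, c i j * ξ i * ξ j)
    (hell' : ∀ ξ : Fin n → ℝ, ∑ i, ∑ j, c i j * ξ i * ξ j ≤ Λ * ∑ i, ξ i ^ 2)
    (hb : |A * b| ≤ 1 / 4) (h1 : d ^ 2 ≤ ∑ i, q1 i ^ 2) (h2 : ∑ i, q1 i ^ 2 ≤ (4 * d) ^ 2)
    (hQ : Q ≤ 2 * ε * d ^ 2) :
    C * (Q + ∑ i, |ε * ((1 + 2 * A * b) * q1 i)|) < ∑ i, ∑ j, c i j *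
      (ε * ((1 + 2 * A * b) * (if i = j then -4 else 0) + 2 * A * (q1 i * q1 j))) := by
  rw [abs_le] at hb
  have hn : (0 : ℝ) ≤ n := n.cast_nonneg
  have hA0 : 0 < A := by rw [hA]; positivity
  have hAe : 2 * A * (Λ⁻¹ * d ^ 2) = 6 * n * Λ + C * (2 * d ^ 2 + 6 * n * d) + 1 := by
    rw [hA]
    field_simp
  have hlhs : ∑ i, |ε * ((1 + 2 * A * b) * q1 i)| ≤ ε * (6 * n * d) := by
    calc _ ≤ ∑ _i : Fin n, ε * (3 / 2 * (4 * d)) := Finset.sum_le_sum fun i _ => by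
          have hq : |q1 i| ≤ 4 * d := abs_le_of_sq_le_sq
            ((Finset.single_le_sum (f := fun i => q1 i ^ 2) (fun i _ => sq_nonneg _)
              (Finset.mem_univ i)).trans h2) (by positivity)
          rw [abs_mul, abs_mul, abs_of_pos hε, abs_of_pos (by linarith : 0 < 1 + 2 * A * b)]
          gcongr
          linarith
      _ = _ := by
          rw [Finset.sum_const, Finset.card_univ, Fintype.card_fin, nsmul_eq_mul]
          ring
  have hrhs : ∑ i, ∑ j, c i j *
      (ε * ((1 + 2 * A * b) * (if i = j then -4 else 0) + 2 * A * (q1 i * q1 j)))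
      = ε * (2 * A * (∑ i, ∑ j, c i j * q1 i * q1 j) - 4 * (1 + 2 * A * b) * ∑ i, c i i) := by
    have e : ∀ i, c i i = ∑ j, c i j * if i = j then 1 else 0 := fun i => by simp
    simp only [e]
    rw [Finset.mul_sum, Finset.mul_sum, ← Finset.sum_sub_distrib, Finset.mul_sum]
    refine Finset.sum_congr rfl fun i _ => ?_
    rw [Finset.mul_sum, Finset.mul_sum, ← Finset.sum_sub_distrib, Finset.mul_sum]
    refine Finset.sum_congr rfl fun j _ => ?_
    split_ifs <;> ring
  have htr := sum_diag_le hell'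
  have h3 : Λ⁻¹ * d ^ 2 ≤ ∑ i, ∑ j, c i j * q1 i * q1 j :=
    (mul_le_mul_of_nonneg_left h1 (inv_pos.2 hΛ).le).trans (hell q1)
  have h4 := mul_le_mul_of_nonneg_left h3 (by positivity : 0 ≤ 2 * A)
  have h5 : 4 * (1 + 2 * A * b) * ∑ i, c i i ≤ 6 * (n * Λ) := by
    calc _ ≤ 4 * (1 + 2 * A * b) * (n * Λ) := mul_le_mul_of_nonneg_left htr (by linarith)
      _ ≤ _ := mul_le_mul_of_nonneg_right (by linarith) (by positivity)
  rw [hrhs]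
  calc C * (Q + ∑ i, |ε * ((1 + 2 * A * b) * q1 i)|)
      ≤ C * (2 * ε * d ^ 2 + ε * (6 * n * d)) :=
        mul_le_mul_of_nonneg_left (add_le_add hQ hlhs) hC
    _ < ε * (C * (2 * d ^ 2 + 6 * n * d) + 1) := by linarith
    _ ≤ _ := mul_le_mul_of_nonneg_left (by linarith) hε.le

/-- A form of the Hopf lemma and the strong maximum principle. -/
theorem TouchingSupersolution.eq_zero {c : EuclideanSpace ℝ (Fin n) → Fin n → Fin n → ℝ}
    {Q : EuclideanSpace ℝ (Fin n) → ℝ} {C Λ r : ℝ} {z : EuclideanSpace ℝ (Fin n)}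
    (hQ : TouchingSupersolution c Q C (ball z r)) (hC : 0 ≤ C) (hΛ : 0 < Λ) (hr : 0 < r)
    (hell : ∀ x ∈ ball z r, ∀ ξ : Fin n → ℝ,
      Λ⁻¹ * ∑ i, ξ i ^ 2 ≤ ∑ i, ∑ j, c x i j * ξ i * ξ j)
    (hell' : ∀ x ∈ ball z r, ∀ ξ : Fin n → ℝ,
      ∑ i, ∑ j, c x i j * ξ i * ξ j ≤ Λ * ∑ i, ξ i ^ 2)
    (hQc : ContinuousOn Q (closedBall z r)) (hQ0 : ∀ x ∈ closedBall z r, 0 ≤ Q x)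
    (hz : Q z = 0) {y : EuclideanSpace ℝ (Fin n)} (hy : y ∈ ball z (r / 2)) : Q y = 0 := by
  by_contra hne
  have hzD : z ∈ closedBall z r := mem_closedBall_self hr.le
  have hZ : IsCompact (closedBall z r ∩ Q ⁻¹' {0}) :=
    (isCompact_closedBall z r).of_isClosed_subset
      (hQc.preimage_isClosed_of_isClosed isClosed_closedBall isClosed_singleton)
      Set.inter_subset_left
  obtain ⟨x0, ⟨hx0D, hx0⟩, hmin0⟩ := hZ.exists_isMinOn ⟨z, hzD, hz⟩
    (f := fun x => dist x y) (by fun_prop)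
  have hx0Q : Q x0 = 0 := hx0
  obtain ⟨d, hd⟩ : ∃ d, dist x0 y = d := ⟨_, rfl⟩
  have hnear : ∀ x ∈ closedBall z r, dist x y < d → 0 < Q x := fun x hx hxy =>
    (hQ0 x hx).lt_of_ne fun h => not_lt.2 (isMinOn_iff.1 hmin0 x ⟨hx, h.symm⟩) (by rwa [hd])
  have hd0 : 0 < d := by
    rw [← hd]
    exact dist_pos.2 fun h => hne (h ▸ hx0Q)
  have hyz : dist y z < r / 2 := hy
  have hdr : d < r / 2 := by
    have := isMinOn_iff.1 hmin0 z ⟨hzD, hz⟩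
    rw [hd, dist_comm] at this
    exact this.trans_lt hyz
  have hx0z : dist x0 z < r := by linarith [dist_triangle x0 y z]
  obtain ⟨A, hA⟩ : ∃ A, A = Λ * (6 * n * Λ + C * (2 * d ^ 2 + 6 * n * d) + 1) / (2 * d ^ 2) :=
    ⟨_, rfl⟩
  have hA0 : 0 < A := by rw [hA]; positivity
  obtain ⟨s, hs0, hs1, hs2, hs3⟩ :
      ∃ s, 0 < s ∧ s ≤ d / 4 ∧ A * (3 * d * s) ≤ 1 / 4 ∧ dist x0 z + s < r := by
    refine ⟨min (d / 4) (min (1 / (12 * A * d)) ((r - dist x0 z) / 2)), ?_, min_le_left _ _, ?_, ?_⟩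
    · have : 0 < r - dist x0 z := by linarith
      positivity
    · calc _ ≤ A * (3 * d * (1 / (12 * A * d))) := by
            gcongr
            exact (min_le_right _ _).trans (min_le_left _ _)
        _ = _ := by
            field_simp
            norm_num
    · have := (min_le_right (d / 4) _).trans
        (min_le_right (1 / (12 * A * d)) ((r - dist x0 z) / 2))
      linarith
  have hsub : closedBall x0 s ⊆ ball z r := fun x hx => by
    have : dist x x0 ≤ s := hx
    exact mem_ball.2 (by linarith [dist_triangle x x0 z])
  have hsub' : closedBall x0 s ⊆ closedBall z r := hsub.trans ball_subset_closedBall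
  set q := barrier (d ^ 2) y x0 with hq
  have hbar := hasHessianOn_barrier (d ^ 2) y x0
  have hqc : Continuous q := by
    rw [hq]
    unfold barrier
    fun_prop
  have hAq : ∀ x ∈ closedBall x0 s, |A * q x| ≤ 1 / 4 := fun x hx => by
    rw [abs_mul, abs_of_pos hA0]
    exact (mul_le_mul_of_nonneg_left (norm_barrier_bounds hd hs1 hx).2.2 hA0.le).trans hs2
  have hqd : ∀ x, q x ≤ d ^ 2 := fun x => by
    rw [hq, barrier]
    linarith [sq_nonneg ‖x - y‖, sq_nonneg ‖x - x0‖]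
  obtain ⟨m, hm0, hm⟩ : ∃ m, 0 < m ∧ ∀ x ∈ sphere x0 s ∩ {x | 0 ≤ q x}, m ≤ Q x := by
    refine IsCompact.exists_forall_le' ((isCompact_sphere x0 s).inter_right
      (isClosed_le continuous_const hqc))
      (hQc.mono fun x hx => hsub' (sphere_subset_closedBall hx.1))
      fun x hx => hnear x (hsub' (sphere_subset_closedBall hx.1)) ?_
    have h1 : 0 ≤ d ^ 2 - ‖x - y‖ ^ 2 - ‖x - x0‖ ^ 2 := hx.2
    have h2 : ‖x - x0‖ = s := by rw [← dist_eq_norm]; exact hx.1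
    rw [h2] at h1
    rw [dist_eq_norm]
    exact lt_of_pow_lt_pow_left₀ 2 hd0.le (by nlinarith)
  obtain ⟨ε, hε⟩ : ∃ ε, ε = m / (2 * d ^ 2) := ⟨_, rfl⟩
  have hε0 : 0 < ε := by rw [hε]; positivity
  have hεm : 2 * ε * d ^ 2 = m := by
    rw [hε]
    field_simp
  set φ := fun x => ε * (q x * (1 + A * q x)) with hφ
  have hφc : Continuous φ := by fun_prop
  have hφle : ∀ x ∈ closedBall x0 s, 0 ≤ q x → φ x < m := fun x hx h0 => by
    have h1 := abs_le.1 (hAq x hx)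
    have h2 : q x * (1 + A * q x) ≤ d ^ 2 * (5 / 4) :=
      mul_le_mul (hqd x) (by linarith) (by linarith) (by positivity)
    have h3 := mul_le_mul_of_nonneg_left h2 hε0.le
    have h4 : 0 < ε * d ^ 2 := by positivity
    simp only [hφ]
    linarith
  have hφneg : ∀ x ∈ closedBall x0 s, q x < 0 → φ x < 0 := fun x hx h0 => by
    have h1 := abs_le.1 (hAq x hx)
    exact mul_neg_of_pos_of_neg hε0 (mul_neg_of_neg_of_pos h0 (by linarith))
  obtain ⟨x1, hx1, hmin1⟩ := (isCompact_closedBall x0 s).exists_isMinOn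
    ⟨x0, mem_closedBall_self hs0.le⟩ ((hQc.mono hsub').sub hφc.continuousOn)
  have hle : Q x1 ≤ φ x1 := by
    have h1 := isMinOn_iff.1 hmin1 x0 (mem_closedBall_self hs0.le)
    have h2 : q x0 = 0 := by
      rw [hq, barrier, ← dist_eq_norm, hd]
      simp
    simpa [hφ, hx0Q, h2] using h1
  have hx1b : x1 ∈ ball x0 s := by
    refine (mem_closedBall.1 hx1).lt_of_ne fun h => ?_
    rcases le_or_gt 0 (q x1) with h0 | h0
    · exact absurd (hm x1 ⟨h, h0⟩) (not_le.2 (hle.trans_lt (hφle x1 hx1 h0)))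
    · exact absurd (hQ0 x1 (hsub' hx1)) (not_le.2 (hle.trans_lt (hφneg x1 hx1 h0)))
  have hlm : IsLocalMin (fun x => Q x - φ x) x1 :=
    hmin1.isLocalMin (mem_of_superset (isOpen_ball.mem_nhds hx1b) ball_subset_closedBall)
  have hbnd := norm_barrier_bounds hd hs1 hx1
  have hP1 : d ^ 2 ≤ ∑ i, barrierGrad y x0 x1 i ^ 2 := by
    rw [sum_barrierGrad_sq]
    nlinarith [hbnd.1]
  have hP2 : ∑ i, barrierGrad y x0 x1 i ^ 2 ≤ (4 * d) ^ 2 := by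
    rw [sum_barrierGrad_sq]
    nlinarith [hbnd.2.1, norm_nonneg ((x1 - y) + (x1 - x0))]
  have hA1 := hAq x1 hx1
  have hφH := hbar.quadratic_comp ε A
  rcases (hQ0 x1 (hsub' hx1)).eq_or_lt with h0 | h0
  · have hg := hQ.grad x1 (hsub hx1) _ _ _ hφH hlm h0.symm
    have hg0 : ∀ i, barrierGrad y x0 x1 i = 0 := fun i => by
      have h1 := abs_le.1 hA1
      have h2 : 0 < 1 + 2 * A * q x1 := by linarith
      exact (mul_eq_zero.1 ((mul_eq_zero.1 (hg i)).resolve_left hε0.ne')).resolve_left h2.ne'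
    simp only [hg0, ne_eq, OfNat.ofNat_ne_zero, not_false_eq_true, zero_pow,
      Finset.sum_const_zero] at hP1
    linarith [pow_pos hd0 2]
  · have hcont : ∀ i j, Continuous fun x => ε * ((1 + 2 * A * q x) * (if i = j then -4 else 0)
        + 2 * A * (barrierGrad y x0 x i * barrierGrad y x0 x j)) := fun i j => by
      unfold barrierGrad
      fun_prop
    have hg := hQ.hess x1 (hsub hx1) _ _ _ hφH hcont hlm h0
    have hq0 : 0 ≤ q x1 := by
      by_contra! h
      linarith [hφneg x1 hx1 h]
    exact absurd hg (not_le.2 (lt_sum_mul_hess_barrier hΛ hC hd0 hε0 hA (hell x1 (hsub hx1))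
      (hell' x1 (hsub hx1)) hA1 hP1 hP2 (by linarith [hφle x1 hx1 hq0])))

end

/-- constant rank theorem of Bian–Guan, Corollary 1.2 of the paper.
Let `B` be the open unit ball of `ℝⁿ`, let `F(A,p,u,x)` be `C²` on
`Symₙ(ℝ) × ℝⁿ × ℝ × B` and satisfy the Bian–Guan structure condition: for each fixed
`p`, the map `(A,u,x) ↦ F(A⁻¹,p,u,x)` is locally convex on `Sym⁺ₙ(ℝ) × ℝ × B`.  If
`u ∈ C³(B)` is a convex solution of `F(D²u,Du,u,x) = 0` on `B` which is uniformly
elliptic with constant `Λ > 0`, then the Hessian `D²u` has constant rank on `B`. -/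
theorem constant_rank (n : ℕ) (Λ : ℝ) (hΛ : 0 < Λ)
    (F : (Fin n → Fin n → ℝ) × (Fin n → ℝ) × ℝ × EuclideanSpace ℝ (Fin n) → ℝ)
    (u : EuclideanSpace ℝ (Fin n) → ℝ)
    (hF : ContDiffOn ℝ 2 F {z | z.2.2.2 ∈ ball (0 : EuclideanSpace ℝ (Fin n)) 1})
    (hconv : ∀ p : Fin n → ℝ,
      ∀ z ∈ {w : (Fin n → Fin n → ℝ) × ℝ × EuclideanSpace ℝ (Fin n) |
          (Matrix.of w.1).PosDef ∧ w.2.2 ∈ ball (0 : EuclideanSpace ℝ (Fin n)) 1},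
        ∃ t, IsOpen t ∧ z ∈ t ∧
          ConvexOn ℝ
            ({w : (Fin n → Fin n → ℝ) × ℝ × EuclideanSpace ℝ (Fin n) |
                (Matrix.of w.1).PosDef ∧
                  w.2.2 ∈ ball (0 : EuclideanSpace ℝ (Fin n)) 1} ∩ t)
            (fun w => F (fun i j => (Matrix.of w.1)⁻¹ i j, p, w.2.1, w.2.2)))
    (hu : ContDiffOn ℝ 3 u (ball 0 1))
    (huc : ConvexOn ℝ (ball 0 1) u)
    (heq : ∀ x ∈ ball (0 : EuclideanSpace ℝ (Fin n)) 1,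
      F (fun i j => hessM u x i j, fun l => pd u x l, u x, x) = 0)
    (hell : ∀ x ∈ ball (0 : EuclideanSpace ℝ (Fin n)) 1, ∀ ξ : Fin n → ℝ,
      Λ⁻¹ * ∑ i, ξ i ^ 2 ≤ ∑ i, ∑ j, Fmat F u x i j * ξ i * ξ j ∧
      ∑ i, ∑ j, Fmat F u x i j * ξ i * ξ j ≤ Λ * ∑ i, ξ i ^ 2) :
    ∀ x ∈ ball (0 : EuclideanSpace ℝ (Fin n)) 1,
      ∀ y ∈ ball (0 : EuclideanSpace ℝ (Fin n)) 1,
        (hessM u x).rank = (hessM u y).rank := by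
  rcases Nat.eq_zero_or_pos n with rfl | hn
  · intro x _ y _
    rw [Subsingleton.elim (hessM u x) (hessM u y)]
  have hs := isSolutionJet_of_contDiffOn isOpen_ball hF hu heq
  have hH : ∀ x ∈ ball (0 : EuclideanSpace ℝ (Fin n)) 1, (hessM u x).PosSemidef := fun x hx => by
    refine Matrix.PosSemidef.of_dotProduct_mulVec_nonneg ?_ fun ξ => ?_
    · ext i j
      exact hs.symm_H x hx j i
    · rw [star_trivial, dotProduct_mulVec_eq_sum]
      simp only [← mul_assoc]
      exact huc.sum_hessian_nonneg isOpen_ball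
        ⟨fun y hy => (hs.strict_u y hy).hasFDerivAt,
          fun y hy i => by
            have := (hs.strict_p y hy i).hasFDerivAt
            simpa only [hs.symm_H y hy _ i] using this⟩ hx ξ
  have hsymb : ∀ x ∈ ball (0 : EuclideanSpace ℝ (Fin n)) 1, ∀ ξ : Fin n → ℝ,
      ∑ i, ∑ j, Fmat F u x i j * ξ i * ξ j = ∑ i, ∑ j,
        symbolF F (jetPt u (fun x b => pd u x b) (hessM u) x) i j * ξ i * ξ j := fun x hx ξ => by
    rw [sum_symbolF_quad]
    simp only [Fmat_eq_fderiv ((hs.contDiffAt_F hx).differentiableAt two_ne_zero)]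
  have hell1 := fun x hx ξ => (hsymb x hx ξ) ▸ (hell x hx ξ).1
  have hell2 := fun x hx ξ => (hsymb x hx ξ) ▸ (hell x hx ξ).2
  have hloc : ContinuousOn (fun x => (hessM u x).rank) (ball 0 1) := fun x hx => by
    obtain ⟨r, Q, C, k, hr, hC, hrB, hQc, hQ0, hQx, hk, hQ⟩ :=
      hs.exists_touchingSupersolution hconv hH hΛ hell1 hn hx
    have hsub : ball x r ⊆ ball 0 1 := ball_subset_closedBall.trans hrB
    have hrank : ∀ y ∈ ball x (r / 2), (hessM u y).rank = k := fun y hy =>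
      hk y (ball_subset_closedBall (ball_subset_ball (half_le_self hr.le) hy))
        (hQ.eq_zero hC hΛ hr (fun z hz => hell1 z (hsub hz)) (fun z hz => hell2 z (hsub hz))
          hQc hQ0 hQx hy)
    refine (continuousAt_const (y := k)).continuousWithinAt.congr_of_eventuallyEq ?_
      (hrank x (mem_ball_self (half_pos hr)))
    filter_upwards [nhdsWithin_le_nhds (ball_mem_nhds x (half_pos hr))] with y hy using hrank y hy
  intro x hx y hy
  exact (convex_ball (0 : EuclideanSpace ℝ (Fin n)) 1).isPreconnected.constant hloc hx hy
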